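/- Assume the standing hypotheses on μ. For every δ > 0 there exists r₀ > 0 such that for all 0 < r ≤ r₀ there is an orthonormal basis (x₁,x₂,x₃,x₄) of ℝ⁴ in which the second-moment matrix entries q_{ij} = (5/(ω₃ r⁵)) ∫_{B(0,r)} wᵢwⱼ dμ(w) satisfy |q_{ii} − 1/2| < δ for i = 1,2,3, |q₄₄ − 3/2| < δ, and |q_{ij}| < δ for all i ≠ j. -/

import Mathlib

open Metric Set MeasureTheory Filter Module
open scoped RealInnerProductSpace Topology Pointwise ENNReal

noncomputable section

/-- `ℝⁿ` as a Euclidean space. -/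
abbrev E (n : ℕ) : Type := EuclideanSpace ℝ (Fin n)

/-- `d(A,B) = sup_{a ∈ A} inf_{b ∈ B} |a - b|`. -/
def setD {n : ℕ} (A B : Set (E n)) : ℝ := ⨆ a ∈ A, Metric.infDist a B

/-- `d^{x,r}(A,B) = (1/r) d(A ∩ B(x,r), B ∩ B(x,r))`. -/
def dxr {n : ℕ} (x : E n) (r : ℝ) (A B : Set (E n)) : ℝ :=
  (1 / r) * setD (A ∩ closedBall x r) (B ∩ closedBall x r)

/-- `D^{x,r}(A,B) = max(d^{x,r}(A,B), d^{x,r}(B,A))`. -/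
def Dxr {n : ℕ} (x : E n) (r : ℝ) (A B : Set (E n)) : ℝ :=
  max (dxr x r A B) (dxr x r B A)

/-- `d̃^{x,r}(A,B) = (1/r) d(A ∩ B(x,r), B)`. -/
def dtxr {n : ℕ} (x : E n) (r : ℝ) (A B : Set (E n)) : ℝ :=
  (1 / r) * setD (A ∩ closedBall x r) B

/-- `D̃^{x,r}(A,B) = max(d̃^{x,r}(A,B), d̃^{x,r}(B,A))`. -/
def Dtxr {n : ℕ} (x : E n) (r : ℝ) (A B : Set (E n)) : ℝ :=
  max (dtxr x r A B) (dtxr x r B A)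

/-- `C` is a cone based at `y`: `y ∈ C` and `s • (C − y) = C − y` for all `s > 0`. -/
def IsConeAt {n : ℕ} (y : E n) (C : Set (E n)) : Prop :=
  y ∈ C ∧ ∀ s : ℝ, 0 < s → s • {z : E n | y + z ∈ C} = {z : E n | y + z ∈ C}

/-- The standard KP cone `{x₄² = x₁² + x₂² + x₃²}` in `ℝⁿ`, `n ≥ 4`. -/
def stdKP (n : ℕ) (hn : 4 ≤ n) : Set (E n) :=
  {x : E n | (x ⟨3, by omega⟩) ^ 2 =
    (x ⟨0, by omega⟩) ^ 2 + (x ⟨1, by omega⟩) ^ 2 + (x ⟨2, by omega⟩) ^ 2}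

/-- `C` is a KP cone based at `y`: in some orthonormal coordinates centered at the origin,
`C − y` is the standard KP cone. -/
def IsKPCone {n : ℕ} (hn : 4 ≤ n) (y : E n) (C : Set (E n)) : Prop :=
  ∃ f : E n ≃ₗᵢ[ℝ] E n, {z : E n | y + z ∈ C} = f ⁻¹' stdKP n hn

/-- `θ^P_Σ(x,r)` : best approximation of `S` in `B(x,r)` by affine `m`-planes through `x`. -/
def thetaP {n : ℕ} (m : ℕ) (S : Set (E n)) (x : E n) (r : ℝ) : ℝ :=
  ⨅ L : {L : AffineSubspace ℝ (E n) // x ∈ L ∧ Module.finrank ℝ L.direction = m},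
    Dxr x r S (L.1 : Set (E n))

/-- `θ^C_Σ(x,r)` : best approximation of `S` in `B(x,r)` by KP cones based at `x`. -/
def thetaC {n : ℕ} (hn : 4 ≤ n) (S : Set (E n)) (x : E n) (r : ℝ) : ℝ :=
  ⨅ C : {C : Set (E n) // IsKPCone hn x C}, Dxr x r S C.1

/-- `ϑ^C_Σ(x,r)` : best approximation of `S` in `B(x,r)` by KP cones containing `x`. -/
def varthetaC {n : ℕ} (hn : 4 ≤ n) (S : Set (E n)) (x : E n) (r : ℝ) : ℝ :=
  ⨅ C : {C : Set (E n) // (∃ y, IsKPCone hn y C) ∧ x ∈ C}, Dxr x r S C.1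

/-- The angle `∠(P₁,P₂) = arcsin Γ(P₁,P₂)` between two affine planes. -/
def planeAngle {n : ℕ} (P₁ P₂ : AffineSubspace ℝ (E n)) : ℝ :=
  Real.arcsin (dxr (0 : E n) 1 (P₁.direction : Set (E n)) (P₂.direction : Set (E n)))

/-- The support of a measure. -/
def msupp {n : ℕ} (μ : Measure (E n)) : Set (E n) :=
  {x : E n | ∀ r : ℝ, 0 < r → 0 < μ (closedBall x r)}

/-- Weak convergence of a sequence of measures in the sense of Radon measures. -/
def VagueTendsto {n : ℕ} (μs : ℕ → Measure (E n)) (ν : Measure (E n)) : Prop :=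
  ∀ f : E n → ℝ, Continuous f → HasCompactSupport f →
    Tendsto (fun i => ∫ y, f y ∂(μs i)) atTop (nhds (∫ y, f y ∂ν))

/-- `ν` is a tangent measure of `μ` at `x`: `ν ≠ 0` and for some `rᵢ ↓ 0`, `cᵢ > 0`,
`cᵢ (T_{x,rᵢ})₊μ → ν` weakly. -/
def IsTangentMeasure {n : ℕ} (μ ν : Measure (E n)) (x : E n) : Prop :=
  ν ≠ 0 ∧ ∃ r c : ℕ → ℝ, (∀ i, 0 < r i) ∧ Tendsto r atTop (nhds 0) ∧ (∀ i, 0 < c i) ∧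
    VagueTendsto (fun i => ENNReal.ofReal (c i) • Measure.map (fun y => (r i)⁻¹ • (y - x)) μ) ν

/-- `μ` is `m`-asymptotically optimally doubling. -/
def AOD {n : ℕ} (m : ℕ) (μ : Measure (E n)) : Prop :=
  ∀ K : Set (E n), K ⊆ msupp μ → IsCompact K → ∀ δ : ℝ, 0 < δ →
    ∃ r₀ : ℝ, 0 < r₀ ∧ ∀ x ∈ K, ∀ r : ℝ, 0 < r → r ≤ r₀ →
      ∀ τ : ℝ, τ ∈ Set.Icc (1/2 : ℝ) 1 →
        |(μ (closedBall x (τ * r))).toReal / (μ (closedBall x r)).toReal - τ ^ m| < δ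

/-- `ν` is `m`-flat: `m`-dimensional Hausdorff measure restricted to an affine `m`-plane. -/
def IsFlatMeasure {n : ℕ} (m : ℕ) (ν : Measure (E n)) : Prop :=
  ∃ L : AffineSubspace ℝ (E n), (L : Set (E n)).Nonempty ∧
    Module.finrank ℝ L.direction = m ∧
    ν = (Measure.hausdorffMeasure (m : ℝ)).restrict (L : Set (E n))

/-- Volume of the unit ball in `ℝᵐ`. -/
def unitBallVol (m : ℕ) : ℝ := (volume (Metric.ball (0 : EuclideanSpace ℝ (Fin m)) 1)).toReal

/-- `ω₃`, the volume of the unit `3`-ball. -/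
def omega3 : ℝ := unitBallVol 3

/-- The second moment `Q_{0,r}` of a measure on `ℝ⁴`. -/
def Qmom (μ : Measure (E 4)) (r : ℝ) (z : E 4) : ℝ :=
  (5 / (omega3 * r ^ 5)) * ∫ w in closedBall (0 : E 4) r, ⟪z, w⟫ ^ 2 ∂μ

/-- Entries `q_{ij}` of the second moment matrix in given directions. -/
def qmom (μ : Measure (E 4)) (r : ℝ) (u v : E 4) : ℝ :=
  (5 / (omega3 * r ^ 5)) * ∫ w in closedBall (0 : E 4) r, ⟪u, w⟫ * ⟪v, w⟫ ∂μ

/-- `μ` is `(α,m)`-Hölder asymptotically uniform. -/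
def HolderAsympUniform {n : ℕ} (α : ℝ) (m : ℕ) (μ : Measure (E n)) : Prop :=
  ∀ K : Set (E n), K ⊆ msupp μ → IsCompact K →
    ∃ C r₀ : ℝ, 0 < r₀ ∧ ∀ x ∈ K, ∀ r : ℝ, 0 < r → r ≤ r₀ →
      |(μ (closedBall x r)).toReal / (unitBallVol m * r ^ m) - 1| ≤ C * r ^ α

/-- `φ` is a `C^{1,β}` diffeomorphism from `U` onto `U'`: a continuously differentiable bijection
with `β`-Hölder derivative whose inverse is also `C^{1,β}`. -/
def IsC1HolderDiffeoOn (β : ℝ) (U U' : Set (E 4)) (φ : E 4 → E 4) : Prop :=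
  Set.BijOn φ U U' ∧
  (∀ x ∈ U, HasFDerivAt φ (fderiv ℝ φ x) x) ∧
  (∃ M : ℝ, ∀ x ∈ U, ∀ y ∈ U, ‖fderiv ℝ φ x - fderiv ℝ φ y‖ ≤ M * ‖x - y‖ ^ β) ∧
  ∃ ψ : E 4 → E 4, Set.BijOn ψ U' U ∧
    (∀ x ∈ U, ψ (φ x) = x) ∧ (∀ y ∈ U', φ (ψ y) = y) ∧
    (∀ y ∈ U', HasFDerivAt ψ (fderiv ℝ ψ y) y) ∧
    (∃ M : ℝ, ∀ x ∈ U', ∀ y ∈ U', ‖fderiv ℝ ψ x - fderiv ℝ ψ y‖ ≤ M * ‖x - y‖ ^ β)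

lemma omega3_pos : 0 < omega3 := by
  unfold omega3 unitBallVol
  exact ENNReal.toReal_pos (Metric.measure_ball_pos _ _ one_pos).ne' measure_ball_lt_top.ne

lemma msupp_eq {n : ℕ} (μ : Measure (E n)) : msupp μ = μ.support := by
  ext x
  rw [Metric.nhds_basis_closedBall.mem_measureSupport]
  rfl

lemma msupp_closed {n : ℕ} (μ : Measure (E n)) : IsClosed (msupp μ) := by
  rw [msupp_eq]; exact Measure.isClosed_support

lemma ae_msupp {n : ℕ} (μ : Measure (E n)) : ∀ᵐ z ∂μ, z ∈ msupp μ := by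
  rw [msupp_eq]; exact Measure.support_mem_ae

lemma exists_msupp_of_pos {n : ℕ} {μ : Measure (E n)} {s : Set (E n)} (h : 0 < μ s) :
    ∃ x ∈ s, x ∈ msupp μ := by
  rw [msupp_eq]; exact Measure.nonempty_inter_support_of_pos h

/-- Uniform measures with `0` in the support. -/
structure Unif (ν : Measure (E 4)) : Prop where
  lf : IsLocallyFiniteMeasure ν
  z : (0 : E 4) ∈ msupp ν
  u : ∀ x ∈ msupp ν, ∀ r : ℝ, 0 < r → ν.real (closedBall x r) = omega3 * r ^ 3

/-- Rescaling. -/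
def resc (ν : Measure (E 4)) (x : E 4) (r : ℝ) : Measure (E 4) :=
  ENNReal.ofReal ((r⁻¹) ^ 3) • Measure.map (fun y => r⁻¹ • (y - x)) ν

lemma resc_meas (x : E 4) (r : ℝ) : Measurable (fun y : E 4 => r⁻¹ • (y - x)) := by fun_prop

lemma resc_pre (x y : E 4) {r : ℝ} (hr : 0 < r) (ρ : ℝ) :
    (fun y : E 4 => r⁻¹ • (y - x)) ⁻¹' closedBall y ρ = closedBall (x + r • y) (r * ρ) := by
  ext z
  simp only [mem_preimage, mem_closedBall, dist_eq_norm]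
  have h : z - (x + r • y) = r • (r⁻¹ • (z - x) - y) := by
    rw [smul_sub, smul_smul, mul_inv_cancel₀ hr.ne', one_smul]; abel
  rw [h, norm_smul, Real.norm_of_nonneg hr.le, mul_le_mul_iff_right₀ hr]

lemma resc_ball (ν : Measure (E 4)) (x y : E 4) {r : ℝ} (hr : 0 < r) (ρ : ℝ) :
    resc ν x r (closedBall y ρ)
      = ENNReal.ofReal ((r⁻¹) ^ 3) * ν (closedBall (x + r • y) (r * ρ)) := by
  rw [resc, Measure.smul_apply, Measure.map_apply (resc_meas x r) measurableSet_closedBall,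
    resc_pre x y hr, smul_eq_mul]

lemma resc_real (ν : Measure (E 4)) (x y : E 4) {r : ℝ} (hr : 0 < r) (ρ : ℝ) :
    (resc ν x r).real (closedBall y ρ) = (r⁻¹) ^ 3 * ν.real (closedBall (x + r • y) (r * ρ)) := by
  rw [Measure.real, resc_ball ν x y hr, ENNReal.toReal_mul, ENNReal.toReal_ofReal (by positivity)]
  rfl

lemma resc_msupp (ν : Measure (E 4)) (x y : E 4) {r : ℝ} (hr : 0 < r) :
    y ∈ msupp (resc ν x r) ↔ x + r • y ∈ msupp ν := by
  have h0 : 0 < ENNReal.ofReal ((r⁻¹) ^ 3) := by rw [ENNReal.ofReal_pos]; positivity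
  constructor
  · intro h ρ hρ
    have := h (ρ / r) (by positivity)
    rw [resc_ball ν x y hr, mul_div_cancel₀ _ hr.ne'] at this
    exact pos_of_ne_zero (right_ne_zero_of_mul this.ne')
  · intro h ρ hρ
    rw [resc_ball ν x y hr]
    exact ENNReal.mul_pos h0.ne' (h _ (by positivity)).ne'

lemma resc_lf (ν : Measure (E 4)) [IsLocallyFiniteMeasure ν] (x : E 4) {r : ℝ} (hr : 0 < r) :
    IsLocallyFiniteMeasure (resc ν x r) := by
  refine ⟨fun y => ⟨closedBall y 1, closedBall_mem_nhds _ one_pos, ?_⟩⟩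
  rw [resc_ball ν x y hr]
  exact ENNReal.mul_lt_top ENNReal.ofReal_lt_top (isCompact_closedBall _ _).measure_lt_top

lemma resc_int (ν : Measure (E 4)) (x : E 4) {r : ℝ} (hr : 0 < r) (f : E 4 → ℝ)
    (hf : Continuous f) :
    ∫ z, f z ∂(resc ν x r) = (r⁻¹) ^ 3 * ∫ z, f (r⁻¹ • (z - x)) ∂ν := by
  rw [resc, integral_smul_measure, ENNReal.toReal_ofReal (by positivity),
    integral_map (resc_meas x r).aemeasurable hf.aestronglyMeasurable, smul_eq_mul]

lemma Unif.resc {ν : Measure (E 4)} (h : Unif ν) {x : E 4} (hx : x ∈ msupp ν) {r : ℝ}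
    (hr : 0 < r) : Unif (resc ν x r) := by
  have := h.lf
  refine ⟨resc_lf ν x hr, ?_, ?_⟩
  · rw [resc_msupp ν x 0 hr]; simpa using hx
  · intro y hy ρ hρ
    rw [resc_msupp ν x y hr] at hy
    rw [resc_real ν x y hr, h.u _ hy _ (by positivity)]
    field_simp

lemma resc_resc (ν : Measure (E 4)) {r s : ℝ} (hr : 0 < r) (hs : 0 < s) :
    resc (resc ν 0 r) 0 s = resc ν 0 (r * s) := by
  unfold resc
  rw [Measure.map_smul, smul_smul, Measure.map_map (resc_meas 0 s) (resc_meas 0 r)]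
  congr 1
  · rw [← ENNReal.ofReal_mul (by positivity)]; congr 1; rw [mul_inv]; ring
  · congr 1
    funext y
    simp [smul_smul, mul_comm]

lemma resc_one (ν : Measure (E 4)) : resc ν 0 1 = ν := by
  unfold resc
  simp


/-- cutoff. -/
def cut (x : E 4) (a b : ℝ) (z : E 4) : ℝ := max 0 (min 1 ((b - dist z x) / (b - a)))

lemma cut_cont (x : E 4) (a b : ℝ) : Continuous (cut x a b) := by
  unfold cut; fun_prop

lemma cut_nonneg (x : E 4) (a b : ℝ) (z : E 4) : 0 ≤ cut x a b z := le_max_left _ _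

lemma cut_le_one (x : E 4) (a b : ℝ) (z : E 4) : cut x a b z ≤ 1 := by
  unfold cut; exact max_le zero_le_one (min_le_left _ _)

lemma cut_eq_one {x : E 4} {a b : ℝ} (hab : a < b) {z : E 4} (hz : z ∈ closedBall x a) :
    cut x a b z = 1 := by
  unfold cut
  rw [mem_closedBall] at hz
  have : 1 ≤ (b - dist z x) / (b - a) := by rw [le_div_iff₀ (by linarith)]; linarith
  rw [min_eq_left this]; simp

lemma cut_eq_zero {x : E 4} {a b : ℝ} (hab : a < b) {z : E 4} (hz : z ∉ closedBall x b) :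
    cut x a b z = 0 := by
  unfold cut
  rw [mem_closedBall, not_le] at hz
  have : (b - dist z x) / (b - a) ≤ 0 := div_nonpos_of_nonpos_of_nonneg (by linarith) (by linarith)
  exact max_eq_left ((min_le_right _ _).trans this)

lemma cut_supp {x : E 4} {a b : ℝ} (hab : a < b) : HasCompactSupport (cut x a b) :=
  HasCompactSupport.intro (isCompact_closedBall x b) fun _ hz => cut_eq_zero hab hz

lemma le_int_cut (μ : Measure (E 4)) [IsLocallyFiniteMeasure μ] {x : E 4} {a b : ℝ} (hab : a < b) :
    μ.real (closedBall x a) ≤ ∫ z, cut x a b z ∂μ := by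
  rw [← integral_indicator_one measurableSet_closedBall]
  apply integral_mono
  · exact (integrable_indicator_iff measurableSet_closedBall).2
      (integrableOn_const (isCompact_closedBall _ _).measure_lt_top.ne)
  · exact (cut_cont x a b).integrable_of_hasCompactSupport (cut_supp hab)
  · intro z
    by_cases hz : z ∈ closedBall x a
    · simp only [indicator_of_mem hz, Pi.one_apply]; exact (cut_eq_one hab hz).ge
    · simp only [indicator_of_notMem hz]; exact cut_nonneg _ _ _ _

lemma int_cut_le (μ : Measure (E 4)) [IsLocallyFiniteMeasure μ] {x : E 4} {a b : ℝ} (hab : a < b) :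
    ∫ z, cut x a b z ∂μ ≤ μ.real (closedBall x b) := by
  rw [← integral_indicator_one measurableSet_closedBall]
  apply integral_mono
  · exact (cut_cont x a b).integrable_of_hasCompactSupport (cut_supp hab)
  · exact (integrable_indicator_iff measurableSet_closedBall).2
      (integrableOn_const (isCompact_closedBall _ _).measure_lt_top.ne)
  · intro z
    by_cases hz : z ∈ closedBall x b
    · simp only [indicator_of_mem hz, Pi.one_apply]; exact cut_le_one _ _ _ _
    · simp only [indicator_of_notMem hz]; exact (cut_eq_zero hab hz).le

/-- ultralimit. -/
structure ULim {ι : Type} (U : Ultrafilter ι) (μs : ι → Measure (E 4)) (ν : Measure (E 4)) :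
    Prop where
  conv : ∀ f : E 4 → ℝ, Continuous f → HasCompactSupport f →
    Tendsto (fun i => ∫ z, f z ∂(μs i)) U (𝓝 (∫ z, f z ∂ν))
  supp : ∀ x, x ∈ msupp ν ↔ ∀ ε > 0, ∀ᶠ i in (U : Filter ι), ∃ y ∈ msupp (μs i), dist y x < ε

/-- asymptotically uniform. -/
structure AU {ι : Type} (U : Ultrafilter ι) (μs : ι → Measure (E 4)) : Prop where
  lf : ∀ i, IsLocallyFiniteMeasure (μs i)
  z : ∀ i, (0 : E 4) ∈ msupp (μs i)
  u : ∀ R ε : ℝ, 0 < R → 0 < ε → ∀ᶠ i in (U : Filter ι), ∀ x ∈ msupp (μs i), ‖x‖ ≤ R →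
    ∀ ρ : ℝ, 0 < ρ → ρ ≤ R → |(μs i).real (closedBall x ρ) - omega3 * ρ ^ 3| ≤ ε

lemma ultra_compact {ι X : Type} [TopologicalSpace X] (U : Ultrafilter ι) {K : Set X}
    (hK : IsCompact K) (F : ι → X) (h : ∀ᶠ i in (U : Filter ι), F i ∈ K) :
    ∃ x ∈ K, Tendsto F U (𝓝 x) :=
  hK.ultrafilter_le_nhds (U.map F) (le_principal_iff.2 h)

lemma AU.bdd {ι : Type} {U : Ultrafilter ι} {μs : ι → Measure (E 4)} (h : AU U μs)
    (f : E 4 → ℝ) (hf : Continuous f) (hc : HasCompactSupport f) :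
    ∃ L, Tendsto (fun i => ∫ z, f z ∂(μs i)) U (𝓝 L) := by
  obtain ⟨C, hC⟩ := hf.bounded_above_of_compact_support hc
  obtain ⟨R, hR⟩ := hc.isCompact.isBounded.subset_closedBall (0 : E 4)
  set R' := max R 1
  have hR' : 0 < R' := lt_max_of_lt_right one_pos
  have key : ∀ᶠ i in (U : Filter ι), (∫ z, f z ∂(μs i)) ∈
      closedBall (0 : ℝ) (C * (omega3 * R' ^ 3 + 1)) := by
    filter_upwards [h.u R' 1 hR' one_pos] with i hi
    have := h.lf i
    have h1 := hi 0 (h.z i) (by simpa using hR'.le) R' hR' le_rfl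
    rw [mem_closedBall_zero_iff]
    have h2 : ∫ z, f z ∂(μs i) = ∫ z in closedBall 0 R', f z ∂(μs i) := by
      refine (setIntegral_eq_integral_of_forall_compl_eq_zero fun x hx => ?_).symm
      by_contra h0
      exact hx (closedBall_subset_closedBall (le_max_left _ _) (hR (subset_tsupport f h0)))
    rw [h2]
    have hfin : (μs i) (closedBall 0 R') < ∞ := (isCompact_closedBall _ _).measure_lt_top
    refine (norm_setIntegral_le_of_norm_le_const hfin fun x _ => hC x).trans ?_
    have hC0 : 0 ≤ C := (norm_nonneg _).trans (hC 0)
    have := (abs_le.1 h1).2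
    gcongr
    linarith
  obtain ⟨L, _, hL⟩ := ultra_compact U (isCompact_closedBall _ _) _ key
  exact ⟨L, hL⟩

open CompactlySupported in
theorem AU.exists_ulim {ι : Type} {U : Ultrafilter ι} {μs : ι → Measure (E 4)} (h : AU U μs) :
    ∃ ν, Unif ν ∧ ULim U μs ν := by
  have hlf := h.lf
  choose L hL using fun f : C_c(E 4, ℝ) => h.bdd f f.continuous f.hasCompactSupport
  have hint : ∀ i (f : C_c(E 4, ℝ)), Integrable f (μs i) := fun i f =>
    f.continuous.integrable_of_hasCompactSupport f.hasCompactSupport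
  let Λ₀ : C_c(E 4, ℝ) →ₗ[ℝ] ℝ :=
    { toFun := L
      map_add' := fun f g => by
        refine tendsto_nhds_unique (hL (f + g)) (((hL f).add (hL g)).congr fun i => ?_)
        rw [← integral_add (hint i f) (hint i g)]; rfl
      map_smul' := fun c f => by
        refine tendsto_nhds_unique (hL (c • f)) (((hL f).const_mul c).congr fun i => ?_)
        rw [← integral_const_mul]; rfl }
  let Λ : C_c(E 4, ℝ) →ₚ[ℝ] ℝ := PositiveLinearMap.mk₀ Λ₀ (fun f hf => by
    refine ge_of_tendsto' (hL f) fun i => integral_nonneg fun z => hf z)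
  set ν := RealRMK.rieszMeasure Λ with hν
  have hνint : ∀ f : C_c(E 4, ℝ), ∫ z, f z ∂ν = L f := RealRMK.integral_rieszMeasure Λ
  have conv : ∀ f : E 4 → ℝ, Continuous f → HasCompactSupport f →
    Tendsto (fun i => ∫ z, f z ∂(μs i)) U (𝓝 (∫ z, f z ∂ν)) := by
    intro f hf hc
    have := hνint ⟨⟨f, hf⟩, hc⟩
    have h2 := hL ⟨⟨f, hf⟩, hc⟩
    rw [← this] at h2
    exact h2
  have hνlf : IsLocallyFiniteMeasure ν := by
    rw [hν]; infer_instance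
  have supp : ∀ x, x ∈ msupp ν ↔
      ∀ ε > 0, ∀ᶠ i in (U : Filter ι), ∃ y ∈ msupp (μs i), dist y x < ε := by
    intro x
    constructor
    · intro hx ε hε
      have h1 : 0 < ν.real (closedBall x (ε / 3)) :=
        ENNReal.toReal_pos (hx _ (by positivity)).ne' (isCompact_closedBall _ _).measure_lt_top.ne
      have hab : ε / 3 < ε / 2 := by linarith
      have h2 := h1.trans_le (le_int_cut ν (x := x) hab)
      filter_upwards [(conv _ (cut_cont x (ε / 3) (ε / 2)) (cut_supp hab)).eventually_const_lt h2]
        with i hi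
      have h3 := hi.trans_le (int_cut_le (μs i) hab)
      have h4 : 0 < (μs i) (closedBall x (ε / 2)) := by
        by_contra h0
        rw [not_lt, nonpos_iff_eq_zero] at h0
        simp [Measure.real, h0] at h3
      obtain ⟨y, hy1, hy2⟩ := exists_msupp_of_pos h4
      exact ⟨y, hy2, (mem_closedBall.1 hy1).trans_lt (by linarith)⟩
    · intro hx ρ hρ
      set s := min (ρ / 3) 1 with hs
      have hs0 : 0 < s := by positivity
      have hsρ : 3 * s ≤ ρ := by have := min_le_left (ρ / 3) 1; linarith
      have hR : 0 < ‖x‖ + 2 := by positivity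
      have ho : 0 < omega3 * s ^ 3 := mul_pos omega3_pos (by positivity)
      have hab : 2 * s < 3 * s := by linarith
      have h1 : omega3 * s ^ 3 / 2 ≤ ∫ z, cut x (2 * s) (3 * s) z ∂ν := by
        refine ge_of_tendsto (conv _ (cut_cont x _ _) (cut_supp hab)) ?_
        filter_upwards [hx s hs0, h.u (‖x‖ + 2) (omega3 * s ^ 3 / 2) hR (by positivity)]
          with i ⟨y, hy, hyx⟩ hi
        have hs1 : s ≤ 1 := min_le_right _ _
        have hyn : ‖y‖ ≤ ‖x‖ + 2 := by
          have := norm_le_norm_add_norm_sub' y x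
          rw [dist_eq_norm] at hyx
          linarith
        have h2 := hi y hy hyn s hs0 (by linarith [norm_nonneg x])
        have h3 := (abs_le.1 h2).1
        refine le_trans ?_ (le_int_cut (μs i) hab)
        have h4 : (μs i).real (closedBall y s) ≤ (μs i).real (closedBall x (2 * s)) := by
          refine measureReal_mono (closedBall_subset_closedBall' (by linarith)) ?_
          exact (isCompact_closedBall _ _).measure_lt_top.ne
        linarith
      have h2 := h1.trans (int_cut_le ν hab)
      have h3 : 0 < ν.real (closedBall x (3 * s)) := by linarith
      have h4 : 0 < ν (closedBall x (3 * s)) := by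
        by_contra h0
        rw [not_lt, nonpos_iff_eq_zero] at h0
        simp [Measure.real, h0] at h3
      exact h4.trans_le (measure_mono (closedBall_subset_closedBall hsρ))
  refine ⟨ν, ⟨hνlf, ?_, ?_⟩, conv, supp⟩
  · rw [supp]
    exact fun ε hε => Eventually.of_forall fun i => ⟨0, h.z i, by simpa using hε⟩
  · intro x hx r hr
    rw [supp] at hx
    -- approximations
    have hR : 0 < ‖x‖ + 2 * r + 3 := by positivity
    have bounds : ∀ ε : ℝ, 0 < ε → ε < 1 → 4 * ε < r →
        ν.real (closedBall x r) ≤ omega3 * (r + 2 * ε) ^ 3 + ε ∧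
        omega3 * (r - 2 * ε) ^ 3 - ε ≤ ν.real (closedBall x r) := by
      intro ε hε hε1 hεr
      have ev := (hx ε hε).and (h.u (‖x‖ + 2 * r + 3) ε hR hε)
      constructor
      · have hab : r < r + ε := by linarith
        refine (le_int_cut ν hab).trans (le_of_tendsto (conv _ (cut_cont x _ _) (cut_supp hab)) ?_)
        filter_upwards [ev] with i ⟨⟨y, hy, hyx⟩, hi⟩
        have hyn : ‖y‖ ≤ ‖x‖ + 2 * r + 3 := by
          have := norm_le_norm_add_norm_sub' y x
          rw [dist_eq_norm] at hyx
          linarith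
        have h2 := (abs_le.1 (hi y hy hyn (r + 2 * ε) (by linarith)
          (by linarith [norm_nonneg x]))).2
        refine (int_cut_le (μs i) hab).trans ?_
        have h4 : (μs i).real (closedBall x (r + ε)) ≤ (μs i).real (closedBall y (r + 2 * ε)) := by
          refine measureReal_mono (closedBall_subset_closedBall' (by rw [dist_comm]; linarith)) ?_
          exact (isCompact_closedBall _ _).measure_lt_top.ne
        linarith
      · have hab : r - ε < r := by linarith
        refine le_trans (ge_of_tendsto (conv _ (cut_cont x _ _) (cut_supp hab)) ?_)
          (int_cut_le ν hab)
        filter_upwards [ev] with i ⟨⟨y, hy, hyx⟩, hi⟩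
        have hyn : ‖y‖ ≤ ‖x‖ + 2 * r + 3 := by
          have := norm_le_norm_add_norm_sub' y x
          rw [dist_eq_norm] at hyx
          linarith
        have h2 := (abs_le.1 (hi y hy hyn (r - 2 * ε) (by linarith)
          (by linarith [norm_nonneg x]))).1
        refine le_trans ?_ (le_int_cut (μs i) hab)
        have h4 : (μs i).real (closedBall y (r - 2 * ε)) ≤ (μs i).real (closedBall x (r - ε)) := by
          refine measureReal_mono (closedBall_subset_closedBall' (by linarith)) ?_
          exact (isCompact_closedBall _ _).measure_lt_top.ne
        linarith
    have evs : ∀ᶠ ε : ℝ in 𝓝[>] 0, 0 < ε ∧ ε < 1 ∧ 4 * ε < r := by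
      have h1 : ∀ᶠ ε : ℝ in 𝓝[>] 0, ε < min 1 (r / 4) :=
        (eventually_lt_nhds (by positivity : (0 : ℝ) < min 1 (r / 4))).filter_mono
          nhdsWithin_le_nhds
      filter_upwards [h1, self_mem_nhdsWithin] with ε h1 h2
      exact ⟨h2, h1.trans_le (min_le_left _ _), by have := h1.trans_le (min_le_right _ _); linarith⟩
    apply le_antisymm
    · have ht : Tendsto (fun ε : ℝ => omega3 * (r + 2 * ε) ^ 3 + ε) (𝓝[>] 0)
          (𝓝 (omega3 * (r + 2 * 0) ^ 3 + 0)) := by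
        refine Tendsto.mono_left (Continuous.tendsto ?_ 0) nhdsWithin_le_nhds
        fun_prop
      simp only [mul_zero, add_zero] at ht
      exact ge_of_tendsto ht (evs.mono fun ε he => (bounds ε he.1 he.2.1 he.2.2).1)
    · have ht : Tendsto (fun ε : ℝ => omega3 * (r - 2 * ε) ^ 3 - ε) (𝓝[>] 0)
          (𝓝 (omega3 * (r - 2 * 0) ^ 3 - 0)) := by
        refine Tendsto.mono_left (Continuous.tendsto ?_ 0) nhdsWithin_le_nhds
        fun_prop
      simp only [mul_zero, sub_zero] at ht
      exact le_of_tendsto ht (evs.mono fun ε he => (bounds ε he.1 he.2.1 he.2.2).2)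


lemma Unif.singleton {ν : Measure (E 4)} (h : Unif ν) : ν {0} = 0 := by
  have := h.lf
  have h1 : ν.real {0} ≤ 0 := by
    have ht : Tendsto (fun ε : ℝ => omega3 * ε ^ 3) (𝓝[>] 0) (𝓝 (omega3 * 0 ^ 3)) := by
      refine Tendsto.mono_left (Continuous.tendsto ?_ 0) nhdsWithin_le_nhds
      fun_prop
    simp only [ne_eq, OfNat.ofNat_ne_zero, not_false_eq_true, zero_pow, mul_zero] at ht
    refine ge_of_tendsto ht ?_
    filter_upwards [self_mem_nhdsWithin] with ε hε
    rw [← h.u 0 h.z ε hε]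
    refine measureReal_mono ?_ (isCompact_closedBall _ _).measure_lt_top.ne
    rw [singleton_subset_iff]; exact mem_closedBall_self (le_of_lt hε)
  have h2 : ν.real {0} = 0 := le_antisymm h1 measureReal_nonneg
  rw [Measure.real, ENNReal.toReal_eq_zero_iff] at h2
  exact h2.resolve_right (isCompact_singleton).measure_lt_top.ne

lemma Unif.meas {ν : Measure (E 4)} (h : Unif ν) {r : ℝ} (hr : 0 ≤ r) :
    ν (closedBall 0 r) = ENNReal.ofReal (omega3 * r ^ 3) := by
  have := h.lf
  rcases hr.eq_or_lt with rfl | hr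
  · simp [h.singleton]
  · rw [← h.u 0 h.z r hr, Measure.real, ENNReal.ofReal_toReal]
    exact (isCompact_closedBall _ _).measure_lt_top.ne

lemma Unif.map_norm {ν : Measure (E 4)} (h : Unif ν) :
    Measure.map (fun z => ‖z‖) (ν.restrict (closedBall 0 1)) =
      (volume.restrict (Ioc (0 : ℝ) 1)).withDensity (fun ρ => ENNReal.ofReal (3 * omega3 * ρ ^ 2)) := by
  have := h.lf
  have hfin : IsFiniteMeasure (ν.restrict (closedBall (0 : E 4) 1)) :=
    ⟨by rw [Measure.restrict_apply_univ]; exact (isCompact_closedBall _ _).measure_lt_top⟩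
  have ho := omega3_pos
  refine Measure.ext_of_Iic _ _ fun a => ?_
  rw [Measure.map_apply (by fun_prop) measurableSet_Iic, Measure.restrict_apply
    (measurableSet_Iic.preimage (by fun_prop)), withDensity_apply _ measurableSet_Iic,
    Measure.restrict_restrict measurableSet_Iic]
  have hs : (fun z : E 4 => ‖z‖) ⁻¹' Iic a ∩ closedBall 0 1 = closedBall 0 (min a 1) := by
    ext z; simp
  have hs2 : Iic a ∩ Ioc (0 : ℝ) 1 = Ioc 0 (min a 1) := by
    ext z; simp; tauto
  rw [hs, hs2]
  rcases lt_or_ge a 0 with ha | ha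
  · rw [closedBall_eq_empty.2 ((min_le_left _ _).trans_lt ha),
      Ioc_eq_empty (by simp; linarith)]
    simp
  · set m := min a 1
    have hm : 0 ≤ m := le_min ha zero_le_one
    rw [h.meas hm, ← ofReal_integral_eq_lintegral_ofReal]
    · rw [← intervalIntegral.integral_of_le hm]
      congr 1
      simp only [intervalIntegral.integral_const_mul, integral_pow]
      push_cast; ring
    · exact (Continuous.integrableOn_Icc (by fun_prop)).mono_set Ioc_subset_Icc_self
    · exact Eventually.of_forall fun ρ => by positivity

lemma Unif.radial {ν : Measure (E 4)} (h : Unif ν) (g : ℝ → ℝ) (hg : Continuous g) :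
    ∫ z in closedBall 0 1, g ‖z‖ ∂ν = ∫ ρ in (0 : ℝ)..1, 3 * omega3 * ρ ^ 2 * g ρ := by
  have ho := omega3_pos
  rw [← integral_map (φ := fun z : E 4 => ‖z‖) (f := g) (by fun_prop)
    hg.aestronglyMeasurable, h.map_norm, integral_withDensity_eq_integral_toReal_smul
    (by fun_prop) (by simp), intervalIntegral.integral_of_le zero_le_one]
  refine setIntegral_congr_fun measurableSet_Ioc fun ρ hρ => ?_
  simp only [smul_eq_mul]
  rw [ENNReal.toReal_ofReal (by positivity)]

/-- the basic weight. -/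
def wt (z : E 4) : ℝ := max 0 (1 - ‖z‖ ^ 2)

lemma wt_cont : Continuous wt := by unfold wt; fun_prop

lemma wt_nonneg (z : E 4) : 0 ≤ wt z := le_max_left _ _

lemma wt_le_one (z : E 4) : wt z ≤ 1 := by
  unfold wt; exact max_le zero_le_one (by nlinarith [sq_nonneg ‖z‖])

lemma wt_zero {z : E 4} (h : z ∉ closedBall (0 : E 4) 1) : wt z = 0 := by
  rw [mem_closedBall_zero_iff, not_le] at h
  unfold wt; apply max_eq_left; nlinarith

lemma wt_pos {z : E 4} (h : ‖z‖ < 1) : 0 < wt z := by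
  unfold wt; apply lt_max_of_lt_right; nlinarith [norm_nonneg z]

lemma wt_supp : HasCompactSupport wt :=
  HasCompactSupport.intro (isCompact_closedBall 0 1) fun _ hz => wt_zero hz

lemma wt_int (ν : Measure (E 4)) [IsLocallyFiniteMeasure ν] {f : E 4 → ℝ} (hf : Continuous f)
    {j : ℕ} (hj : j ≠ 0) : Integrable (fun z => wt z ^ j * f z) ν := by
  refine Continuous.integrable_of_hasCompactSupport (by have := wt_cont; fun_prop) ?_
  refine HasCompactSupport.intro (isCompact_closedBall 0 1) fun z hz => ?_
  rw [wt_zero hz]; simp [hj]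

lemma wt_int1 (ν : Measure (E 4)) [IsLocallyFiniteMeasure ν] {f : E 4 → ℝ} (hf : Continuous f) :
    Integrable (fun z => wt z * f z) ν := by
  simpa using wt_int ν hf one_ne_zero

lemma Unif.wtrad {ν : Measure (E 4)} (h : Unif ν) {j : ℕ} (hj : j ≠ 0) (k : ℕ) :
    ∫ z, wt z ^ j * ‖z‖ ^ k ∂ν
      = ∫ ρ in (0 : ℝ)..1, 3 * omega3 * ρ ^ 2 * ((1 - ρ ^ 2) ^ j * ρ ^ k) := by
  have h1 := h.radial (fun t => (max 0 (1 - t ^ 2)) ^ j * t ^ k) (by fun_prop)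
  rw [setIntegral_eq_integral_of_forall_compl_eq_zero] at h1
  · have h2 : ∫ z, wt z ^ j * ‖z‖ ^ k ∂ν =
      ∫ z : E 4, (max 0 (1 - ‖z‖ ^ 2)) ^ j * ‖z‖ ^ k ∂ν := rfl
    rw [h2, h1]
    refine intervalIntegral.integral_congr fun ρ hρ => ?_
    simp only [zero_le_one, uIcc_of_le, mem_Icc] at hρ
    have : 0 ≤ 1 - ρ ^ 2 := by nlinarith
    simp only [max_eq_right this]
  · intro z hz
    have := wt_zero hz
    unfold wt at this
    simp only [this]
    simp [hj]

lemma Unif.J11 {ν : Measure (E 4)} (h : Unif ν) : ∫ z, wt z * ‖z‖ ^ 2 ∂ν = 6 * omega3 / 35 := by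
  have h1 := h.wtrad one_ne_zero 2
  simp only [pow_one] at h1
  rw [h1]
  have : ∀ ρ : ℝ, 3 * omega3 * ρ ^ 2 * ((1 - ρ ^ 2) * ρ ^ 2) =
    3 * omega3 * (ρ ^ 4) - 3 * omega3 * ρ ^ 6 := fun ρ => by ring
  simp only [this]
  rw [intervalIntegral.integral_sub (by apply Continuous.intervalIntegrable; fun_prop)
    (by apply Continuous.intervalIntegrable; fun_prop)]
  simp only [intervalIntegral.integral_const_mul, integral_pow]
  norm_num; ring

lemma Unif.J21 {ν : Measure (E 4)} (h : Unif ν) : ∫ z, wt z * ‖z‖ ^ 4 ∂ν = 2 * omega3 / 21 := by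
  have h1 := h.wtrad one_ne_zero 4
  simp only [pow_one] at h1
  rw [h1]
  have : ∀ ρ : ℝ, 3 * omega3 * ρ ^ 2 * ((1 - ρ ^ 2) * ρ ^ 4) =
    3 * omega3 * (ρ ^ 6) - 3 * omega3 * ρ ^ 8 := fun ρ => by ring
  simp only [this]
  rw [intervalIntegral.integral_sub (by apply Continuous.intervalIntegrable; fun_prop)
    (by apply Continuous.intervalIntegrable; fun_prop)]
  simp only [intervalIntegral.integral_const_mul, integral_pow]
  norm_num; ring

lemma Unif.J12 {ν : Measure (E 4)} (h : Unif ν) : ∫ z, wt z ^ 2 * ‖z‖ ^ 2 ∂ν = 8 * omega3 / 105 := by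
  rw [h.wtrad two_ne_zero 2]
  have : ∀ ρ : ℝ, 3 * omega3 * ρ ^ 2 * ((1 - ρ ^ 2) ^ 2 * ρ ^ 2) =
    3 * omega3 * (ρ ^ 4) - 6 * omega3 * ρ ^ 6 + 3 * omega3 * ρ ^ 8 := fun ρ => by ring
  simp only [this]
  rw [intervalIntegral.integral_add (by apply Continuous.intervalIntegrable; fun_prop)
    (by apply Continuous.intervalIntegrable; fun_prop),
    intervalIntegral.integral_sub (by apply Continuous.intervalIntegrable; fun_prop)
    (by apply Continuous.intervalIntegrable; fun_prop)]
  simp only [intervalIntegral.integral_const_mul, integral_pow]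
  norm_num; ring

lemma Unif.J02 {ν : Measure (E 4)} (h : Unif ν) : ∫ z, wt z ^ 2 ∂ν = 8 * omega3 / 35 := by
  have h1 := h.wtrad two_ne_zero 0
  simp only [pow_zero, mul_one] at h1
  rw [h1]
  have : ∀ ρ : ℝ, 3 * omega3 * ρ ^ 2 * (1 - ρ ^ 2) ^ 2 =
    3 * omega3 * (ρ ^ 2) - 6 * omega3 * ρ ^ 4 + 3 * omega3 * ρ ^ 6 := fun ρ => by ring
  simp only [this]
  rw [intervalIntegral.integral_add (by apply Continuous.intervalIntegrable; fun_prop)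
    (by apply Continuous.intervalIntegrable; fun_prop),
    intervalIntegral.integral_sub (by apply Continuous.intervalIntegrable; fun_prop)
    (by apply Continuous.intervalIntegrable; fun_prop)]
  simp only [intervalIntegral.integral_const_mul, integral_pow]
  norm_num; ring

/-- first moment functional. -/
def bl (ν : Measure (E 4)) (u : E 4) : ℝ := 35 / (8 * omega3) * ∫ z, wt z ^ 2 * ⟪u, z⟫ ∂ν

/-- second moment form. -/
def q (ν : Measure (E 4)) (u v : E 4) : ℝ := 35 / (2 * omega3) * ∫ z, wt z * (⟪u, z⟫ * ⟪v, z⟫) ∂ν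

lemma taylor3 (t h : ℝ) :
    |max 0 (1 - (t + h)) ^ 3 - max 0 (1 - t) ^ 3 + 3 * max 0 (1 - t) ^ 2 * h
      - 3 * max 0 (1 - t) * h ^ 2| ≤ |h| ^ 3 := by
  rcases le_total 0 (1 - t) with h1 | h1 <;> rcases le_total 0 (1 - (t + h)) with h2 | h2
  · rw [max_eq_right h1, max_eq_right h2, ← abs_pow, ← abs_neg (h ^ 3)]
    apply le_of_eq; congr 1; ring
  · rw [max_eq_right h1, max_eq_left h2]
    have h0 : 0 ≤ h := by linarith
    rw [abs_of_nonneg h0, abs_le]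
    have h3 : 0 ≤ h - (1 - t) := by linarith
    have e : (0 : ℝ) ^ 3 - (1 - t) ^ 3 + 3 * (1 - t) ^ 2 * h - 3 * (1 - t) * h ^ 2
      = (h - (1 - t)) ^ 3 - h ^ 3 := by ring
    rw [e]
    have h4 : (h - (1 - t)) ^ 3 ≤ h ^ 3 := pow_le_pow_left₀ h3 (by linarith) 3
    have h5 : 0 ≤ (h - (1 - t)) ^ 3 := by positivity
    have h6 : 0 ≤ h ^ 3 := by positivity
    constructor <;> linarith
  · rw [max_eq_left h1, max_eq_right h2]
    have h0 : h ≤ 0 := by linarith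
    simp only [ne_eq, OfNat.ofNat_ne_zero, not_false_eq_true, zero_pow, sub_zero, mul_zero, zero_mul,
      add_zero]
    rw [abs_of_nonneg (by positivity), abs_of_nonpos h0]
    exact pow_le_pow_left₀ h2 (by linarith) 3
  · rw [max_eq_left h1, max_eq_left h2]; simp

lemma ptwise (x z : E 4) (hx : ‖x‖ ≤ 1) :
    |wt (z - x) ^ 3 - wt z ^ 3 + 3 * wt z ^ 2 * (‖x‖ ^ 2 - 2 * ⟪x, z⟫) - 12 * wt z * ⟪x, z⟫ ^ 2|
      ≤ (closedBall (0 : E 4) 2).indicator (fun _ => 200 * ‖x‖ ^ 3) z := by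
  have hx0 := norm_nonneg x
  by_cases hz : z ∈ closedBall (0 : E 4) 2
  · rw [indicator_of_mem hz]
    rw [mem_closedBall_zero_iff] at hz
    set h := ‖x‖ ^ 2 - 2 * ⟪x, z⟫ with hh
    have hi := abs_real_inner_le_norm x z
    have hi2 : |⟪x, z⟫| ≤ 2 * ‖x‖ := hi.trans (by nlinarith)
    have e1 : ‖z - x‖ ^ 2 = ‖z‖ ^ 2 + h := by
      rw [norm_sub_sq_real, hh, real_inner_comm]; ring
    have t1 := taylor3 (‖z‖ ^ 2) h
    have hw : wt (z - x) = max 0 (1 - (‖z‖ ^ 2 + h)) := by unfold wt; rw [e1]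
    have hw2 : wt z = max 0 (1 - ‖z‖ ^ 2) := rfl
    rw [← hw, ← hw2] at t1
    have hh5 : |h| ≤ 5 * ‖x‖ := by
      rw [hh]; obtain ⟨a, b⟩ := abs_le.1 hi2
      rw [abs_le]; constructor <;> nlinarith
    have t2 : |h| ^ 3 ≤ 125 * ‖x‖ ^ 3 := by
      calc |h| ^ 3 ≤ (5 * ‖x‖) ^ 3 := pow_le_pow_left₀ (abs_nonneg _) hh5 3
        _ = _ := by ring
    have e2 : wt (z - x) ^ 3 - wt z ^ 3 + 3 * wt z ^ 2 * h - 12 * wt z * ⟪x, z⟫ ^ 2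
      = (wt (z - x) ^ 3 - wt z ^ 3 + 3 * wt z ^ 2 * h - 3 * wt z * h ^ 2)
        + 3 * wt z * (‖x‖ ^ 2 * (‖x‖ ^ 2 - 4 * ⟪x, z⟫)) := by rw [hh]; ring
    have t3 : |3 * wt z * (‖x‖ ^ 2 * (‖x‖ ^ 2 - 4 * ⟪x, z⟫))| ≤ 27 * ‖x‖ ^ 3 := by
      have hn1 : 0 ≤ 3 * wt z := by have := wt_nonneg z; positivity
      have hn2 : 0 ≤ ‖x‖ ^ 2 := by positivity
      rw [abs_mul, abs_of_nonneg hn1, abs_mul, abs_of_nonneg hn2]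
      have t4 : |‖x‖ ^ 2 - 4 * ⟪x, z⟫| ≤ 9 * ‖x‖ := by
        obtain ⟨a, b⟩ := abs_le.1 hi2
        rw [abs_le]; constructor <;> nlinarith
      calc 3 * wt z * (‖x‖ ^ 2 * |‖x‖ ^ 2 - 4 * ⟪x, z⟫|)
          ≤ 3 * 1 * (‖x‖ ^ 2 * (9 * ‖x‖)) := by
            gcongr; exact wt_le_one z
        _ = _ := by ring
    rw [e2]
    refine (abs_add_le _ _).trans ?_
    have : 0 ≤ ‖x‖ ^ 3 := by positivity
    linarith
  · rw [indicator_of_notMem hz]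
    have h1 : wt z = 0 := wt_zero fun h => hz (closedBall_subset_closedBall one_le_two h)
    have h2 : wt (z - x) = 0 := by
      apply wt_zero
      rw [mem_closedBall_zero_iff] at hz ⊢
      have := norm_sub_norm_le z x
      linarith
    simp [h1, h2]

lemma Unif.rel {ν : Measure (E 4)} (h : Unif ν) {x : E 4} (hx : x ∈ msupp ν) (hx1 : ‖x‖ ≤ 1) :
    |2 * bl ν x + q ν x x - ‖x‖ ^ 2| ≤ 3000 * ‖x‖ ^ 3 := by
  have := h.lf
  have ho := omega3_pos
  have hc := wt_cont
  -- translation invariance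
  have hw3 : ∫ z, wt (z - x) ^ 3 ∂ν = ∫ z, wt z ^ 3 ∂ν := by
    have hU := h.resc hx one_pos
    have h1 := hU.wtrad three_ne_zero 0
    have h2 := h.wtrad three_ne_zero 0
    simp only [pow_zero, mul_one] at h1 h2
    rw [resc_int ν x one_pos _ (by fun_prop)] at h1
    simpa [← h2] using h1
  have i1 : Integrable (fun z => wt (z - x) ^ 3) ν := by
    refine Continuous.integrable_of_hasCompactSupport (by fun_prop) ?_
    refine HasCompactSupport.intro (isCompact_closedBall x 1) fun z hz => ?_
    rw [wt_zero (z := z - x)]; · simp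
    rw [mem_closedBall_zero_iff, ← dist_eq_norm]; exact hz
  have i2 : Integrable (fun z => wt z ^ 3) ν := by
    simpa using wt_int ν (continuous_const (y := (1 : ℝ))) three_ne_zero
  have i3 : Integrable (fun z => wt z ^ 2 * (3 * (‖x‖ ^ 2 - 2 * ⟪x, z⟫))) ν :=
    wt_int ν (by fun_prop) two_ne_zero
  have i4 : Integrable (fun z => wt z * (12 * ⟪x, z⟫ ^ 2)) ν := wt_int1 ν (by fun_prop)
  have hI : |∫ z, (wt (z - x) ^ 3 - wt z ^ 3 + wt z ^ 2 * (3 * (‖x‖ ^ 2 - 2 * ⟪x, z⟫))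
      - wt z * (12 * ⟪x, z⟫ ^ 2)) ∂ν| ≤ 200 * ‖x‖ ^ 3 * (omega3 * 2 ^ 3) := by
    rw [← Real.norm_eq_abs]
    refine (norm_integral_le_integral_norm _).trans ?_
    have hb : ∫ z, (closedBall (0 : E 4) 2).indicator (fun _ => 200 * ‖x‖ ^ 3) z ∂ν
        = 200 * ‖x‖ ^ 3 * (omega3 * 2 ^ 3) := by
      rw [integral_indicator measurableSet_closedBall, setIntegral_const, h.u 0 h.z 2 two_pos,
        smul_eq_mul]; ring
    rw [← hb]
    refine integral_mono ((((i1.sub i2).add i3).sub i4).norm) ?_ ?_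
    · exact (integrable_indicator_iff measurableSet_closedBall).2
        (integrableOn_const (isCompact_closedBall _ _).measure_lt_top.ne)
    · intro z
      have := ptwise x z hx1
      simp only [Real.norm_eq_abs]
      refine le_trans (le_of_eq ?_) this
      congr 1; ring
  have i12 : Integrable (fun z => wt (z - x) ^ 3 - wt z ^ 3) ν := i1.sub i2
  have i123 : Integrable (fun z => wt (z - x) ^ 3 - wt z ^ 3
    + wt z ^ 2 * (3 * (‖x‖ ^ 2 - 2 * ⟪x, z⟫))) ν := i12.add i3
  rw [integral_sub i123 i4, integral_add i12 i3, integral_sub i1 i2, hw3,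
    sub_self, zero_add] at hI
  have e3 : ∫ z, wt z ^ 2 * (3 * (‖x‖ ^ 2 - 2 * ⟪x, z⟫)) ∂ν
      = 3 * ‖x‖ ^ 2 * (8 * omega3 / 35) - 6 * ∫ z, wt z ^ 2 * ⟪x, z⟫ ∂ν := by
    rw [← h.J02, ← integral_const_mul, ← integral_const_mul, ← integral_sub]
    · congr 1; funext z; ring
    · simpa using (wt_int ν (continuous_const (y := (1 : ℝ))) two_ne_zero).const_mul _
    · exact (wt_int ν (by fun_prop) two_ne_zero).const_mul _
  have e4 : ∫ z, wt z * (12 * ⟪x, z⟫ ^ 2) ∂ν = 12 * ∫ z, wt z * (⟪x, z⟫ * ⟪x, z⟫) ∂ν := by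
    rw [← integral_const_mul]; congr 1; funext z; ring
  rw [e3, e4] at hI
  set P := ∫ z, wt z ^ 2 * ⟪x, z⟫ ∂ν
  set R := ∫ z, wt z * (⟪x, z⟫ * ⟪x, z⟫) ∂ν
  have e5 : 2 * bl ν x + q ν x x - ‖x‖ ^ 2 = -(35 / (24 * omega3)) *
      (3 * ‖x‖ ^ 2 * (8 * omega3 / 35) - 6 * P - 12 * R) := by
    have e6 : bl ν x = 35 / (8 * omega3) * P := rfl
    have e7 : q ν x x = 35 / (2 * omega3) * R := rfl
    rw [e6, e7]; field_simp; ring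
  rw [e5, abs_mul, abs_neg, abs_of_pos (by positivity)]
  calc _ ≤ 35 / (24 * omega3) * (200 * ‖x‖ ^ 3 * (omega3 * 2 ^ 3)) := by gcongr
    _ = (7000 / 3) * ‖x‖ ^ 3 := by field_simp; ring
    _ ≤ _ := by gcongr; norm_num


lemma int_zero_supp {ν : Measure (E 4)} {f : E 4 → ℝ} (hf : Continuous f)
    (h0 : ∀ z ∈ msupp ν, 0 ≤ f z) (hi : Integrable f ν) (hz : ∫ z, f z ∂ν = 0) :
    ∀ x ∈ msupp ν, f x = 0 := by
  have h0' : 0 ≤ᵐ[ν] f := by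
    filter_upwards [ae_msupp ν] with z hz using h0 z hz
  have h1 := (integral_eq_zero_iff_of_nonneg_ae h0' hi).1 hz
  intro x hx
  by_contra hne
  have ho : IsOpen {z | f z ≠ 0} := isOpen_ne_fun hf continuous_const
  have hx' := hx
  rw [msupp_eq, Measure.mem_support_iff_forall] at hx'
  have := hx' _ (ho.mem_nhds hne)
  have h2 : ν {z | f z ≠ 0} = 0 := h1
  rw [h2] at this
  exact lt_irrefl _ this

section lin
variable (ν : Measure (E 4))

lemma q_comm (u v : E 4) : q ν u v = q ν v u := by
  unfold q; congr 2; funext z; ring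

lemma q_nonneg (u : E 4) : 0 ≤ q ν u u := by
  have := omega3_pos
  refine mul_nonneg (by positivity) (integral_nonneg fun z => ?_)
  have := wt_nonneg z
  exact mul_nonneg this (mul_self_nonneg _)

lemma q_zero_of {u v : E 4} (h : ∀ z ∈ msupp ν, ⟪u, z⟫ = 0) : q ν u v = 0 := by
  have : ∫ z, wt z * (⟪u, z⟫ * ⟪v, z⟫) ∂ν = 0 := by
    apply integral_eq_zero_of_ae
    filter_upwards [ae_msupp ν] with z hz
    simp [h z hz]
  simp [q, this]

lemma bl_zero_of {u : E 4} (h : ∀ z ∈ msupp ν, ⟪u, z⟫ = 0) : bl ν u = 0 := by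
  have : ∫ z, wt z ^ 2 * ⟪u, z⟫ ∂ν = 0 := by
    apply integral_eq_zero_of_ae
    filter_upwards [ae_msupp ν] with z hz
    simp [h z hz]
  simp [bl, this]

variable [IsLocallyFiniteMeasure ν]

lemma exists_b : ∃ b : E 4, ∀ u, bl ν u = ⟪b, u⟫ := by
  refine ⟨(35 / (8 * omega3)) • ∫ z, wt z ^ 2 • z ∂ν, fun u => ?_⟩
  have hi : Integrable (fun z : E 4 => wt z ^ 2 • z) ν := by
    have hc := wt_cont
    refine Continuous.integrable_of_hasCompactSupport (by fun_prop) ?_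
    refine HasCompactSupport.intro (isCompact_closedBall (0 : E 4) 1) fun z hz => ?_
    rw [wt_zero hz]; simp
  rw [real_inner_comm, inner_smul_right, ← integral_inner hi]
  simp only [bl, inner_smul_right]

lemma exists_T : ∃ T : E 4 →ₗ[ℝ] E 4, T.IsSymmetric ∧ ∀ u v, ⟪T u, v⟫ = q ν u v := by
  have hi : ∀ u, Integrable (fun z : E 4 => (wt z * ⟪u, z⟫) • z) ν := by
    intro u
    have hc := wt_cont
    refine Continuous.integrable_of_hasCompactSupport (by fun_prop) ?_
    exact (wt_supp.mul_right).smul_right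
  let T : E 4 →ₗ[ℝ] E 4 :=
    { toFun := fun u => (35 / (2 * omega3)) • ∫ z, (wt z * ⟪u, z⟫) • z ∂ν
      map_add' := fun u v => by
        rw [← smul_add, ← integral_add (hi u) (hi v)]
        congr 2; funext z; rw [inner_add_left, mul_add, add_smul]
      map_smul' := fun c u => by
        have e : ∫ z, (wt z * ⟪c • u, z⟫) • z ∂ν = c • ∫ z, (wt z * ⟪u, z⟫) • z ∂ν := by
          rw [← integral_smul]
          congr 1; funext z; rw [real_inner_smul_left, smul_smul]; congr 1; ring
        rw [e, smul_comm]; rfl }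
  have hT : ∀ u v, ⟪T u, v⟫ = q ν u v := by
    intro u v
    show ⟪(35 / (2 * omega3)) • ∫ z, (wt z * ⟪u, z⟫) • z ∂ν, v⟫ = _
    rw [real_inner_comm, inner_smul_right, ← integral_inner (hi u)]
    simp only [q, inner_smul_right]
    congr 2; funext z; ring
  refine ⟨T, fun u v => ?_, hT⟩
  rw [hT, real_inner_comm, hT]
  unfold q; congr 2; funext z; ring

lemma q_cont : Continuous (fun u : E 4 => q ν u u) := by
  obtain ⟨T, -, hT⟩ := exists_T ν
  simp only [← hT]
  have : Continuous T := T.continuous_of_finiteDimensional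
  fun_prop

lemma bl_cont : Continuous (bl ν) := by
  obtain ⟨b, hb⟩ := exists_b ν
  have : bl ν = fun u => ⟪b, u⟫ := funext hb
  rw [this]; fun_prop

lemma q_zero {u : E 4} (h : q ν u u = 0) {z : E 4} (hz : z ∈ msupp ν) (hz1 : ‖z‖ < 1) :
    ⟪u, z⟫ = 0 := by
  have ho := omega3_pos
  have hc := wt_cont
  have h1 : ∫ z, wt z * (⟪u, z⟫ * ⟪u, z⟫) ∂ν = 0 := by
    have : (35 / (2 * omega3)) ≠ 0 := by positivity
    simpa [q, this] using h
  have := int_zero_supp (by fun_prop) (fun z _ => mul_nonneg (wt_nonneg z) (mul_self_nonneg _))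
    (wt_int1 ν (by fun_prop)) h1 z hz
  simpa [(wt_pos hz1).ne'] using this

lemma q_mono {u : E 4} {σ : ℝ} (hσ : 0 < σ) (hσ1 : σ ≤ 1) :
    q (resc ν 0 σ) u u ≤ σ⁻¹ ^ 5 * q ν u u := by
  have ho := omega3_pos
  have hc := wt_cont
  unfold q
  rw [resc_int ν 0 hσ _ (by fun_prop)]
  have : ∫ z, wt (σ⁻¹ • (z - 0)) * (⟪u, σ⁻¹ • (z - 0)⟫ * ⟪u, σ⁻¹ • (z - 0)⟫) ∂ν
      ≤ σ⁻¹ ^ 2 * ∫ z, wt z * (⟪u, z⟫ * ⟪u, z⟫) ∂ν := by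
    rw [← integral_const_mul]
    refine integral_mono ?_ ((wt_int1 ν (by fun_prop)).const_mul _) fun z => ?_
    · have h2 := hσ.ne'
      refine Continuous.integrable_of_hasCompactSupport (by fun_prop) ?_
      apply HasCompactSupport.mul_right
      simp only [sub_zero]
      exact wt_supp.comp_homeomorph (Homeomorph.smulOfNeZero _ (inv_ne_zero h2))
    · simp only [sub_zero, real_inner_smul_right]
      have hw : wt (σ⁻¹ • z) ≤ wt z := by
        unfold wt
        apply max_le_max le_rfl
        rw [norm_smul, mul_pow, Real.norm_eq_abs, sq_abs]
        have : 1 ≤ σ⁻¹ ^ 2 := one_le_pow₀ ((one_le_inv₀ hσ).2 hσ1)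
        nlinarith [sq_nonneg ‖z‖]
      calc _ = wt (σ⁻¹ • z) * (σ⁻¹ ^ 2 * ⟪u, z⟫ ^ 2) := by ring
        _ ≤ wt z * (σ⁻¹ ^ 2 * ⟪u, z⟫ ^ 2) := by gcongr
        _ = _ := by ring
  calc _ ≤ 35 / (2 * omega3) * (σ⁻¹ ^ 3 * (σ⁻¹ ^ 2 * ∫ z, wt z * (⟪u, z⟫ * ⟪u, z⟫) ∂ν)) := by
        gcongr
    _ = _ := by ring

end lin

abbrev OB := OrthonormalBasis (Fin 4) ℝ (E 4)

lemma OB.norm_sq (b : OB) (z : E 4) : ∑ i, ⟪b i, z⟫ ^ 2 = ‖z‖ ^ 2 := b.sum_sq_inner_right z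

lemma Unif.q_trace {ν : Measure (E 4)} (h : Unif ν) (b : OB) : ∑ i, q ν (b i) (b i) = 3 := by
  have := h.lf
  have ho := omega3_pos
  unfold q
  rw [← Finset.mul_sum, ← integral_finsetSum]
  · have : ∀ z : E 4, ∑ i, wt z * (⟪b i, z⟫ * ⟪b i, z⟫) = wt z * ‖z‖ ^ 2 := by
      intro z
      rw [← OB.norm_sq b z, Finset.mul_sum]
      congr 1; funext i; ring
    simp only [this, h.J11]
    field_simp; norm_num
  · intro i _
    exact wt_int1 ν (by fun_prop)

lemma ULim.q {ι : Type} {U : Ultrafilter ι} {μs : ι → Measure (E 4)} {ν : Measure (E 4)}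
    (h : ULim U μs ν) (u v : E 4) : Tendsto (fun i => q (μs i) u v) U (𝓝 (q ν u v)) := by
  have hc := wt_cont
  exact (h.conv _ (by fun_prop) wt_supp.mul_right).const_mul _

lemma ULim.bl {ι : Type} {U : Ultrafilter ι} {μs : ι → Measure (E 4)} {ν : Measure (E 4)}
    (h : ULim U μs ν) (u : E 4) : Tendsto (fun i => bl (μs i) u) U (𝓝 (bl ν u)) := by
  have hc := wt_cont
  refine (h.conv _ (by fun_prop) ?_).const_mul _
  exact (wt_supp.comp_left (g := fun t => t ^ 2) (by simp)).mul_right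

lemma q_exp (ν : Measure (E 4)) [IsLocallyFiniteMeasure ν] (b : OB) (u v : E 4) :
    q ν u v = ∑ i, ∑ j, ⟪b i, u⟫ * ⟪b j, v⟫ * q ν (b i) (b j) := by
  obtain ⟨T, hs, hT⟩ := exists_T ν
  simp only [← hT]
  conv_lhs => rw [← b.sum_repr' u, ← b.sum_repr' v]
  simp only [map_sum, map_smul, sum_inner, inner_sum, real_inner_smul_left, real_inner_smul_right]
  rw [Finset.sum_comm]
  refine Finset.sum_congr rfl fun i _ => Finset.sum_congr rfl fun j _ => ?_
  ring

lemma ULim.q' {ι : Type} {U : Ultrafilter ι} {μs : ι → Measure (E 4)} {ν : Measure (E 4)}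
    (h : ULim U μs ν) (hl : ∀ i, IsLocallyFiniteMeasure (μs i)) [IsLocallyFiniteMeasure ν]
    {us : ι → E 4} {u : E 4} (hu : Tendsto us U (𝓝 u)) :
    Tendsto (fun i => _root_.q (μs i) (us i) (us i)) U (𝓝 (_root_.q ν u u)) := by
  let b : OB := EuclideanSpace.basisFun (Fin 4) ℝ
  have e : ∀ i, _root_.q (μs i) (us i) (us i)
      = ∑ j, ∑ k, ⟪b j, us i⟫ * ⟪b k, us i⟫ * _root_.q (μs i) (b j) (b k) :=
    fun i => by have := hl i; exact q_exp _ b _ _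
  simp only [e]
  rw [q_exp ν b u u]
  refine tendsto_finsetSum _ fun j _ => tendsto_finsetSum _ fun k _ => ?_
  exact ((tendsto_const_nhds.inner hu).mul (tendsto_const_nhds.inner hu)).mul (h.q _ _)

lemma ULim.resc {ι : Type} {U : Ultrafilter ι} {μs : ι → Measure (E 4)} {ν : Measure (E 4)}
    (h : ULim U μs ν) {r : ℝ} (hr : 0 < r) :
    ULim U (fun i => resc (μs i) 0 r) (resc ν 0 r) := by
  refine ⟨fun f hf hc => ?_, fun x => ?_⟩
  · simp only [resc_int _ _ hr f hf]
    refine (h.conv _ (by fun_prop) ?_).const_mul _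
    simp only [sub_zero]
    exact hc.comp_homeomorph (Homeomorph.smulOfNeZero _ (inv_ne_zero hr.ne'))
  · rw [resc_msupp _ _ _ hr, h.supp]
    constructor
    · intro H ε hε
      filter_upwards [H (r * ε) (by positivity)] with i hi
      obtain ⟨y, hy, hd⟩ := hi
      refine ⟨r⁻¹ • y, ?_, ?_⟩
      · rw [resc_msupp _ _ _ hr]; simpa [smul_smul, hr.ne'] using hy
      · have : dist (r⁻¹ • y) x = r⁻¹ * dist y (0 + r • x) := by
          have e : x = r⁻¹ • (0 + r • x) := by simp [smul_smul, hr.ne']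
          conv_lhs => rw [e]
          rw [dist_smul₀, Real.norm_eq_abs, abs_of_pos (inv_pos.2 hr)]
        rw [this, inv_mul_lt_iff₀ hr]; exact hd
    · intro H ε hε
      filter_upwards [H (r⁻¹ * ε) (by positivity)] with i hi
      obtain ⟨y, hy, hd⟩ := hi
      rw [resc_msupp _ _ _ hr] at hy
      refine ⟨0 + r • y, hy, ?_⟩
      rw [dist_add_left, dist_smul₀, Real.norm_eq_abs, abs_of_pos hr]
      rwa [lt_inv_mul_iff₀ hr] at hd

lemma AU.of_unif {ι : Type} (U : Ultrafilter ι) {μs : ι → Measure (E 4)} (h : ∀ i, Unif (μs i)) :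
    AU U μs :=
  ⟨fun i => (h i).lf, fun i => (h i).z, fun R ε _ hε => Eventually.of_forall fun i x hx _ ρ hρ _ => by
    rw [(h i).u x hx ρ hρ, sub_self, abs_zero]; exact hε.le⟩

/-- sequential tangent directions at zero -/
def Tan0 (ν : Measure (E 4)) (x : E 4) : Prop :=
  ∃ (t : ℕ → ℝ) (y : ℕ → E 4), (∀ k, 0 < t k) ∧ Tendsto t atTop (𝓝 0) ∧ Tendsto y atTop (𝓝 x) ∧
    ∀ k, t k • y k ∈ msupp ν

lemma Tan0.of_blowup {ι : Type} {U : Ultrafilter ι} {r : ι → ℝ} (hr : ∀ i, 0 < r i)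
    (hr0 : Tendsto r U (𝓝 0)) {ν l : Measure (E 4)} (h : ULim U (fun i => resc ν 0 (r i)) l)
    {x : E 4} (hx : x ∈ msupp l) : Tan0 ν x := by
  have key : ∀ k : ℕ, ∃ (t : ℝ) (y : E 4), 0 < t ∧ t < 1 / ((k : ℝ) + 1) ∧ dist y x < 1 / ((k : ℝ) + 1)
      ∧ t • y ∈ msupp ν := by
    intro k
    have hk : (0 : ℝ) < 1 / ((k : ℝ) + 1) := by positivity
    have h1 := (h.supp x).1 hx _ hk
    have h2 := hr0.eventually_lt_const hk
    obtain ⟨i, ⟨y, hy, hd⟩, hi⟩ := (h1.and h2).exists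
    rw [resc_msupp _ _ _ (hr i), zero_add] at hy
    exact ⟨r i, y, hr i, hi, hd, hy⟩
  choose t y h1 h2 h3 h4 using key
  refine ⟨t, y, h1, ?_, ?_, h4⟩
  · exact squeeze_zero (fun k => (h1 k).le) (fun k => (h2 k).le) tendsto_one_div_add_atTop_nhds_zero_nat
  · rw [tendsto_iff_dist_tendsto_zero]
    exact squeeze_zero (fun k => dist_nonneg) (fun k => (h3 k).le)
      tendsto_one_div_add_atTop_nhds_zero_nat

lemma Tan0.resc {ν : Measure (E 4)} {x : E 4} (h : Tan0 ν x) {r : ℝ} (hr : 0 < r) :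
    Tan0 (resc ν 0 r) x := by
  obtain ⟨t, y, h1, h2, h3, h4⟩ := h
  refine ⟨fun k => r⁻¹ * t k, y, fun k => by have := h1 k; positivity, by simpa using h2.const_mul r⁻¹, h3,
    fun k => ?_⟩
  rw [resc_msupp _ _ _ hr]
  simpa [smul_smul, ← mul_assoc, hr.ne'] using h4 k

lemma Unif.rel_seq {ν : Measure (E 4)} (h : Unif ν) {x : E 4} {t : ℕ → ℝ} {y : ℕ → E 4}
    (h1 : ∀ k, 0 < t k) (h2 : Tendsto t atTop (𝓝 0)) (h3 : Tendsto y atTop (𝓝 x))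
    (h4 : ∀ k, t k • y k ∈ msupp ν) :
    Tendsto (fun k => 2 * bl ν (y k) / t k + q ν (y k) (y k) - ‖y k‖ ^ 2) atTop (𝓝 0) := by
  have := h.lf
  obtain ⟨b, hb⟩ := exists_b ν
  obtain ⟨T, -, hT⟩ := exists_T ν
  have hn : Tendsto (fun k => ‖t k • y k‖) atTop (𝓝 0) := by
    simpa using (h2.smul h3).norm
  have hlim : Tendsto (fun k => 3000 * t k * ‖y k‖ ^ 3) atTop (𝓝 0) := by
    simpa using (h2.const_mul 3000).mul (h3.norm.pow 3)
  refine squeeze_zero_norm' ?_ hlim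
  filter_upwards [hn.eventually_lt_const one_pos] with k hk
  have h5 := h.rel (h4 k) hk.le
  have ht := h1 k
  simp only [hb, ← hT, map_smul, real_inner_smul_left, real_inner_smul_right, norm_smul,
    Real.norm_eq_abs, abs_of_pos ht] at h5 ⊢
  have e : 2 * (t k * ⟪b, y k⟫) + t k * (t k * ⟪T (y k), y k⟫) - (t k * ‖y k‖) ^ 2
     = t k ^ 2 * (2 * ⟪b, y k⟫ / t k + ⟪T (y k), y k⟫ - ‖y k‖ ^ 2) := by
    field_simp
  rw [e, abs_mul, abs_of_pos (by positivity : 0 < t k ^ 2)] at h5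
  have h6 : t k ^ 2 * |2 * ⟪b, y k⟫ / t k + ⟪T (y k), y k⟫ - ‖y k‖ ^ 2|
    ≤ t k ^ 2 * (3000 * t k * ‖y k‖ ^ 3) := h5.trans (le_of_eq (by ring))
  exact le_of_mul_le_mul_left h6 (by positivity)

lemma Tan0.bl {ν : Measure (E 4)} (hν : Unif ν) {x : E 4} (h : Tan0 ν x) : bl ν x = 0 := by
  have := hν.lf
  obtain ⟨t, y, h1, h2, h3, h4⟩ := h
  have h5 := (hν.rel_seq h1 h2 h3 h4).mul h2
  have hq := ((q_cont ν).tendsto x).comp h3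
  have hb := ((bl_cont ν).tendsto x).comp h3
  have h6 : Tendsto (fun k => 2 * _root_.bl ν (y k)) atTop (𝓝 0) := by
    have := h5.sub ((hq.sub (h3.norm.pow 2)).mul h2)
    simp only [mul_zero, sub_zero] at this
    refine this.congr fun k => ?_
    have := (h1 k).ne'
    simp only [Function.comp]
    field_simp; ring
  have h7 := tendsto_nhds_unique h6 (hb.const_mul 2)
  linarith

lemma Tan0.q {ν : Measure (E 4)} (hν : Unif ν) (hb : ∀ u, _root_.bl ν u = 0) {x : E 4}
    (h : Tan0 ν x) : q ν x x = ‖x‖ ^ 2 := by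
  have := hν.lf
  obtain ⟨t, y, h1, h2, h3, h4⟩ := h
  have h5 := hν.rel_seq h1 h2 h3 h4
  simp only [hb, mul_zero, zero_div, zero_add] at h5
  have hq := ((q_cont ν).tendsto x).comp h3
  have := tendsto_nhds_unique h5 (hq.sub (h3.norm.pow 2))
  linarith

def Blow (ν l : Measure (E 4)) : Prop :=
  Unif l ∧ ∃ r : ℕ → ℝ, (∀ k, 0 < r k) ∧ Tendsto r atTop (𝓝 0) ∧
    ULim (hyperfilter ℕ) (fun k => resc ν 0 (r k)) l

lemma hyper_le {α : Type*} {f : ℕ → α} {l : Filter α} (h : Tendsto f atTop l) :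
    Tendsto f (hyperfilter ℕ : Filter ℕ) l := h.mono_left Nat.hyperfilter_le_atTop

lemma Unif.blow {ν : Measure (E 4)} (h : Unif ν) : ∃ l, Blow ν l := by
  have hr : ∀ k : ℕ, (0 : ℝ) < 1 / ((k : ℝ) + 1) := fun k => by positivity
  obtain ⟨l, h1, h2⟩ := (AU.of_unif (hyperfilter ℕ) fun k => h.resc h.z (hr k)).exists_ulim
  exact ⟨l, h1, _, hr, tendsto_one_div_add_atTop_nhds_zero_nat, h2⟩

lemma Blow.resc {ν l : Measure (E 4)} (h : Blow ν l) {s : ℝ} (hs : 0 < s) : Blow ν (resc l 0 s) := by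
  obtain ⟨h1, r, h2, h3, h4⟩ := h
  refine ⟨h1.resc h1.z hs, fun k => r k * s, fun k => mul_pos (h2 k) hs,
    by simpa using h3.mul_const s, ?_⟩
  have := h4.resc hs
  simpa only [resc_resc ν (h2 _) hs] using this

lemma Blow.tan {ν l : Measure (E 4)} (h : Blow ν l) {x : E 4} (hx : x ∈ msupp l) : Tan0 ν x := by
  obtain ⟨h1, r, h2, h3, h4⟩ := h
  exact Tan0.of_blowup h2 (hyper_le h3) h4 hx

lemma Blow.bl {ν l : Measure (E 4)} (h : Blow ν l) (hν : Unif ν) (u : E 4) : bl l u = 0 := by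
  have hl := h.1.lf
  obtain ⟨b, hb⟩ := exists_b l
  have h5 : ∀ x ∈ msupp l, ⟪b, x⟫ = 0 := by
    intro x hx
    have ht := h.tan hx
    obtain ⟨h1, r, h2, h3, h4⟩ := h
    have := h4.bl x
    have e : ∀ k, _root_.bl (_root_.resc ν 0 (r k)) x = 0 := fun k =>
      (ht.resc (h2 k)).bl (hν.resc hν.z (h2 k))
    simp only [e] at this
    rw [← hb]
    exact tendsto_nhds_unique this tendsto_const_nhds
  have h6 := bl_zero_of l h5
  rw [hb] at h6
  rw [hb, inner_self_eq_zero.1 h6, inner_zero_left]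

lemma Blow.q {ν l : Measure (E 4)} (h : Blow ν l) (hν : Unif ν)
    (hb : ∀ r > 0, ∀ u, _root_.bl (_root_.resc ν 0 r) u = 0) {x : E 4} (hx : x ∈ msupp l) :
    q l x x = ‖x‖ ^ 2 := by
  have ht := h.tan hx
  obtain ⟨h1, r, h2, h3, h4⟩ := h
  have := h4.q x x
  have e : ∀ k, _root_.q (_root_.resc ν 0 (r k)) x x = ‖x‖ ^ 2 := fun k =>
    (ht.resc (h2 k)).q (hν.resc hν.z (h2 k)) (hb _ (h2 k))
  simp only [e] at this
  exact tendsto_nhds_unique this tendsto_const_nhds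

structure Good (l : Measure (E 4)) : Prop where
  unif : Unif l
  qq : ∀ x ∈ msupp l, q l x x = ‖x‖ ^ 2

lemma Blow.good {ν l l2 : Measure (E 4)} (hν : Unif ν) (h : Blow ν l) (h2 : Blow l l2) : Good l2 :=
  ⟨h2.1, fun _ hx => h2.q h.1 (fun _ hr u => (h.resc hr).bl hν u) hx⟩

lemma Tan0.perp {ν : Measure (E 4)} {e : E 4} (h : ∀ z ∈ msupp ν, ⟪e, z⟫ = 0) {x : E 4}
    (hx : Tan0 ν x) : ⟪e, x⟫ = 0 := by
  obtain ⟨t, y, h1, h2, h3, h4⟩ := hx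
  have h5 : ∀ k, ⟪e, y k⟫ = 0 := fun k => by
    have := h _ (h4 k)
    rw [real_inner_smul_right] at this
    simpa [(h1 k).ne'] using this
  have h6 : Tendsto (fun k => ⟪e, y k⟫) atTop (𝓝 ⟪e, x⟫) := tendsto_const_nhds.inner h3
  simp only [h5] at h6
  exact tendsto_nhds_unique h6 tendsto_const_nhds

lemma quad_exp (b : OB) (S : E 4 →ₗ[ℝ] E 4) (z : E 4) :
    ⟪S z, z⟫ = ∑ i, ∑ j, ⟪S (b i), b j⟫ * (⟪b i, z⟫ * ⟪b j, z⟫) := by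
  conv_lhs => rw [← b.sum_repr' z]
  simp only [map_sum, map_smul, sum_inner, inner_sum, real_inner_smul_left, real_inner_smul_right]
  rw [Finset.sum_comm]
  refine Finset.sum_congr rfl fun i _ => Finset.sum_congr rfl fun j _ => ?_
  ring

lemma int_quad (ν : Measure (E 4)) [IsLocallyFiniteMeasure ν] (b : OB) (S : E 4 →ₗ[ℝ] E 4) :
    35 / (2 * omega3) * ∫ z, wt z * ⟪S z, z⟫ ∂ν
      = ∑ i, ∑ j, ⟪S (b i), b j⟫ * q ν (b i) (b j) := by
  have e : ∀ z, wt z * ⟪S z, z⟫ = ∑ i, ∑ j, ⟪S (b i), b j⟫ * (wt z * (⟪b i, z⟫ * ⟪b j, z⟫)) := by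
    intro z
    rw [quad_exp b S z, Finset.mul_sum]
    refine Finset.sum_congr rfl fun i _ => ?_
    rw [Finset.mul_sum]
    refine Finset.sum_congr rfl fun j _ => ?_
    ring
  have hi : ∀ i j, Integrable (fun z => ⟪S (b i), b j⟫ * (wt z * (⟪b i, z⟫ * ⟪b j, z⟫))) ν :=
    fun i j => (wt_int1 ν (by fun_prop)).const_mul _
  simp only [e]
  rw [integral_finsetSum _ fun i _ => integrable_finsetSum _ fun j _ => hi i j, Finset.mul_sum]
  refine Finset.sum_congr rfl fun i _ => ?_
  rw [integral_finsetSum _ fun j _ => hi i j, Finset.mul_sum]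
  refine Finset.sum_congr rfl fun j _ => ?_
  rw [integral_const_mul]; unfold q; ring

lemma Good.sum_sq {l : Measure (E 4)} (h : Good l) (b : OB) :
    ∑ i, ∑ j, q l (b i) (b j) ^ 2 = 3 := by
  have := h.unif.lf
  have ho := omega3_pos
  obtain ⟨T, hs, hT⟩ := exists_T l
  have h1 := int_quad l b T
  have h2 : ∫ z, wt z * ⟪T z, z⟫ ∂l = ∫ z, wt z * ‖z‖ ^ 2 ∂l := by
    apply integral_congr_ae
    filter_upwards [ae_msupp l] with z hz
    rw [hT, h.qq z hz]
  rw [h2, h.unif.J11] at h1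
  simp only [hT, ← pow_two] at h1
  rw [← h1]; field_simp; norm_num

lemma exists_basis {n e : E 4} (hn : ‖n‖ = 1) (he : ‖e‖ = 1) (hne : ⟪n, e⟫ = 0) :
    ∃ b : OB, b 0 = n ∧ b 1 = e := by
  let v : Fin 4 → E 4 := ![n, e, 0, 0]
  have hv : Orthonormal ℝ (({0, 1} : Set (Fin 4)).domRestrict v) := by
    constructor
    · rintro ⟨i, hi⟩
      rcases hi with rfl | rfl
      · simpa [v, Set.domRestrict] using hn
      · simpa [v, Set.domRestrict] using he
    · rintro ⟨i, hi⟩ ⟨j, hj⟩ hij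
      rcases hi with rfl | rfl <;> rcases hj with rfl | rfl
      · exact absurd rfl hij
      · simpa [v, Set.domRestrict] using hne
      · simpa [v, Set.domRestrict, real_inner_comm] using hne
      · exact absurd rfl hij
  obtain ⟨b, hb⟩ := hv.exists_orthonormalBasis_extension_of_card_eq (by simp)
  exact ⟨b, by rw [hb 0 (by simp)]; rfl, by rw [hb 1 (by simp)]; rfl⟩

lemma exists_basis1 {n : E 4} (hn : ‖n‖ = 1) : ∃ b : OB, b 0 = n := by
  let v : Fin 4 → E 4 := ![n, 0, 0, 0]
  have hv : Orthonormal ℝ (({0} : Set (Fin 4)).domRestrict v) := by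
    constructor
    · rintro ⟨i, hi⟩
      rcases hi with rfl
      simpa [v, Set.domRestrict] using hn
    · rintro ⟨i, hi⟩ ⟨j, hj⟩ hij
      rcases hi with rfl; rcases hj with rfl
      exact absurd rfl hij
  obtain ⟨b, hb⟩ := hv.exists_orthonormalBasis_extension_of_card_eq (by simp)
  exact ⟨b, by rw [hb 0 (by simp)]; rfl⟩

/-- a uniform measure supported in a hyperplane has full support there -/
lemma Unif.full {l : Measure (E 4)} (h : Unif l) {n : E 4} (hn : ‖n‖ = 1)
    (hl : ∀ z ∈ msupp l, ⟪n, z⟫ = 0) {p : E 4} (hp : ⟪n, p⟫ = 0) : p ∈ msupp l := by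
  by_contra hpn
  obtain ⟨x, hx, hd⟩ := (msupp_closed l).exists_infDist_eq_dist ⟨0, h.z⟩ p
  set e := p - x with he
  have he0 : e ≠ 0 := fun h0 => hpn (by rw [sub_eq_zero.1 h0]; exact hx)
  have hne : ⟪n, e⟫ = 0 := by rw [he, inner_sub_right, hp, hl x hx, sub_zero]
  have hν := h.resc hx one_pos
  obtain ⟨l1, hl1⟩ := hν.blow
  obtain ⟨l2, hl2⟩ := hl1.1.blow
  have hG : Good l2 := Blow.good hν hl1 hl2
  have hperp : ∀ z ∈ msupp (_root_.resc l x 1), ⟪n, z⟫ = 0 := by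
    intro z hz
    rw [resc_msupp _ _ _ one_pos, one_smul] at hz
    have := hl _ hz
    rwa [inner_add_right, hl x hx, zero_add] at this
  have hcone : ∀ z ∈ msupp (_root_.resc l x 1), 2 * ⟪e, z⟫ ≤ ‖z‖ ^ 2 := by
    intro z hz
    rw [resc_msupp _ _ _ one_pos, one_smul] at hz
    have h1 : ‖e‖ ≤ ‖e - z‖ := by
      have := infDist_le_dist_of_mem (x := p) hz
      rw [hd, dist_eq_norm, dist_eq_norm] at this
      rwa [he, sub_sub]
    have h2 : ‖e‖ ^ 2 ≤ ‖e - z‖ ^ 2 := by gcongr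
    rw [norm_sub_sq_real e z] at h2
    linarith
  have hneg : ∀ z, Tan0 (_root_.resc l x 1) z → ⟪e, z⟫ ≤ 0 := by
    rintro z ⟨t, y, h1, h2, h3, h4⟩
    have h5 : Tendsto (fun k => t k * ‖y k‖ ^ 2 - 2 * ⟪e, y k⟫) atTop (𝓝 (0 * ‖z‖ ^ 2 - 2 * ⟪e, z⟫)) :=
      (h2.mul (h3.norm.pow 2)).sub ((tendsto_const_nhds.inner h3).const_mul 2)
    have h6 := ge_of_tendsto' (b := 0) h5 fun k => ?_
    · linarith
    · have h7 := hcone _ (h4 k)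
      have ht := h1 k
      rw [real_inner_smul_right, norm_smul, Real.norm_eq_abs, abs_of_pos ht] at h7
      have : 0 ≤ t k * (t k * ‖y k‖ ^ 2 - 2 * ⟪e, y k⟫) := by nlinarith
      exact nonneg_of_mul_nonneg_right this ht
  have hl1e1 : ∀ m, Blow (_root_.resc l x 1) m → ∀ z ∈ msupp m, ‖z‖ < 1 → ⟪e, z⟫ = 0 := by
    intro m hm z hz hz1
    have := hm.1.lf
    have ho := omega3_pos
    have hc := wt_cont
    have h1 := hm.bl hν e
    have h2 : ∫ z, wt z ^ 2 * ⟪e, z⟫ ∂m = 0 := by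
      have : (35 / (8 * omega3)) ≠ 0 := by positivity
      simpa [bl, this] using h1
    have h3 := int_zero_supp (ν := m) (f := fun z => -(wt z ^ 2 * ⟪e, z⟫)) (by fun_prop) (fun z hz => by
      have := hneg z (hm.tan hz)
      have := sq_nonneg (wt z)
      nlinarith) (wt_int m (by fun_prop) two_ne_zero).neg (by rw [integral_neg, h2, neg_zero]) z hz
    simpa [(wt_pos hz1).ne'] using h3
  have hl1e : ∀ z ∈ msupp l1, ⟪e, z⟫ = 0 := by
    intro z hz
    have hs : 0 < ‖z‖ + 1 := by positivity
    have hs' := hs.ne'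
    have := hl1e1 _ (hl1.resc hs) ((‖z‖ + 1)⁻¹ • z) (by
      rw [resc_msupp _ _ _ hs]; simpa [smul_smul, hs'] using hz) (by
      rw [norm_smul, norm_inv, Real.norm_eq_abs, abs_of_pos hs, inv_mul_lt_iff₀ hs]; linarith)
    rw [real_inner_smul_right] at this
    simpa [hs'] using this
  have hl2e : ∀ z ∈ msupp l2, ⟪e, z⟫ = 0 := fun z hz => (hl2.tan hz).perp hl1e
  have hl1n : ∀ z ∈ msupp l1, ⟪n, z⟫ = 0 := fun z hz => (hl1.tan hz).perp hperp
  have hl2n : ∀ z ∈ msupp l2, ⟪n, z⟫ = 0 := fun z hz => (hl2.tan hz).perp hl1n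
  obtain ⟨b, hb0, hb1⟩ := exists_basis (n := n) (e := ‖e‖⁻¹ • e) hn (by
    rw [norm_smul, norm_inv, norm_norm, inv_mul_cancel₀ (norm_ne_zero_iff.2 he0)])
    (by rw [real_inner_smul_right, hne, mul_zero])
  have q0 : ∀ v, q l2 (b 0) v = 0 := fun v => q_zero_of l2 (by rw [hb0]; exact hl2n)
  have q1 : ∀ v, q l2 (b 1) v = 0 := fun v => q_zero_of l2 (by
    rw [hb1]; intro z hz; rw [real_inner_smul_left, hl2e z hz, mul_zero])
  have h3 := hG.unif.q_trace b
  have h4 := hG.sum_sq b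
  simp only [Fin.sum_univ_four, q0, q1] at h3 h4
  nlinarith [sq_nonneg (q l2 (b 2) (b 2) - q l2 (b 3) (b 3)), sq_nonneg (q l2 (b 2) (b 0)),
    sq_nonneg (q l2 (b 2) (b 1)), sq_nonneg (q l2 (b 2) (b 3)), sq_nonneg (q l2 (b 3) (b 0)),
    sq_nonneg (q l2 (b 3) (b 1)), sq_nonneg (q l2 (b 3) (b 2))]

lemma Unif.le_of_msupp {a b : Measure (E 4)} (ha : Unif a) (hb : Unif b)
    (h : msupp a = msupp b) : b ≤ a := by
  have := ha.lf
  have := hb.lf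
  have h1 : ∀ᵐ x ∂b, a.rnDeriv b x = 1 := by
    filter_upwards [Besicovitch.ae_tendsto_rnDeriv a b, ae_msupp b] with x hx hxb
    have hxa : x ∈ msupp a := h ▸ hxb
    refine tendsto_nhds_unique hx (tendsto_const_nhds.congr' ?_)
    filter_upwards [self_mem_nhdsWithin] with r hr
    have ho := omega3_pos
    have hr' : 0 < r := hr
    have e1 := ha.u x hxa r hr
    have e2 := hb.u x hxb r hr
    have fa : a (closedBall x r) ≠ ⊤ := (isCompact_closedBall _ _).measure_lt_top.ne
    have fb : b (closedBall x r) ≠ ⊤ := (isCompact_closedBall _ _).measure_lt_top.ne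
    have e3 : a (closedBall x r) = b (closedBall x r) :=
      (ENNReal.toReal_eq_toReal_iff' fa fb).1 (e1.trans e2.symm)
    rw [e3, ENNReal.div_self _ fb]
    intro h0
    rw [Measure.real, h0] at e2
    have : 0 < omega3 * r ^ 3 := by positivity
    simp at e2
    rcases e2 with h | h
    · exact ho.ne' h
    · exact hr'.ne' h
  calc b = b.withDensity (fun _ => 1) := by rw [withDensity_const, one_smul]
    _ = b.withDensity (a.rnDeriv b) := (withDensity_congr_ae h1).symm
    _ ≤ a := Measure.withDensity_rnDeriv_le a b

lemma Unif.eq_of_msupp {a b : Measure (E 4)} (ha : Unif a) (hb : Unif b)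
    (h : msupp a = msupp b) : a = b :=
  le_antisymm (hb.le_of_msupp ha h.symm) (ha.le_of_msupp hb h)

lemma map_iso_msupp (ν : Measure (E 4)) (R : E 4 ≃ₗᵢ[ℝ] E 4) (y : E 4) :
    y ∈ msupp (ν.map R) ↔ R.symm y ∈ msupp ν := by
  simp only [msupp, mem_ofPred_eq]
  have hm : Measurable R := R.continuous.measurable
  refine forall_congr' fun r => forall_congr' fun hr => ?_
  rw [Measure.map_apply hm measurableSet_closedBall, R.preimage_closedBall]

lemma Unif.map_iso {ν : Measure (E 4)} (h : Unif ν) (R : E 4 ≃ₗᵢ[ℝ] E 4) : Unif (ν.map R) := by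
  have hm : Measurable R := R.continuous.measurable
  have := h.lf
  have hb : ∀ x r, (ν.map R) (closedBall x r) = ν (closedBall (R.symm x) r) := fun x r => by
    rw [Measure.map_apply hm measurableSet_closedBall, R.preimage_closedBall]
  refine ⟨⟨fun x => ⟨closedBall x 1, closedBall_mem_nhds x one_pos, ?_⟩⟩, ?_, fun x hx r hr => ?_⟩
  · rw [hb]; exact (isCompact_closedBall _ _).measure_lt_top
  · rw [map_iso_msupp]; simpa using h.z
  · rw [Measure.real, hb]; exact h.u _ ((map_iso_msupp _ _ _).1 hx) r hr

section plane
variable {l : Measure (E 4)} {n : E 4}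

lemma plane_iso (h : Unif l) (hl : ∀ z, z ∈ msupp l ↔ ⟪n, z⟫ = 0)
    {u v : E 4} (hu : ⟪n, u⟫ = 0) (hv : ⟪n, v⟫ = 0) (huv : ‖u‖ = ‖v‖) (j k : ℕ) :
    ∫ z, wt z ^ j * ⟪u, z⟫ ^ k ∂l = ∫ z, wt z ^ j * ⟪v, z⟫ ^ k ∂l := by
  let R : E 4 ≃ₗᵢ[ℝ] E 4 := (ℝ ∙ (u - v))ᗮ.reflection
  have hRu : R u = v := Submodule.reflection_sub huv
  have hRn : R n = n := by
    apply Submodule.reflection_mem_subspace_eq_self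
    rw [Submodule.mem_orthogonal_singleton_iff_inner_left, inner_sub_right, hu, hv, sub_zero]
  have hmap : l.map R = l := by
    apply (h.map_iso R).eq_of_msupp h
    ext z
    rw [map_iso_msupp, hl, hl, ← R.inner_map_map, hRn, R.apply_symm_apply]
  conv_rhs => rw [← hmap]
  have hc := wt_cont
  rw [integral_map R.continuous.aemeasurable (by
    exact Continuous.aestronglyMeasurable (by fun_prop))]
  congr 1; funext z
  have e1 : wt (R z) = wt z := by unfold wt; rw [R.norm_map]
  have e2 : ⟪v, R z⟫ = ⟪u, z⟫ := by rw [← hRu, R.inner_map_map]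
  rw [e1, e2]

lemma plane_mom (h : Unif l) (b : OB) (hl : ∀ z, z ∈ msupp l ↔ ⟪b 0, z⟫ = 0) :
    (∀ i, i ≠ 0 → ∫ z, wt z ^ 2 * ⟪b i, z⟫ ^ 2 ∂l = 8 * omega3 / 315) ∧
    (∀ i, i ≠ 0 → ∫ z, wt z * ⟪b i, z⟫ ^ 4 ∂l = 6 * omega3 / 315) ∧
    (∀ i j, i ≠ 0 → j ≠ 0 → i ≠ j →
      ∫ z, wt z * (⟪b i, z⟫ ^ 2 * ⟪b j, z⟫ ^ 2) ∂l = 2 * omega3 / 315) := by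
  have := h.lf
  have hc := wt_cont
  have hp : ∀ i, i ≠ 0 → ⟪b 0, b i⟫ = 0 := fun i hi => b.inner_eq_zero hi.symm
  have hz : ∀ᵐ z ∂l, ⟪b 0, z⟫ = 0 := by
    filter_upwards [ae_msupp l] with z hz using (hl z).1 hz
  have hN : ∀ᵐ z ∂l, ‖z‖ ^ 2 = ⟪b 1, z⟫ ^ 2 + ⟪b 2, z⟫ ^ 2 + ⟪b 3, z⟫ ^ 2 := by
    filter_upwards [hz] with z hz
    rw [← OB.norm_sq b z, Fin.sum_univ_four, hz]; ring
  have ii : ∀ f : E 4 → ℝ, Continuous f → Integrable (fun z => wt z * f z) l := fun f hf => wt_int1 l hf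
  have ii2 : ∀ f : E 4 → ℝ, Continuous f → Integrable (fun z => wt z ^ 2 * f z) l :=
    fun f hf => wt_int l hf two_ne_zero
  have hb2 : ∀ i, i ≠ 0 → ∫ z, wt z ^ 2 * ⟪b i, z⟫ ^ 2 ∂l = ∫ z, wt z ^ 2 * ⟪b 1, z⟫ ^ 2 ∂l :=
    fun i hi => plane_iso h hl (hp i hi) (hp 1 (by decide)) (by simp) 2 2
  have hb4 : ∀ i, i ≠ 0 → ∫ z, wt z * ⟪b i, z⟫ ^ 4 ∂l = ∫ z, wt z * ⟪b 1, z⟫ ^ 4 ∂l :=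
    fun i hi => by simpa using plane_iso h hl (hp i hi) (hp 1 (by decide)) (by simp) 1 4
  have h2 : ∫ z, wt z ^ 2 * ⟪b 1, z⟫ ^ 2 ∂l = 8 * omega3 / 315 := by
    have e : ∫ z, wt z ^ 2 * ‖z‖ ^ 2 ∂l = ∫ z, (wt z ^ 2 * ⟪b 1, z⟫ ^ 2 + wt z ^ 2 * ⟪b 2, z⟫ ^ 2
        + wt z ^ 2 * ⟪b 3, z⟫ ^ 2) ∂l := by
      apply integral_congr_ae
      filter_upwards [hN] with z hz
      rw [hz]; ring
    have j12 : Integrable (fun z => wt z ^ 2 * ⟪b 1, z⟫ ^ 2 + wt z ^ 2 * ⟪b 2, z⟫ ^ 2) l :=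
      (ii2 _ (by fun_prop)).add (ii2 _ (by fun_prop))
    rw [h.J12, integral_add j12 (ii2 _ (by fun_prop)), integral_add (ii2 _ (by fun_prop))
      (ii2 _ (by fun_prop)), hb2 2 (by decide), hb2 3 (by decide)] at e
    linarith
  have h22 : ∀ i j, i ≠ 0 → j ≠ 0 → i ≠ j →
      3 * ∫ z, wt z * (⟪b i, z⟫ ^ 2 * ⟪b j, z⟫ ^ 2) ∂l = ∫ z, wt z * ⟪b 1, z⟫ ^ 4 ∂l := by
    intro i j hi hj hij
    have n1 : ‖b i + b j‖ = ‖(√2 : ℝ) • b 1‖ := by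
      rw [← sq_eq_sq₀ (norm_nonneg _) (norm_nonneg _), norm_add_sq_real, b.inner_eq_zero hij,
        norm_smul]
      simp; norm_num
    have n2 : ‖b i - b j‖ = ‖(√2 : ℝ) • b 1‖ := by
      rw [← sq_eq_sq₀ (norm_nonneg _) (norm_nonneg _), norm_sub_sq_real, b.inner_eq_zero hij,
        norm_smul]
      simp; norm_num
    have v1 : ⟪b 0, (√2 : ℝ) • b 1⟫ = 0 := by rw [real_inner_smul_right, hp 1 (by decide), mul_zero]
    have p1 := plane_iso h hl (by rw [inner_add_right, hp i hi, hp j hj, add_zero]) v1 n1 1 4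
    have p2 := plane_iso h hl (by rw [inner_sub_right, hp i hi, hp j hj, sub_zero]) v1 n2 1 4
    simp only [pow_one] at p1 p2
    have e0 : ∫ z, wt z * ⟪(√2 : ℝ) • b 1, z⟫ ^ 4 ∂l = 4 * ∫ z, wt z * ⟪b 1, z⟫ ^ 4 ∂l := by
      rw [← integral_const_mul]; congr 1; funext z
      have : (√2 : ℝ) ^ 4 = 4 := by
        rw [show (4 : ℕ) = 2 * 2 from rfl, pow_mul, Real.sq_sqrt (by norm_num)]; norm_num
      rw [real_inner_smul_left, mul_pow, this]; ring
    have e1 : ∫ z, wt z * ⟪b i + b j, z⟫ ^ 4 ∂l + ∫ z, wt z * ⟪b i - b j, z⟫ ^ 4 ∂l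
        = 2 * ∫ z, wt z * ⟪b i, z⟫ ^ 4 ∂l + 2 * ∫ z, wt z * ⟪b j, z⟫ ^ 4 ∂l
          + 12 * ∫ z, wt z * (⟪b i, z⟫ ^ 2 * ⟪b j, z⟫ ^ 2) ∂l := by
      have a1 : Integrable (fun z => wt z * ⟪b i + b j, z⟫ ^ 4) l := ii _ (by fun_prop)
      have a2 : Integrable (fun z => wt z * ⟪b i - b j, z⟫ ^ 4) l := ii _ (by fun_prop)
      have a3 : Integrable (fun z => 2 * (wt z * ⟪b i, z⟫ ^ 4)) l := (ii _ (by fun_prop)).const_mul _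
      have a4 : Integrable (fun z => 2 * (wt z * ⟪b j, z⟫ ^ 4)) l := (ii _ (by fun_prop)).const_mul _
      have a5 : Integrable (fun z => 12 * (wt z * (⟪b i, z⟫ ^ 2 * ⟪b j, z⟫ ^ 2))) l :=
        (ii _ (by fun_prop)).const_mul _
      have a34 : Integrable (fun z => 2 * (wt z * ⟪b i, z⟫ ^ 4) + 2 * (wt z * ⟪b j, z⟫ ^ 4)) l :=
        a3.add a4
      rw [← integral_add a1 a2, ← integral_const_mul, ← integral_const_mul, ← integral_const_mul,
        ← integral_add a3 a4, ← integral_add a34 a5]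
      congr 1; funext z
      rw [inner_add_left, inner_sub_left]; ring
    rw [p1, p2, e0, hb4 i hi, hb4 j hj] at e1
    linarith
  have h4 : ∫ z, wt z * ⟪b 1, z⟫ ^ 4 ∂l = 6 * omega3 / 315 := by
    have e : ∫ z, wt z * ‖z‖ ^ 4 ∂l = ∫ z, (wt z * ⟪b 1, z⟫ ^ 4 + wt z * ⟪b 2, z⟫ ^ 4
        + wt z * ⟪b 3, z⟫ ^ 4 + 2 * (wt z * (⟪b 1, z⟫ ^ 2 * ⟪b 2, z⟫ ^ 2))
        + 2 * (wt z * (⟪b 1, z⟫ ^ 2 * ⟪b 3, z⟫ ^ 2))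
        + 2 * (wt z * (⟪b 2, z⟫ ^ 2 * ⟪b 3, z⟫ ^ 2))) ∂l := by
      apply integral_congr_ae
      filter_upwards [hN] with z hz
      rw [show ‖z‖ ^ 4 = (‖z‖ ^ 2) ^ 2 by ring, hz]; ring
    have a1 : ∀ i, Integrable (fun z => wt z * ⟪b i, z⟫ ^ 4) l := fun i => ii _ (by fun_prop)
    have a2 : ∀ i j, Integrable (fun z => 2 * (wt z * (⟪b i, z⟫ ^ 2 * ⟪b j, z⟫ ^ 2))) l :=
      fun i j => (ii _ (by fun_prop)).const_mul _
    rw [integral_add (by exact ((((a1 1).add (a1 2)).add (a1 3)).add (a2 1 2)).add (a2 1 3)) (a2 2 3),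
      integral_add (by exact (((a1 1).add (a1 2)).add (a1 3)).add (a2 1 2)) (a2 1 3),
      integral_add (by exact ((a1 1).add (a1 2)).add (a1 3)) (a2 1 2),
      integral_add (by exact (a1 1).add (a1 2)) (a1 3), integral_add (a1 1) (a1 2),
      hb4 2 (by decide), hb4 3 (by decide), integral_const_mul, integral_const_mul,
      integral_const_mul, h.J21] at e
    have t1 := h22 1 2 (by decide) (by decide) (by decide)
    have t2 := h22 1 3 (by decide) (by decide) (by decide)
    have t3 := h22 2 3 (by decide) (by decide) (by decide)
    linarith
  refine ⟨fun i hi => (hb2 i hi).trans h2, fun i hi => (hb4 i hi).trans h4, fun i j hi hj hij => ?_⟩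
  have := h22 i j hi hj hij
  linarith

end plane

lemma wt1_supp (f : E 4 → ℝ) : HasCompactSupport (fun z => wt z * f z) :=
  HasCompactSupport.intro (isCompact_closedBall (0 : E 4) 1) fun z hz => by rw [wt_zero hz]; simp

lemma wt2_supp (f : E 4 → ℝ) : HasCompactSupport (fun z => wt z ^ 2 * f z) :=
  HasCompactSupport.intro (isCompact_closedBall (0 : E 4) 1) fun z hz => by rw [wt_zero hz]; simp

lemma scale_in {ν : Measure (E 4)} {z : E 4} (hz : z ∈ msupp ν) :
    (‖z‖ + 1)⁻¹ • z ∈ msupp (resc ν 0 (‖z‖ + 1)) ∧ ‖(‖z‖ + 1)⁻¹ • z‖ < 1 := by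
  have hs : 0 < ‖z‖ + 1 := by positivity
  constructor
  · rw [resc_msupp _ _ _ hs]; simpa [smul_smul, hs.ne'] using hz
  · rw [norm_smul, norm_inv, Real.norm_eq_abs, abs_of_pos hs, inv_mul_lt_iff₀ hs]; linarith

lemma exists_diag {A : E 4 →ₗ[ℝ] E 4} (hA : A.IsSymmetric) {n : E 4} (hn : ‖n‖ = 1) :
    ∃ b : OB, b 0 = n ∧ ∀ i j, i ≠ 0 → j ≠ 0 → i ≠ j → ⟪A (b i), b j⟫ = 0 := by
  have hn0 : n ≠ 0 := by rintro rfl; simp at hn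
  let V : Submodule ℝ (E 4) := (ℝ ∙ n)ᗮ
  have : Fact (finrank ℝ (E 4) = 3 + 1) := ⟨by simp⟩
  have hV : finrank ℝ V = 3 := Submodule.finrank_orthogonal_span_singleton hn0
  let T : V →ₗ[ℝ] V := V.orthogonalProjectionOnto.toLinearMap ∘ₗ A ∘ₗ V.subtype
  have hTi : ∀ x y : V, ⟪T x, y⟫ = ⟪A x, (y : E 4)⟫ := by
    intro x y
    show ⟪(V.orthogonalProjectionOnto (A x) : V), y⟫ = _
    rw [Submodule.inner_orthogonalProjectionOnto_eq_of_mem_right]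
  have hT : T.IsSymmetric := by
    intro x y
    rw [hTi, hA, real_inner_comm, ← hTi, real_inner_comm]
  let f := hT.eigenvectorBasis hV
  let v : Fin 4 → E 4 := Fin.cons n (fun i => (f i : E 4))
  have hnf : ∀ i, ⟪n, (f i : E 4)⟫ = 0 := fun i =>
    Submodule.mem_orthogonal_singleton_iff_inner_right.1 (f i).2
  have hff : ∀ i j, ⟪(f i : E 4), (f j : E 4)⟫ = if i = j then 1 else 0 := fun i j => by
    have := f.inner_eq_ite i j
    simpa using this
  have hv : Orthonormal ℝ v := by
    rw [orthonormal_iff_ite]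
    intro i j
    refine Fin.cases ?_ (fun i => ?_) i <;> refine Fin.cases ?_ (fun j => ?_) j
    · simp [v, hn]
    · simp [v, hnf, (Fin.succ_ne_zero _).symm]
    · simp [v, real_inner_comm, hnf]
    · simp [v, hff]
  have hv' : Orthonormal ℝ ((univ : Set (Fin 4)).domRestrict v) := hv.comp _ Subtype.val_injective
  obtain ⟨b, hb⟩ := hv'.exists_orthonormalBasis_extension_of_card_eq (by simp)
  refine ⟨b, hb 0 (mem_univ _), fun i j hi hj hij => ?_⟩
  rw [hb i (mem_univ _), hb j (mem_univ _)]
  obtain ⟨i, rfl⟩ := Fin.exists_succ_eq.2 hi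
  obtain ⟨j, rfl⟩ := Fin.exists_succ_eq.2 hj
  have hij' : i ≠ j := fun h => hij (by rw [h])
  simp only [v, Fin.cons_succ]
  rw [← hTi, hT.apply_eigenvectorBasis, real_inner_smul_left]
  have := f.inner_eq_zero hij'
  simp only [f] at this
  rw [this, mul_zero]

/-- graph-type relation at zero -/
structure GR (ν : Measure (E 4)) (A : E 4 →ₗ[ℝ] E 4) (N : E 4) : Prop where
  unif : Unif ν
  symm : A.IsSymmetric
  ne : N ≠ 0
  rel : ∀ y ∈ msupp ν, ⟪A y, y⟫ + 2 * ⟪N, y⟫ = 0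

section GR
variable {ν : Measure (E 4)} {A : E 4 →ₗ[ℝ] E 4} {N : E 4}

lemma GR.perp (h : GR ν A N) {x : E 4} (hx : Tan0 ν x) : ⟪N, x⟫ = 0 := by
  obtain ⟨t, y, h1, h2, h3, h4⟩ := hx
  have hA : Continuous A := A.continuous_of_finiteDimensional
  have h5 : Tendsto (fun k => t k * ⟪A (y k), y k⟫ + 2 * ⟪N, y k⟫) atTop
      (𝓝 (0 * ⟪A x, x⟫ + 2 * ⟪N, x⟫)) :=
    (h2.mul ((((hA.tendsto x).comp h3)).inner h3)).add ((tendsto_const_nhds.inner h3).const_mul 2)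
  have h6 : ∀ k, t k * ⟪A (y k), y k⟫ + 2 * ⟪N, y k⟫ = 0 := fun k => by
    have := h.rel _ (h4 k)
    rw [map_smul, real_inner_smul_left, real_inner_smul_right, real_inner_smul_right] at this
    have h7 : t k * (t k * ⟪A (y k), y k⟫ + 2 * ⟪N, y k⟫) = 0 := by linarith
    simpa [(h1 k).ne'] using h7
  simp only [h6] at h5
  have := tendsto_nhds_unique h5 tendsto_const_nhds
  linarith

lemma GR.blow (h : GR ν A N) {l : Measure (E 4)} (hl : Blow ν l) (z : E 4) :
    z ∈ msupp l ↔ ⟪N, z⟫ = 0 := by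
  refine ⟨fun hz => h.perp (hl.tan hz), fun hz => ?_⟩
  have hN := norm_ne_zero_iff.2 h.ne
  refine hl.1.full (n := ‖N‖⁻¹ • N) (by rw [norm_smul, norm_inv, norm_norm, inv_mul_cancel₀ hN])
    (fun z hz => ?_) ?_
  · rw [real_inner_smul_left, h.perp (hl.tan hz), mul_zero]
  · rw [real_inner_smul_left, hz, mul_zero]

lemma GR.tan (h : GR ν A N) {x : E 4} (hx : ⟪N, x⟫ = 0) : Tan0 ν x := by
  obtain ⟨l, hl⟩ := h.unif.blow
  exact hl.tan ((h.blow hl x).2 hx)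

lemma GR.resc (h : GR ν A N) {r : ℝ} (hr : 0 < r) : GR (resc ν 0 r) (r • A) N := by
  refine ⟨h.unif.resc h.unif.z hr, fun x y => ?_, h.ne, fun y hy => ?_⟩
  · simp only [LinearMap.smul_apply, real_inner_smul_left, real_inner_smul_right, h.symm x y]
  · rw [resc_msupp _ _ _ hr, zero_add] at hy
    have := h.rel _ hy
    rw [map_smul, real_inner_smul_left, real_inner_smul_right, real_inner_smul_right] at this
    have h2 : r * (r * ⟪A y, y⟫ + 2 * ⟪N, y⟫) = 0 := by linarith
    simpa [hr.ne', LinearMap.smul_apply, real_inner_smul_left] using h2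

lemma GR.bl (h : GR ν A N) (u : E 4) : ‖N‖ ^ 2 * bl ν u = bl ν N * ⟪N, u⟫ := by
  have := h.unif.lf
  obtain ⟨b, hb⟩ := exists_b ν
  have hN : ‖N‖ ^ 2 ≠ 0 := by have := norm_ne_zero_iff.2 h.ne; positivity
  have h1 : ⟪N, ‖N‖ ^ 2 • u - ⟪N, u⟫ • N⟫ = 0 := by
    rw [inner_sub_right, real_inner_smul_right, real_inner_smul_right, real_inner_self_eq_norm_sq]; ring
  have h2 := (h.tan h1).bl h.unif
  rw [hb, inner_sub_right, real_inner_smul_right, real_inner_smul_right, ← hb, ← hb] at h2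
  linarith

lemma GR.q (h : GR ν A N) {x : E 4} (hx : ⟪N, x⟫ = 0) :
    ‖N‖ ^ 2 * (q ν x x - ‖x‖ ^ 2) = _root_.bl ν N * ⟪A x, x⟫ := by
  have := h.unif.lf
  have hN : ‖N‖ ^ 2 ≠ 0 := by have := norm_ne_zero_iff.2 h.ne; positivity
  have hA : Continuous A := A.continuous_of_finiteDimensional
  obtain ⟨t, y, h1, h2, h3, h4⟩ := h.tan hx
  have h5 := (h.unif.rel_seq h1 h2 h3 h4).const_mul (‖N‖ ^ 2)
  have hq := ((q_cont ν).tendsto x).comp h3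
  have hA' : Tendsto (fun k => ⟪A (y k), y k⟫) atTop (𝓝 ⟪A x, x⟫) :=
    ((hA.tendsto x).comp h3).inner h3
  have h6 := ((hq.sub (h3.norm.pow 2)).const_mul (‖N‖ ^ 2)).sub (hA'.const_mul (_root_.bl ν N))
  have h7 : ∀ k, ‖N‖ ^ 2 * (2 * _root_.bl ν (y k) / t k + _root_.q ν (y k) (y k) - ‖y k‖ ^ 2)
     = ‖N‖ ^ 2 * (((fun u => _root_.q ν u u) ∘ y) k - ‖y k‖ ^ 2)
        - _root_.bl ν N * ⟪A (y k), y k⟫ := by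
    intro k
    have := h.rel _ (h4 k)
    rw [map_smul, real_inner_smul_left, real_inner_smul_right, real_inner_smul_right] at this
    have h8 : t k * (t k * ⟪A (y k), y k⟫ + 2 * ⟪N, y k⟫) = 0 := by linarith
    have h9 : 2 * ⟪N, y k⟫ = - (t k * ⟪A (y k), y k⟫) := by
      have : t k * ⟪A (y k), y k⟫ + 2 * ⟪N, y k⟫ = 0 := by simpa [(h1 k).ne'] using h8
      linarith
    have hb := h.bl (y k)
    have ht := (h1 k).ne'
    simp only [Function.comp]
    have e : ‖N‖ ^ 2 * (2 * _root_.bl ν (y k) / t k) = - (_root_.bl ν N * ⟪A (y k), y k⟫) := by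
      rw [show ‖N‖ ^ 2 * (2 * _root_.bl ν (y k) / t k) = 2 * (‖N‖ ^ 2 * _root_.bl ν (y k)) / t k by ring,
        hb, show 2 * (_root_.bl ν N * ⟪N, y k⟫) = _root_.bl ν N * (2 * ⟪N, y k⟫) by ring, h9]
      field_simp
    linarith
  simp only [h7, mul_zero] at h5
  have := tendsto_nhds_unique h5 h6
  linarith

lemma GR.qN (h : GR ν A N) (b : OB) (hb : b 0 = ‖N‖⁻¹ • N) :
    _root_.q ν N N = - _root_.bl ν N * (∑ i, if i = 0 then 0 else ⟪A (b i), b i⟫) := by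
  have := h.unif.lf
  have hN : ‖N‖ ≠ 0 := norm_ne_zero_iff.2 h.ne
  obtain ⟨T, -, hT⟩ := exists_T ν
  have hp : ∀ i, i ≠ 0 → ⟪N, b i⟫ = 0 := fun i hi => by
    have : ⟪b 0, b i⟫ = 0 := b.inner_eq_zero hi.symm
    rw [hb, real_inner_smul_left] at this
    simpa [hN] using this
  have h1 := h.unif.q_trace b
  have h0 : _root_.q ν N N = ‖N‖ ^ 2 * _root_.q ν (b 0) (b 0) := by
    rw [← hT, ← hT, hb, map_smul, real_inner_smul_left, real_inner_smul_right]; field_simp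
  have hi : ∀ i, i ≠ 0 → ‖N‖ ^ 2 * _root_.q ν (b i) (b i) = ‖N‖ ^ 2 + _root_.bl ν N * ⟪A (b i), b i⟫ :=
    fun i hi => by
      have := h.q (hp i hi)
      rw [b.norm_eq_one] at this
      linarith
  rw [h0]
  simp only [Fin.sum_univ_four] at h1 ⊢
  have e1 := hi 1 (by decide)
  have e2 := hi 2 (by decide)
  have e3 := hi 3 (by decide)
  have : ‖N‖ ^ 2 * _root_.q ν (b 0) (b 0) = 3 * ‖N‖ ^ 2 - ‖N‖ ^ 2 * _root_.q ν (b 1) (b 1)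
     - ‖N‖ ^ 2 * _root_.q ν (b 2) (b 2) - ‖N‖ ^ 2 * _root_.q ν (b 3) (b 3) := by rw [← h1]; ring
  rw [this, e1, e2, e3]
  simp
  ring

lemma GR.qN_int (h : GR ν A N) :
    _root_.q ν N N = 35 / (8 * omega3) * ∫ z, wt z * ⟪A z, z⟫ ^ 2 ∂ν ∧
    _root_.bl ν N = - (35 / (16 * omega3)) * ∫ z, wt z ^ 2 * ⟪A z, z⟫ ∂ν := by
  have ho := omega3_pos
  have hz : ∀ᵐ z ∂ν, ⟪N, z⟫ = - (1 / 2) * ⟪A z, z⟫ := by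
    filter_upwards [ae_msupp ν] with z hz
    have := h.rel z hz
    linarith
  constructor
  · unfold _root_.q
    have : ∫ z, wt z * (⟪N, z⟫ * ⟪N, z⟫) ∂ν = ∫ z, (1 / 4) * (wt z * ⟪A z, z⟫ ^ 2) ∂ν := by
      apply integral_congr_ae
      filter_upwards [hz] with z hz
      rw [hz]; ring
    rw [this, integral_const_mul]; field_simp; ring
  · unfold _root_.bl
    have : ∫ z, wt z ^ 2 * ⟪N, z⟫ ∂ν = ∫ z, - (1 / 2) * (wt z ^ 2 * ⟪A z, z⟫) ∂ν := by
      apply integral_congr_ae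
      filter_upwards [hz] with z hz
      rw [hz]; ring
    rw [this, integral_const_mul]; field_simp; ring

lemma GR.int_eq (h : GR ν A N) (b : OB) (hb : b 0 = ‖N‖⁻¹ • N) :
    ∫ z, wt z * ⟪A z, z⟫ ^ 2 ∂ν = (1 / 2) * (∑ i, if i = 0 then 0 else ⟪A (b i), b i⟫) *
      ∫ z, wt z ^ 2 * ⟪A z, z⟫ ∂ν := by
  have ho := omega3_pos
  have h1 := h.qN b hb
  obtain ⟨h2, h3⟩ := h.qN_int
  rw [h2, h3] at h1
  field_simp at h1 ⊢
  linarith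

lemma GR.zero (h : GR ν A N) (b : OB) (hb : b 0 = ‖N‖⁻¹ • N)
    (hH : (∑ i, if i = 0 then 0 else ⟪A (b i), b i⟫) = 0) : ∀ z ∈ msupp ν, ⟪N, z⟫ = 0 := by
  intro z hz
  have hs : 0 < ‖z‖ + 1 := by positivity
  have h1 := (h.resc hs)
  have := h1.unif.lf
  have h2 := h1.qN b hb
  have e : (∑ i, if i = 0 then 0 else ⟪((‖z‖ + 1) • A) (b i), b i⟫)
     = (‖z‖ + 1) * ∑ i, if i = 0 then 0 else ⟪A (b i), b i⟫ := by
    rw [Finset.mul_sum]; refine Finset.sum_congr rfl fun i _ => ?_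
    split_ifs <;> simp [real_inner_smul_left]
  rw [e, hH, mul_zero, mul_zero] at h2
  obtain ⟨k1, k2⟩ := scale_in hz
  have h3 := q_zero _ h2 k1 k2
  rw [real_inner_smul_right] at h3
  simpa [hs.ne'] using h3

lemma GR.H_eq (h : GR ν A N) (b : OB) (hb : b 0 = ‖N‖⁻¹ • N)
    (hd : ∀ i j, i ≠ 0 → j ≠ 0 → i ≠ j → ⟪A (b i), b j⟫ = 0) :
    (∑ i, if i = 0 then 0 else ⟪A (b i), b i⟫) ^ 2
      = 2 * ∑ i, if i = 0 then 0 else ⟪A (b i), b i⟫ ^ 2 := by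
  obtain ⟨l, hl⟩ := h.unif.blow
  have hl' := h.blow hl
  have hN : ‖N‖ ≠ 0 := norm_ne_zero_iff.2 h.ne
  have ho := omega3_pos
  have hc := wt_cont
  have hA : Continuous A := A.continuous_of_finiteDimensional
  have := hl.1.lf
  have hb0 : ∀ z, z ∈ msupp l ↔ ⟪b 0, z⟫ = 0 := by
    intro z; rw [hl', hb, real_inner_smul_left]; simp [hN]
  obtain ⟨m1, m2, m3⟩ := plane_mom hl.1 b hb0
  set H := ∑ i, if i = 0 then 0 else ⟪A (b i), b i⟫ with hH
  -- pass to the limit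
  have key : ∫ z, wt z * ⟪A z, z⟫ ^ 2 ∂l = (1 / 2) * H * ∫ z, wt z ^ 2 * ⟪A z, z⟫ ∂l := by
    obtain ⟨-, r, h2, h3, h4⟩ := hl
    have hq1 : Continuous fun z => ⟪A z, z⟫ := hA.inner continuous_id
    have d1 : Continuous fun z => wt z * ⟪A z, z⟫ ^ 2 := hc.mul (hq1.pow 2)
    have d2 : Continuous fun z => wt z ^ 2 * ⟪A z, z⟫ := (hc.pow 2).mul hq1
    have c1 := h4.conv _ d1 (wt1_supp _)
    have c2 := h4.conv _ d2
      (wt2_supp _)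
    refine tendsto_nhds_unique c1 ((c2.const_mul (1 / 2 * H)).congr fun k => ?_)
    have h5 := (h.resc (h2 k)).int_eq b hb
    have hr := h2 k
    have e : (∑ i, if i = 0 then 0 else ⟪(r k • A) (b i), b i⟫) = r k * H := by
      rw [hH, Finset.mul_sum]; refine Finset.sum_congr rfl fun i _ => ?_
      split_ifs <;> simp [real_inner_smul_left]
    have e1 : ∫ z, wt z * ⟪(r k • A) z, z⟫ ^ 2 ∂(_root_.resc ν 0 (r k))
        = r k ^ 2 * ∫ z, wt z * ⟪A z, z⟫ ^ 2 ∂(_root_.resc ν 0 (r k)) := by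
      rw [← integral_const_mul]; congr 1; funext z
      rw [LinearMap.smul_apply, real_inner_smul_left]; ring
    have e2 : ∫ z, wt z ^ 2 * ⟪(r k • A) z, z⟫ ∂(_root_.resc ν 0 (r k))
        = r k * ∫ z, wt z ^ 2 * ⟪A z, z⟫ ∂(_root_.resc ν 0 (r k)) := by
      rw [← integral_const_mul]; congr 1; funext z
      rw [LinearMap.smul_apply, real_inner_smul_left]; ring
    rw [e, e1, e2] at h5
    have hr2 : r k ^ 2 ≠ 0 := by positivity
    apply mul_left_cancel₀ hr2
    linarith
  have hz : ∀ᵐ z ∂l, ⟪A z, z⟫ = ⟪A (b 1), b 1⟫ * ⟪b 1, z⟫ ^ 2 + ⟪A (b 2), b 2⟫ * ⟪b 2, z⟫ ^ 2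
      + ⟪A (b 3), b 3⟫ * ⟪b 3, z⟫ ^ 2 := by
    filter_upwards [ae_msupp l] with z hz
    have h0 := (hb0 z).1 hz
    rw [quad_exp b A z]
    simp only [Fin.sum_univ_four, h0]
    rw [hd 1 2 (by decide) (by decide) (by decide), hd 1 3 (by decide) (by decide) (by decide),
      hd 2 1 (by decide) (by decide) (by decide), hd 2 3 (by decide) (by decide) (by decide),
      hd 3 1 (by decide) (by decide) (by decide), hd 3 2 (by decide) (by decide) (by decide)]
    ring
  set a1 := ⟪A (b 1), b 1⟫
  set a2 := ⟪A (b 2), b 2⟫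
  set a3 := ⟪A (b 3), b 3⟫
  have ii : ∀ f : E 4 → ℝ, Continuous f → ∀ c : ℝ, Integrable (fun z => c * (wt z * f z)) l :=
    fun f hf c => (wt_int1 l hf).const_mul c
  have ii2 : ∀ f : E 4 → ℝ, Continuous f → ∀ c : ℝ, Integrable (fun z => c * (wt z ^ 2 * f z)) l :=
    fun f hf c => (wt_int l hf two_ne_zero).const_mul c
  have i2 : ∫ z, wt z ^ 2 * ⟪A z, z⟫ ∂l = H * (8 * omega3 / 315) := by
    have j : ∀ i, Integrable (fun z => ⟪A (b i), b i⟫ * (wt z ^ 2 * ⟪b i, z⟫ ^ 2)) l :=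
      fun i => ii2 _ (by fun_prop) _
    have : ∫ z, wt z ^ 2 * ⟪A z, z⟫ ∂l = ∫ z, (a1 * (wt z ^ 2 * ⟪b 1, z⟫ ^ 2)
        + a2 * (wt z ^ 2 * ⟪b 2, z⟫ ^ 2) + a3 * (wt z ^ 2 * ⟪b 3, z⟫ ^ 2)) ∂l := by
      apply integral_congr_ae
      filter_upwards [hz] with z hz
      rw [hz]; ring
    rw [this, integral_add (by exact (j 1).add (j 2)) (j 3), integral_add (j 1) (j 2)]
    simp only [integral_const_mul]
    rw [m1 1 (by decide), m1 2 (by decide), m1 3 (by decide), hH]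
    simp [Fin.sum_univ_four, a1, a2, a3]; ring
  have i4 : ∫ z, wt z * ⟪A z, z⟫ ^ 2 ∂l = (H ^ 2 + 2 * (a1 ^ 2 + a2 ^ 2 + a3 ^ 2)) * (2 * omega3 / 315) := by
    have j : ∀ i, Integrable (fun z => ⟪A (b i), b i⟫ ^ 2 * (wt z * ⟪b i, z⟫ ^ 4)) l :=
      fun i => ii _ (by fun_prop) _
    have j' : ∀ i k, Integrable (fun z => 2 * (⟪A (b i), b i⟫ * ⟪A (b k), b k⟫) *
      (wt z * (⟪b i, z⟫ ^ 2 * ⟪b k, z⟫ ^ 2))) l :=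
      fun i k => ii _ (by fun_prop) _
    have : ∫ z, wt z * ⟪A z, z⟫ ^ 2 ∂l = ∫ z, (a1 ^ 2 * (wt z * ⟪b 1, z⟫ ^ 4)
        + a2 ^ 2 * (wt z * ⟪b 2, z⟫ ^ 4) + a3 ^ 2 * (wt z * ⟪b 3, z⟫ ^ 4)
        + 2 * (a1 * a2) * (wt z * (⟪b 1, z⟫ ^ 2 * ⟪b 2, z⟫ ^ 2))
        + 2 * (a1 * a3) * (wt z * (⟪b 1, z⟫ ^ 2 * ⟪b 3, z⟫ ^ 2))
        + 2 * (a2 * a3) * (wt z * (⟪b 2, z⟫ ^ 2 * ⟪b 3, z⟫ ^ 2))) ∂l := by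
      apply integral_congr_ae
      filter_upwards [hz] with z hz
      rw [hz]; ring
    rw [this, integral_add (by exact ((((j 1).add (j 2)).add (j 3)).add (j' 1 2)).add (j' 1 3)) (j' 2 3),
      integral_add (by exact (((j 1).add (j 2)).add (j 3)).add (j' 1 2)) (j' 1 3),
      integral_add (by exact ((j 1).add (j 2)).add (j 3)) (j' 1 2),
      integral_add (by exact (j 1).add (j 2)) (j 3), integral_add (j 1) (j 2)]
    simp only [integral_const_mul]
    rw [m2 1 (by decide), m2 2 (by decide), m2 3 (by decide),
      m3 1 2 (by decide) (by decide) (by decide), m3 1 3 (by decide) (by decide) (by decide),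
      m3 2 3 (by decide) (by decide) (by decide), hH]
    simp [Fin.sum_univ_four, a1, a2, a3]; ring
  rw [i2, i4] at key
  have hs : (∑ i, if i = 0 then 0 else ⟪A (b i), b i⟫ ^ 2) = a1 ^ 2 + a2 ^ 2 + a3 ^ 2 := by
    simp [Fin.sum_univ_four, a1, a2, a3]
  rw [hs]
  have : omega3 * (H ^ 2 - 2 * (a1 ^ 2 + a2 ^ 2 + a3 ^ 2)) = 0 := by linarith
  have := (mul_eq_zero.1 this).resolve_left ho.ne'
  linarith

/-- basis free version of the relation; `n` is the unit normal -/
lemma GR.trace (h : GR ν A N) (e : OB) {n : E 4} (hn : n = ‖N‖⁻¹ • N) :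
    ((∑ i, ⟪A (e i), e i⟫) - ⟪A n, n⟫) ^ 2
      = 2 * ((∑ i, ‖A (e i)‖ ^ 2) - 2 * ‖A n‖ ^ 2 + ⟪A n, n⟫ ^ 2) := by
  have hN : ‖N‖ ≠ 0 := norm_ne_zero_iff.2 h.ne
  have hn1 : ‖n‖ = 1 := by rw [hn, norm_smul, norm_inv, norm_norm, inv_mul_cancel₀ hN]
  obtain ⟨b, hb, hd⟩ := exists_diag h.symm hn1
  have h1 := h.H_eq b (hb.trans hn) hd
  have t1 : ∑ i, ⟪A (e i), e i⟫ = ∑ i, ⟪A (b i), b i⟫ := by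
    have := (A.trace_eq_sum_inner e).symm.trans (A.trace_eq_sum_inner b)
    simpa only [real_inner_comm] using this
  have t2 : ∑ i, ‖A (e i)‖ ^ 2 = ∑ i, ‖A (b i)‖ ^ 2 := by
    have := ((A ∘ₗ A).trace_eq_sum_inner e).symm.trans ((A ∘ₗ A).trace_eq_sum_inner b)
    have hs : ∀ x, ⟪x, (A ∘ₗ A) x⟫ = ‖A x‖ ^ 2 := fun x => by
      rw [LinearMap.comp_apply, ← h.symm, real_inner_self_eq_norm_sq]
    simpa only [hs] using this
  rw [t1, t2]
  have hn2 : ∀ x, ‖A x‖ ^ 2 = ∑ i, ⟪b i, A x⟫ ^ 2 := fun x => (OB.norm_sq b _).symm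
  simp only [hn2]
  have hsy : ∀ i j, ⟪b i, A (b j)⟫ = ⟪A (b j), b i⟫ := fun i j => real_inner_comm _ _
  have hsy0 : ∀ j, ⟪A (b 0), b j⟫ = ⟪A (b j), b 0⟫ := fun j => by rw [h.symm, real_inner_comm]
  rw [← hb]
  simp only [hsy]
  simp only [Fin.sum_univ_four] at h1 ⊢
  rw [hd 1 2 (by decide) (by decide) (by decide), hd 1 3 (by decide) (by decide) (by decide),
      hd 2 1 (by decide) (by decide) (by decide), hd 2 3 (by decide) (by decide) (by decide),
      hd 3 1 (by decide) (by decide) (by decide), hd 3 2 (by decide) (by decide) (by decide),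
      hsy0 1, hsy0 2, hsy0 3]
  simp at h1
  linarith

end GR

lemma tan_deriv {ν : Measure (E 4)} {x v : E 4} (hx : x ∈ msupp ν) (hv : Tan0 (resc ν x 1) v)
    {f : E 4 → ℝ} (hf : Differentiable ℝ f) (h0 : ∀ y ∈ msupp ν, f y = 0) {D : ℝ}
    (hD : HasDerivAt (fun t : ℝ => f (x + t • v)) D 0) : D = 0 := by
  have h1 : HasDerivAt (fun t : ℝ => f (x + t • v)) (fderiv ℝ f x v) 0 := by
    have h2 : HasFDerivAt f (fderiv ℝ f x) (x + (0:ℝ) • v) := by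
      simpa using (hf x).hasFDerivAt
    have h3 : HasDerivAt (fun t : ℝ => x + t • v) v 0 := by
      simpa using ((hasDerivAt_id (0:ℝ)).smul_const v).const_add x
    exact h2.comp_hasDerivAt (0:ℝ) h3
  rw [hD.unique h1]
  obtain ⟨t, y, ht, ht0, hy, hs⟩ := hv
  have h5 := HasFDerivWithinAt.lim (hasFDerivWithinAt_univ.2 (hf x).hasFDerivAt) (l := atTop)
    (c := fun k => (t k)⁻¹) (d := fun k => t k • y k) (v := v) (by simpa using ht0.smul hy)
    (.of_forall fun _ => mem_univ _) (by
    refine hy.congr fun k => ?_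
    rw [smul_smul, inv_mul_cancel₀ (ht k).ne', one_smul])
  refine tendsto_nhds_unique h5 (tendsto_const_nhds.congr fun k => ?_)
  have h6 := (resc_msupp ν x (t k • y k) one_pos).1 (hs k)
  rw [one_smul] at h6
  rw [h0 _ h6, h0 _ hx]; simp

/-- Good measure with diagonalised second moment. -/
structure GD (l : Measure (E 4)) (e : OB) (a : Fin 4 → ℝ) : Prop where
  good : Good l
  diag : ∀ i j, q l (e i) (e j) = if i = j then 1 + a i else 0

lemma Good.exists_GD {l : Measure (E 4)} (h : Good l) : ∃ e a, GD l e a := by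
  have := h.unif.lf
  obtain ⟨T, hs, hT⟩ := exists_T l
  let e : OB := hs.eigenvectorBasis (by simp : finrank ℝ (E 4) = 4)
  refine ⟨e, fun i => hs.eigenvalues (by simp : finrank ℝ (E 4) = 4) i - 1, h, fun i j => ?_⟩
  rw [← hT, hs.apply_eigenvectorBasis]
  change ⟪_ • e i, e j⟫ = _
  rw [real_inner_smul_left, orthonormal_iff_ite.1 e.orthonormal]
  split_ifs <;> simp

/-- the operator diag(a) in basis e -/
def dg (e : OB) (a : Fin 4 → ℝ) : E 4 →ₗ[ℝ] E 4 :=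
  ∑ i, (a i) • ((innerSL ℝ (e i)).toLinearMap.smulRight (e i))

lemma dg_apply (e : OB) (a : Fin 4 → ℝ) (x : E 4) : dg e a x = ∑ i, (a i * ⟪e i, x⟫) • e i := by
  simp [dg, smul_smul]

lemma dg_inner (e : OB) (a : Fin 4 → ℝ) (x y : E 4) :
    ⟪dg e a x, y⟫ = ∑ i, a i * ⟪e i, x⟫ * ⟪e i, y⟫ := by
  rw [dg_apply, sum_inner]; simp [real_inner_smul_left]

lemma dg_symm (e : OB) (a : Fin 4 → ℝ) : (dg e a).IsSymmetric := fun x y => by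
  rw [dg_inner, real_inner_comm, dg_inner]
  exact Finset.sum_congr rfl fun i _ => by ring

lemma dg_coord (e : OB) (a : Fin 4 → ℝ) (x : E 4) (i : Fin 4) :
    ⟪e i, dg e a x⟫ = a i * ⟪e i, x⟫ := by
  rw [real_inner_comm, dg_inner]
  simp [orthonormal_iff_ite.1 e.orthonormal]

lemma dg_norm (e : OB) (a : Fin 4 → ℝ) (x : E 4) :
    ‖dg e a x‖ ^ 2 = ∑ i, a i ^ 2 * ⟪e i, x⟫ ^ 2 := by
  rw [← OB.norm_sq e]
  exact Finset.sum_congr rfl fun i _ => by rw [dg_coord]; ring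

lemma GD.qq {l : Measure (E 4)} {e : OB} {a : Fin 4 → ℝ} (h : GD l e a) (x y : E 4) :
    q l x y = ⟪x, y⟫ + ⟪dg e a x, y⟫ := by
  have := h.good.unif.lf
  rw [q_exp l e, dg_inner, ← e.sum_inner_mul_inner x y, ← Finset.sum_add_distrib]
  simp only [h.diag]
  refine Finset.sum_congr rfl fun i _ => ?_
  simp [real_inner_comm]
  ring

lemma GD.rel {l : Measure (E 4)} {e : OB} {a : Fin 4 → ℝ} (h : GD l e a) {x : E 4}
    (hx : x ∈ msupp l) : ⟪dg e a x, x⟫ = 0 := by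
  have := h.good.qq x hx
  rw [h.qq, real_inner_self_eq_norm_sq] at this
  linarith

lemma GD.gr {l : Measure (E 4)} {e : OB} {a : Fin 4 → ℝ} (h : GD l e a) {x : E 4}
    (hx : x ∈ msupp l) (hN : dg e a x ≠ 0) : GR (resc l x 1) (dg e a) (dg e a x) := by
  refine ⟨h.good.unif.resc hx one_pos, dg_symm e a, hN, fun y hy => ?_⟩
  rw [resc_msupp _ _ _ one_pos, one_smul] at hy
  have h1 := h.rel hy
  have h2 := h.rel hx
  have h3 := dg_symm e a x y
  rw [map_add, inner_add_left, inner_add_right, inner_add_right, h2] at h1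
  rw [real_inner_comm] at h3
  have h4 : ⟪dg e a y, x⟫ = ⟪dg e a x, y⟫ := by
    rw [dg_symm e a y x, real_inner_comm]
  linarith

/-- the tangential field -/
def fld (e : OB) (a : Fin 4 → ℝ) (i j : Fin 4) (x : E 4) : E 4 :=
  (a j * ⟪e j, x⟫) • e i - (a i * ⟪e i, x⟫) • e j

lemma GD.der {l : Measure (E 4)} {e : OB} {a : Fin 4 → ℝ} (h : GD l e a) {x : E 4}
    (hx : x ∈ msupp l) (i j : Fin 4) {f : E 4 → ℝ} (hf : Differentiable ℝ f)
    (h0 : ∀ y ∈ msupp l, f y = 0) {D : ℝ}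
    (hD : HasDerivAt (fun t : ℝ => f (x + t • fld e a i j x)) D 0) : D = 0 := by
  refine tan_deriv hx ?_ hf h0 hD
  by_cases hN : dg e a x = 0
  · have h1 : ∀ k, a k * ⟪e k, x⟫ = 0 := fun k => by rw [← dg_coord, hN, inner_zero_right]
    have : fld e a i j x = 0 := by simp [fld, h1]
    rw [this]
    refine ⟨fun k => 1 / ((k:ℝ) + 1), fun _ => 0, fun k => by positivity,
      tendsto_one_div_add_atTop_nhds_zero_nat, tendsto_const_nhds, fun k => ?_⟩
    rw [smul_zero]
    exact (h.good.unif.resc hx one_pos).z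
  · refine (h.gr hx hN).tan ?_
    rw [fld, inner_sub_right, real_inner_smul_right, real_inner_smul_right, real_inner_comm (e i),
      real_inner_comm (e j), dg_coord, dg_coord]
    ring

/-- power sums -/
def psum (e : OB) (a : Fin 4 → ℝ) (k : ℕ) (x : E 4) : ℝ := ∑ m, a m ^ k * ⟪e m, x⟫ ^ 2

lemma psum_diff (e : OB) (a : Fin 4 → ℝ) (k : ℕ) : Differentiable ℝ (psum e a k) := by
  unfold psum
  have : ∀ m, Differentiable ℝ (fun x : E 4 => ⟪e m, x⟫) := fun m => (innerSL ℝ (e m)).differentiable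
  fun_prop

lemma sprod_diff (e : OB) (i j : Fin 4) : Differentiable ℝ (fun x => ⟪e i, x⟫ * ⟪e j, x⟫) := by
  have : ∀ m, Differentiable ℝ (fun x : E 4 => ⟪e m, x⟫) := fun m => (innerSL ℝ (e m)).differentiable
  fun_prop

lemma coord_der (e : OB) (m : Fin 4) (x v : E 4) :
    HasDerivAt (fun t : ℝ => ⟪e m, x + t • v⟫) ⟪e m, v⟫ 0 := by
  have h3 : HasDerivAt (fun t : ℝ => x + t • v) v 0 := by
    simpa using ((hasDerivAt_id (0:ℝ)).smul_const v).const_add x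
  exact (innerSL ℝ (e m)).hasFDerivAt.comp_hasDerivAt (0:ℝ) h3

lemma fld_coord (e : OB) (a : Fin 4 → ℝ) (i j m : Fin 4) (x : E 4) :
    ⟪e m, fld e a i j x⟫ = (if m = i then a j * ⟪e j, x⟫ else 0) - if m = j then a i * ⟪e i, x⟫ else 0 := by
  rw [fld, inner_sub_right, real_inner_smul_right, real_inner_smul_right,
    orthonormal_iff_ite.1 e.orthonormal, orthonormal_iff_ite.1 e.orthonormal]
  simp

lemma psum_der (e : OB) (a : Fin 4 → ℝ) (k : ℕ) (i j : Fin 4) (x : E 4) :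
    HasDerivAt (fun t : ℝ => psum e a k (x + t • fld e a i j x))
      (2 * (a i ^ k * a j - a j ^ k * a i) * (⟪e i, x⟫ * ⟪e j, x⟫)) 0 := by
  have h : HasDerivAt (fun t : ℝ => psum e a k (x + t • fld e a i j x))
      (∑ m, a m ^ k * (2 * ⟪e m, x⟫ * ⟪e m, fld e a i j x⟫)) 0 := by
    unfold psum
    refine HasDerivAt.fun_sum fun m _ => ?_
    refine HasDerivAt.const_mul _ ?_
    have := (coord_der e m x (fld e a i j x)).fun_pow 2
    simpa using this
  convert h using 1
  simp only [fld_coord, mul_sub, Finset.sum_sub_distrib]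
  simp
  ring

lemma sprod_der (e : OB) (a : Fin 4 → ℝ) {i j : Fin 4} (hij : i ≠ j) (x : E 4) :
    HasDerivAt (fun t : ℝ => ⟪e i, x + t • fld e a i j x⟫ * ⟪e j, x + t • fld e a i j x⟫)
      (a j * ⟪e j, x⟫ ^ 2 - a i * ⟪e i, x⟫ ^ 2) 0 := by
  have h := (coord_der e i x (fld e a i j x)).fun_mul (coord_der e j x (fld e a i j x))
  have h2 : ⟪e i, fld e a i j x⟫ * ⟪e j, x + (0:ℝ) • fld e a i j x⟫
      + ⟪e i, x + (0:ℝ) • fld e a i j x⟫ * ⟪e j, fld e a i j x⟫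
      = a j * ⟪e j, x⟫ ^ 2 - a i * ⟪e i, x⟫ ^ 2 := by
    rw [fld_coord, fld_coord]
    simp [hij, hij.symm]
    ring
  rw [← h2]; exact h

section
variable {l : Measure (E 4)} {e : OB} {a : Fin 4 → ℝ}

lemma GD.sum (h : GD l e a) : ∑ i, a i = -1 := by
  have := h.good.unif.q_trace e
  simp only [h.diag, if_true, Finset.sum_add_distrib] at this
  simp at this
  linarith

lemma GD.sum2 (h : GD l e a) : ∑ i, a i ^ 2 = 1 := by
  have := h.good.sum_sq e
  have h1 := h.sum
  simp only [h.diag, ite_pow] at this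
  simp [Fin.sum_univ_four] at this h1 ⊢
  linarith

lemma GD.ge (h : GD l e a) (i : Fin 4) : -1 ≤ a i := by
  have := q_nonneg l (e i)
  rw [h.diag] at this
  simp at this
  linarith

lemma GD.G (h : GD l e a) {x : E 4} (hx : x ∈ msupp l) :
    4 * psum e a 4 x * psum e a 2 x - (psum e a 2 x - psum e a 3 x) ^ 2 = 0 := by
  by_cases hN : dg e a x = 0
  · have h1 : ∀ k, a k * ⟪e k, x⟫ = 0 := fun k => by rw [← dg_coord, hN, inner_zero_right]
    have h2 : ∀ k, psum e a (k+2) x = 0 := fun k => Finset.sum_eq_zero fun m _ => by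
      rw [show a m ^ (k+2) * ⟪e m, x⟫ ^ 2 = a m ^ k * (a m * ⟪e m, x⟫) ^ 2 by ring, h1]; simp
    have h3 := h2 0
    have h4 := h2 1
    simp only [Nat.reduceAdd] at h3 h4
    rw [h3, h4]; simp
  · have hg := (h.gr hx hN).trace e rfl
    have hn : ‖dg e a x‖ ≠ 0 := norm_ne_zero_iff.2 hN
    have h2 : psum e a 2 x = ‖dg e a x‖ ^ 2 := by rw [dg_norm]; rfl
    have h3 : psum e a 3 x = ⟪dg e a (dg e a x), dg e a x⟫ := by
      rw [dg_inner]; simp only [dg_coord, psum]; exact Finset.sum_congr rfl fun i _ => by ring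
    have h4 : psum e a 4 x = ‖dg e a (dg e a x)‖ ^ 2 := by
      rw [dg_norm]; simp only [dg_coord, psum]; exact Finset.sum_congr rfl fun i _ => by ring
    have e1 : ∑ i, ⟪dg e a (e i), e i⟫ = -1 := by
      rw [← h.sum]
      refine Finset.sum_congr rfl fun i _ => ?_
      rw [real_inner_comm, dg_coord]; simp
    have e2 : ∑ i, ‖dg e a (e i)‖ ^ 2 = 1 := by
      rw [← h.sum2]
      refine Finset.sum_congr rfl fun i _ => ?_
      rw [dg_norm]; simp [orthonormal_iff_ite.1 e.orthonormal]
    rw [e1, e2, map_smul, norm_smul, real_inner_smul_left, real_inner_smul_right, ← h3, norm_inv,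
      norm_norm, mul_pow, ← h4] at hg
    have hp : psum e a 2 x ≠ 0 := by rw [h2]; positivity
    have h5 : ‖dg e a x‖⁻¹ * (‖dg e a x‖⁻¹ * psum e a 3 x) = psum e a 3 x / psum e a 2 x := by
      rw [h2]; field_simp
    have h6 : ‖dg e a x‖⁻¹ ^ 2 = 1 / psum e a 2 x := by rw [h2]; field_simp
    rw [h5, h6] at hg
    field_simp at hg
    linear_combination hg

lemma GD.pair (h : GD l e a) {i j : Fin 4} (hij : i ≠ j) (hi : a i ≠ 0) (hj : a j ≠ 0)
    (hne : a i ≠ a j) : 4 * (a i ^ 2 + a i * a j + a j ^ 2) = (1 - a i - a j) ^ 2 := by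
  have hlf := h.good.unif.lf
  have p2 := psum_diff e a 2
  have p3 := psum_diff e a 3
  have p4 := psum_diff e a 4
  have ps := sprod_diff e i j
  set c2 := a i ^ 2 * a j - a j ^ 2 * a i with hc2
  set c3 := a i ^ 3 * a j - a j ^ 3 * a i with hc3
  set c4 := a i ^ 4 * a j - a j ^ 4 * a i with hc4
  let L : E 4 → ℝ := fun x => 4 * (c4 * psum e a 2 x + c2 * psum e a 4 x)
    - 2 * (psum e a 2 x - psum e a 3 x) * (c2 - c3)
  have s1 : ∀ x ∈ msupp l, ⟪e i, x⟫ * ⟪e j, x⟫ * L x = 0 := by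
    intro x hx
    have d2 := psum_der e a 2 i j x
    have d3 := psum_der e a 3 i j x
    have d4 := psum_der e a 4 i j x
    have hd := h.der hx i j (f := fun x => 4 * psum e a 4 x * psum e a 2 x
      - (psum e a 2 x - psum e a 3 x) ^ 2) (by fun_prop) (fun y hy => h.G hy)
      (((d4.const_mul 4).fun_mul d2).fun_sub ((d2.fun_sub d3).fun_pow 2))
    simp only [zero_smul, add_zero, ← hc2, ← hc3, ← hc4] at hd
    simp at hd
    simp only [L]
    linear_combination (1/2) * hd
  have s2 : ∀ x ∈ msupp l, (⟪e i, x⟫ * ⟪e j, x⟫) ^ 3 * (8 * c2 * c4 - 2 * (c2 - c3) ^ 2) = 0 := by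
    intro x hx
    have d2 := psum_der e a 2 i j x
    have d3 := psum_der e a 3 i j x
    have d4 := psum_der e a 4 i j x
    have ds := sprod_der e a hij x
    have hd := h.der hx i j (f := fun x => ⟪e i, x⟫ * ⟪e j, x⟫ * (4 * (c4 * psum e a 2 x + c2 * psum e a 4 x)
      - 2 * (psum e a 2 x - psum e a 3 x) * (c2 - c3))) (by fun_prop) (fun y hy => s1 y hy)
      (ds.fun_mul ((((d2.const_mul c4).fun_add (d4.const_mul c2)).const_mul 4).fun_sub
        (((d2.fun_sub d3).const_mul 2).mul_const (c2 - c3))))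
    simp only [zero_smul, add_zero, ← hc2, ← hc3, ← hc4] at hd
    have h1 := s1 x hx
    simp only [L] at h1
    linear_combination (1/2) * (⟪e i, x⟫ * ⟪e j, x⟫) * hd
      - (1/2) * (a j * ⟪e j, x⟫ ^ 2 - a i * ⟪e i, x⟫ ^ 2) * h1
  have hK : 8 * c2 * c4 - 2 * (c2 - c3) ^ 2 = 0 := by
    by_contra hK
    have s3 : ∀ x ∈ msupp l, ⟪e i, x⟫ * ⟪e j, x⟫ = 0 := fun x hx => by
      have := (mul_eq_zero.1 (s2 x hx)).resolve_right hK
      exact pow_eq_zero_iff (by norm_num) |>.1 this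
    have s4 : ∀ x ∈ msupp l, a j * ⟪e j, x⟫ ^ 2 - a i * ⟪e i, x⟫ ^ 2 = 0 := fun x hx =>
      h.der hx i j (f := fun x => ⟪e i, x⟫ * ⟪e j, x⟫) ps s3 (sprod_der e a hij x)
    have s5 : ∀ x ∈ msupp l, ⟪e i, x⟫ = 0 ∧ ⟪e j, x⟫ = 0 := fun x hx => by
      have h1 := s3 x hx
      have h2 := s4 x hx
      rcases mul_eq_zero.1 h1 with h1 | h1 <;> rw [h1] at h2 <;> simp_all
    have e1 := q_zero_of l (v := e i) fun z hz => (s5 z hz).1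
    have e2 := q_zero_of l (v := e j) fun z hz => (s5 z hz).2
    rw [h.diag] at e1 e2
    simp at e1 e2
    exact hne (by linarith)
  have : (a i) ^ 2 * (a j) ^ 2 * (a i - a j) ^ 2 *
      (4 * (a i ^ 2 + a i * a j + a j ^ 2) - (1 - a i - a j) ^ 2) = 0 := by
    rw [hc2, hc3, hc4] at hK
    linear_combination (1/2) * hK
  have h1 := sub_ne_zero.2 hne
  have h2 : (a i) ^ 2 * (a j) ^ 2 * (a i - a j) ^ 2 ≠ 0 := by positivity
  have := (mul_eq_zero.1 this).resolve_left h2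
  linarith
end

lemma two_vals {a : Fin 4 → ℝ} (h1 : ∑ i, a i = -1)
    (hp : ∀ i j, i ≠ j → a i ≠ 0 → a j ≠ 0 → a i ≠ a j →
      4 * (a i ^ 2 + a i * a j + a j ^ 2) = (1 - a i - a j) ^ 2) :
    ∃ α β : ℝ, α ≠ 0 ∧ β ≠ 0 ∧ (∀ i, a i = 0 ∨ a i = α ∨ a i = β) ∧
      (α = β ∨ 4 * (α ^ 2 + α * β + β ^ 2) = (1 - α - β) ^ 2) := by
  obtain ⟨k, hk⟩ : ∃ k, a k ≠ 0 := by
    by_contra! h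
    simp [h] at h1
  by_cases hj : ∃ j, a j ≠ 0 ∧ a j ≠ a k
  · obtain ⟨j, hj0, hjk⟩ := hj
    have hkj : k ≠ j := by rintro rfl; exact hjk rfl
    refine ⟨a k, a j, hk, hj0, fun m => ?_, Or.inr (hp k j hkj hk hj0 hjk.symm)⟩
    by_contra! hm
    obtain ⟨m0, mk, mj⟩ := hm
    have hkm : k ≠ m := by rintro rfl; exact mk rfl
    have hjm : j ≠ m := by rintro rfl; exact mj rfl
    have e1 := hp k j hkj hk hj0 hjk.symm
    have e2 := hp k m hkm hk m0 mk.symm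
    have e3 := hp j m hjm hj0 m0 mj.symm
    have f1 : 3 * (a j + a m) + 2 * a k + 2 = 0 := by
      apply mul_left_cancel₀ (sub_ne_zero.2 mj)
      linear_combination e2 - e1
    have f2 : 3 * (a k + a m) + 2 * a j + 2 = 0 := by
      apply mul_left_cancel₀ (sub_ne_zero.2 mk)
      linear_combination e3 - e1
    exact hjk (by linarith)
  · push Not at hj
    refine ⟨a k, a k, hk, hk, fun m => ?_, Or.inl rfl⟩
    by_cases h : a m = 0
    · exact Or.inl h
    · exact Or.inr (Or.inl (hj m h))

lemma ab_alg {α β : ℝ} (hα : α ≠ 0) (hβ : β ≠ 0)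
    (hr : α = β ∨ 4 * (α ^ 2 + α * β + β ^ 2) = (1 - α - β) ^ 2) (m n : ℕ) (hmn : m + n ≤ 4)
    (h1 : m * α + n * β = -1) (h2 : m * α ^ 2 + n * β ^ 2 = 1) :
    ((m = 0 ∨ α = -1) ∧ (n = 0 ∨ β = -1)) ∨
    (m + n = 4 ∧ (α = 1/2 ∧ β = -1/2 ∨ α = -1/2 ∧ β = 1/2)) := by
  rcases hr with rfl | hr
  · have : α = -1 := by linear_combination α * h1 - h2
    simp [this]
  have hm : m ≤ 4 := by omega
  have hn : n ≤ 4 := by omega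
  interval_cases m <;> interval_cases n <;> simp at hmn h1 h2 ⊢ <;> grind

lemma classify_alg {a : Fin 4 → ℝ} (h1 : ∑ i, a i = -1) (h2 : ∑ i, a i ^ 2 = 1)
    (hp : ∀ i j, i ≠ j → a i ≠ 0 → a j ≠ 0 → a i ≠ a j →
      4 * (a i ^ 2 + a i * a j + a j ^ 2) = (1 - a i - a j) ^ 2) :
    ∃ k, (∀ i, a i = if i = k then -1 else 0) ∨ (∀ i, a i = if i = k then 1/2 else -1/2) := by
  obtain ⟨α, β, hα, hβ, hv, hr⟩ := two_vals h1 hp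
  classical
  have f1 : ∀ i, a i = (if a i = α then 1 else 0 : ℕ) * α + (if a i = β ∧ a i ≠ α then 1 else 0 : ℕ) * β := by
    intro i; rcases hv i with h | h | h <;> split_ifs <;> push_cast <;> grind
  have f2 : ∀ i, a i ^ 2 = (if a i = α then 1 else 0 : ℕ) * α ^ 2
      + (if a i = β ∧ a i ≠ α then 1 else 0 : ℕ) * β ^ 2 := by
    intro i; rcases hv i with h | h | h <;> split_ifs <;> push_cast <;> grind
  have hc := ab_alg hα hβ hr (∑ i, if a i = α then 1 else 0) (∑ i, if a i = β ∧ a i ≠ α then 1 else 0)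
    (by
      rw [← Finset.sum_add_distrib]
      calc _ ≤ ∑ i : Fin 4, 1 := Finset.sum_le_sum fun i _ => by split_ifs <;> grind
        _ = 4 := by simp)
    (by rw [← h1]; push_cast; rw [Finset.sum_mul, Finset.sum_mul, ← Finset.sum_add_distrib]
        exact Finset.sum_congr rfl fun i _ => by conv_rhs => rw [f1 i]
                                                 push_cast; rfl)
    (by rw [← h2]; push_cast; rw [Finset.sum_mul, Finset.sum_mul, ← Finset.sum_add_distrib]
        exact Finset.sum_congr rfl fun i _ => by conv_rhs => rw [f2 i]
                                                 push_cast; rfl)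
  have hT : (∀ i, a i = 0 ∨ a i = -1) ∨ (∀ i, a i = 1/2 ∨ a i = -1/2) := by
    rcases hc with ⟨c1, c2⟩ | ⟨c1, c2⟩
    · left
      intro i
      by_cases h0 : a i = 0
      · exact Or.inl h0
      right
      by_cases hi : a i = α
      · rcases c1 with c1 | c1
        · exact absurd hi (by have := Finset.sum_eq_zero_iff.1 c1 i (Finset.mem_univ i); simpa using this)
        · rw [hi, c1]
      · have hb : a i = β := by rcases hv i with h | h | h <;> tauto
        rcases c2 with c2 | c2
        · have := Finset.sum_eq_zero_iff.1 c2 i (Finset.mem_univ i)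
          simp [hb] at this
          rw [hb] at hi; exact absurd this hi
        · rw [hb, c2]
    · right
      intro i
      have h0 : a i ≠ 0 := by
        intro h0
        rw [← Finset.sum_add_distrib] at c1
        have : ∑ i : Fin 4, ((if a i = α then 1 else 0) + if a i = β ∧ a i ≠ α then 1 else 0) < ∑ i : Fin 4, 1 :=
          Finset.sum_lt_sum (fun i _ => by split_ifs <;> grind)
            ⟨i, Finset.mem_univ i, by rw [h0, if_neg hα.symm, if_neg (fun h => hβ h.1.symm)]; norm_num⟩
        rw [c1] at this
        simp at this
      rcases hv i with h | h | h
      · exact absurd h h0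
      · rw [h]; tauto
      · rw [h]; tauto
  simp only [Fin.sum_univ_four] at h1 h2
  rcases hT with hT | hT <;> rcases hT 0 with e0 | e0 <;> rcases hT 1 with e1 | e1 <;>
    rcases hT 2 with e2 | e2 <;> rcases hT 3 with e3 | e3 <;> rw [e0, e1, e2, e3] at h1 <;> first
    | (exfalso; norm_num at h1; done)
    | (refine ⟨0, Or.inl fun i => ?_⟩; fin_cases i <;> simp [e0, e1, e2, e3] <;> done)
    | (refine ⟨1, Or.inl fun i => ?_⟩; fin_cases i <;> simp [e0, e1, e2, e3] <;> done)
    | (refine ⟨2, Or.inl fun i => ?_⟩; fin_cases i <;> simp [e0, e1, e2, e3] <;> done)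
    | (refine ⟨3, Or.inl fun i => ?_⟩; fin_cases i <;> simp [e0, e1, e2, e3] <;> done)
    | (refine ⟨0, Or.inr fun i => ?_⟩; fin_cases i <;> simp [e0, e1, e2, e3] <;> done)
    | (refine ⟨1, Or.inr fun i => ?_⟩; fin_cases i <;> simp [e0, e1, e2, e3] <;> done)
    | (refine ⟨2, Or.inr fun i => ?_⟩; fin_cases i <;> simp [e0, e1, e2, e3] <;> done)
    | (refine ⟨3, Or.inr fun i => ?_⟩; fin_cases i <;> simp [e0, e1, e2, e3] <;> done)

/-- flat / KP profiles -/
def aF : Fin 4 → ℝ := fun i => if i = 3 then -1 else 0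
def aK : Fin 4 → ℝ := fun i => if i = 3 then 1/2 else -1/2

lemma Good.classify {l : Measure (E 4)} (h : Good l) :
    (∃ e, GD l e aF) ∨ (∃ e, GD l e aK) := by
  obtain ⟨e, a, hG⟩ := h.exists_GD
  obtain ⟨k, hk⟩ := classify_alg hG.sum hG.sum2 fun i j h1 h2 h3 h4 => hG.pair h1 h2 h3 h4
  have hsw : ∀ i, Equiv.swap k 3 i = k ↔ i = 3 := fun i => by
    rw [Equiv.swap_apply_eq_iff, Equiv.swap_apply_left]
  have key : ∀ a' : Fin 4 → ℝ, (∀ i, a (Equiv.swap k 3 i) = a' i) → GD l (e.reindex (Equiv.swap k 3)) a' := by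
    intro a' ha
    refine ⟨h, fun i j => ?_⟩
    rw [OrthonormalBasis.reindex_apply, OrthonormalBasis.reindex_apply, hG.diag, Equiv.symm_swap, ha]
    simp
  rcases hk with hk | hk
  · exact Or.inl ⟨_, key aF fun i => by rw [hk, aF]; simp only [hsw]⟩
  · exact Or.inr ⟨_, key aK fun i => by rw [hk, aK]; simp only [hsw]⟩

lemma ULim.approx {ι : Type} {U : Ultrafilter ι} {μs : ι → Measure (E 4)} {ν : Measure (E 4)}
    (h : ULim U μs ν) (hz : ∀ i, (msupp (μs i)).Nonempty) {x : E 4} (hx : x ∈ msupp ν) :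
    ∃ y : ι → E 4, (∀ i, y i ∈ msupp (μs i)) ∧ Tendsto y U (𝓝 x) := by
  choose y hy hd using fun i => (msupp_closed (μs i)).exists_infDist_eq_dist (hz i) x
  refine ⟨y, hy, Metric.tendsto_nhds.2 fun ε hε => ?_⟩
  filter_upwards [(h.supp x).1 hx ε hε] with i hi
  obtain ⟨z, hz, hzd⟩ := hi
  rw [dist_comm, ← hd i]
  exact (infDist_le_dist_of_mem hz).trans_lt (by rwa [dist_comm])

lemma ULim.mem {ι : Type} {U : Ultrafilter ι} {μs : ι → Measure (E 4)} {ν : Measure (E 4)}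
    (h : ULim U μs ν) {x : E 4} {y : ι → E 4} (hy : ∀ᶠ i in (U : Filter ι), y i ∈ msupp (μs i))
    (hx : Tendsto y U (𝓝 x)) : x ∈ msupp ν := by
  rw [h.supp]
  intro ε hε
  filter_upwards [hy, Metric.tendsto_nhds.1 hx ε hε] with i h1 h2
  exact ⟨_, h1, h2⟩

lemma q_smul (ν : Measure (E 4)) (c : ℝ) (u : E 4) : q ν (c • u) (c • u) = c ^ 2 * q ν u u := by
  unfold q
  simp only [real_inner_smul_left]
  rw [show (fun z : E 4 => wt z * (c * ⟪u, z⟫ * (c * ⟪u, z⟫))) = fun z => c ^ 2 * (wt z * (⟪u, z⟫ * ⟪u, z⟫))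
    from funext fun z => by ring, integral_const_mul]
  ring

lemma bl_smul (ν : Measure (E 4)) (c : ℝ) (u : E 4) : bl ν (c • u) = c * bl ν u := by
  unfold bl
  simp only [real_inner_smul_left]
  rw [show (fun z : E 4 => wt z ^ 2 * (c * ⟪u, z⟫)) = fun z => c * (wt z ^ 2 * ⟪u, z⟫)
    from funext fun z => by ring, integral_const_mul]
  ring

lemma Unif.rel_big {ν : Measure (E 4)} (h : Unif ν) {x : E 4} (hx : x ∈ msupp ν) {R : ℝ} (hR : 0 < R)
    (hxR : ‖x‖ ≤ R) :
    |2 * (R * bl (_root_.resc ν 0 R) x) + q (_root_.resc ν 0 R) x x - ‖x‖ ^ 2| ≤ 3000 * ‖x‖ ^ 3 / R := by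
  have h1 := h.resc h.z hR
  have h2 : R⁻¹ • x ∈ msupp (_root_.resc ν 0 R) := by
    rw [resc_msupp _ _ _ hR, zero_add, smul_smul, mul_inv_cancel₀ hR.ne', one_smul]; exact hx
  have hn : ‖R⁻¹ • x‖ = ‖x‖ / R := by
    rw [norm_smul, norm_inv, Real.norm_of_nonneg hR.le]; ring
  have h3 := h1.rel h2 (by rw [hn, div_le_one hR]; exact hxR)
  rw [q_smul, bl_smul, hn] at h3
  have h4 : 2 * (R * bl (_root_.resc ν 0 R) x) + q (_root_.resc ν 0 R) x x - ‖x‖ ^ 2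
      = R ^ 2 * (2 * (R⁻¹ * bl (_root_.resc ν 0 R) x) + R⁻¹ ^ 2 * q (_root_.resc ν 0 R) x x - (‖x‖ / R) ^ 2) := by
    field_simp
  rw [h4, abs_mul, abs_of_pos (by positivity)]
  calc R ^ 2 * _ ≤ R ^ 2 * (3000 * (‖x‖ / R) ^ 3) := by gcongr
    _ = _ := by field_simp

lemma Unif.down {ν : Measure (E 4)} (h : Unif ν) : ∃ l b, Good l ∧
    ULim (hyperfilter ℕ) (fun k : ℕ => _root_.resc ν 0 ((k : ℝ) + 1)) l ∧
    ∀ x ∈ msupp ν, q l x x - ‖x‖ ^ 2 + 2 * ⟪b, x⟫ = 0 := by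
  have hR : ∀ k : ℕ, (0:ℝ) < (k:ℝ) + 1 := fun k => by positivity
  have hRt : Tendsto (fun k : ℕ => (k:ℝ) + 1) (hyperfilter ℕ) atTop :=
    hyper_le (tendsto_atTop_add_const_right _ _ tendsto_natCast_atTop_atTop)
  have hu : ∀ k : ℕ, Unif (_root_.resc ν 0 ((k:ℝ) + 1)) := fun k => h.resc h.z (hR k)
  have hlf : ∀ k : ℕ, IsLocallyFiniteMeasure (_root_.resc ν 0 ((k:ℝ) + 1)) := fun k => (hu k).lf
  obtain ⟨l, hl, hL⟩ := (AU.of_unif (hyperfilter ℕ) hu).exists_ulim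
  have hllf := hl.lf
  choose c hc using fun k : ℕ => exists_b (_root_.resc ν 0 ((k:ℝ) + 1))
  obtain ⟨β, hβ⟩ : ∃ β : ℕ → E 4, ∀ (k : ℕ) (x : E 4),
      ((k:ℝ) + 1) * bl (_root_.resc ν 0 ((k:ℝ) + 1)) x = ⟪β k, x⟫ :=
    ⟨fun k => ((k:ℝ) + 1) • c k, fun k x => by rw [hc, real_inner_smul_left]⟩
  -- the fundamental relation
  have hrel : ∀ x ∈ msupp ν, Tendsto (fun k : ℕ => 2 * ⟪β k, x⟫ + q (_root_.resc ν 0 ((k:ℝ) + 1)) x x - ‖x‖ ^ 2)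
      (hyperfilter ℕ) (𝓝 0) := by
    intro x hx
    refine squeeze_zero_norm' (a := fun k : ℕ => 3000 * ‖x‖ ^ 3 / ((k:ℝ) + 1)) ?_ (hRt.const_div_atTop _)
    filter_upwards [hRt.eventually_ge_atTop ‖x‖] with k hk
    rw [← hβ]
    exact h.rel_big hx (hR k) hk
  have hbd : ∃ M, ∀ᶠ k in (hyperfilter ℕ : Filter ℕ), β k ∈ closedBall (0 : E 4) M := by
    by_contra! hcon
    have hM : Tendsto (fun k => ‖β k‖) (hyperfilter ℕ) atTop := by
      refine tendsto_atTop.2 fun M => ?_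
      filter_upwards [hcon M] with k hk
      rw [mem_closedBall_zero_iff, not_le] at hk
      exact hk.le
    obtain ⟨w, hw1, hw⟩ := ultra_compact (hyperfilter ℕ) (isCompact_sphere (0 : E 4) 1)
      (fun k => ‖β k‖⁻¹ • β k) (by
        filter_upwards [hM.eventually_gt_atTop 0] with k hk
        rw [mem_sphere_zero_iff_norm, norm_smul, norm_inv, norm_norm, inv_mul_cancel₀ hk.ne'])
    have hw1 : ‖w‖ = 1 := by simpa using hw1
    have hwp : ∀ x ∈ msupp ν, ⟪w, x⟫ = 0 := by
      intro x hx
      have h1 := hrel x hx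
      have h2 : Tendsto (fun k : ℕ => ‖β k‖⁻¹) (hyperfilter ℕ) (𝓝 0) := tendsto_inv_atTop_zero.comp hM
      have h3 := (h1.sub (hL.q x x)).add_const (‖x‖ ^ 2)
      have h4 := h2.mul h3
      rw [zero_mul] at h4
      have h5 : Tendsto (fun k => 2 * ⟪‖β k‖⁻¹ • β k, x⟫) (hyperfilter ℕ) (𝓝 (2 * ⟪w, x⟫)) :=
        (hw.inner tendsto_const_nhds).const_mul 2
      have h6 := tendsto_nhds_unique h5 (h4.congr fun k => by
        rw [real_inner_smul_left]; ring)
      linarith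
    have h7 : ∀ k, ⟪‖β k‖⁻¹ • β k, w⟫ = 0 := by
      intro k
      rw [real_inner_smul_left, ← hβ, bl_zero_of]
      · simp
      · intro z hz
        rw [resc_msupp _ _ _ (hR k), zero_add] at hz
        have := hwp _ hz
        rw [real_inner_smul_right] at this
        exact (mul_eq_zero.1 this).resolve_left (hR k).ne'
    have h8 : Tendsto (fun k => ⟪‖β k‖⁻¹ • β k, w⟫) (hyperfilter ℕ) (𝓝 ⟪w, w⟫) :=
      hw.inner tendsto_const_nhds
    simp only [h7] at h8
    have := tendsto_nhds_unique h8 tendsto_const_nhds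
    rw [real_inner_self_eq_norm_sq, hw1] at this
    norm_num at this
  obtain ⟨M, hM⟩ := hbd
  obtain ⟨b, -, hb⟩ := ultra_compact (hyperfilter ℕ) (isCompact_closedBall (0 : E 4) M) β hM
  have hfin : ∀ x ∈ msupp ν, q l x x - ‖x‖ ^ 2 + 2 * ⟪b, x⟫ = 0 := by
    intro x hx
    have h5 : Tendsto (fun k => 2 * ⟪β k, x⟫) (hyperfilter ℕ) (𝓝 (2 * ⟪b, x⟫)) :=
      (hb.inner tendsto_const_nhds).const_mul 2
    have h6 := tendsto_nhds_unique (hrel x hx) ((h5.add (hL.q x x)).sub_const (‖x‖ ^ 2))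
    linarith
  refine ⟨l, b, ⟨hl, fun x hx => ?_⟩, hL, hfin⟩
  obtain ⟨y, hy, hyx⟩ := hL.approx (fun k => ⟨0, (hu k).z⟩) hx
  have h1 : ∀ k, q l (y k) (y k) - ‖y k‖ ^ 2 + ((k:ℝ) + 1)⁻¹ * (2 * ⟪b, y k⟫) = 0 := by
    intro k
    have := hy k
    rw [resc_msupp _ _ _ (hR k), zero_add] at this
    have := hfin _ this
    rw [q_smul, norm_smul, real_inner_smul_right, Real.norm_of_nonneg (hR k).le] at this
    have h0 := (hR k).ne'
    field_simp
    apply mul_left_cancel₀ h0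
    linear_combination this
  have h2 : Tendsto (fun k : ℕ => q l (y k) (y k) - ‖y k‖ ^ 2 + ((k:ℝ) + 1)⁻¹ * (2 * ⟪b, y k⟫))
      (hyperfilter ℕ) (𝓝 (q l x x - ‖x‖ ^ 2 + 0 * (2 * ⟪b, x⟫))) := by
    refine ((((q_cont l).tendsto x).comp hyx).sub (hyx.norm.pow 2)).add
      ((tendsto_inv_atTop_zero.comp hRt).mul ((tendsto_const_nhds.inner hyx).const_mul 2))
  simp only [h1] at h2
  have := tendsto_nhds_unique h2 tendsto_const_nhds
  linarith

lemma dgF (e : OB) (x y : E 4) : ⟪dg e aF x, y⟫ = - (⟪e 3, x⟫ * ⟪e 3, y⟫) := by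
  rw [dg_inner]; simp [Fin.sum_univ_four, aF]

lemma dgF_norm (e : OB) (x : E 4) : ‖dg e aF x‖ ^ 2 = ⟪e 3, x⟫ ^ 2 := by
  rw [dg_norm]; simp [Fin.sum_univ_four, aF]

lemma Unif.flat_inf {ν l : Measure (E 4)} (h : Unif ν) {b : E 4} {e : OB} (hG : GD l e aF)
    (hr : ∀ x ∈ msupp ν, q l x x - ‖x‖ ^ 2 + 2 * ⟪b, x⟫ = 0) :
    ∃ u : E 4, ‖u‖ = 1 ∧ ∀ z ∈ msupp ν, ⟪u, z⟫ = 0 := by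
  have hr' : ∀ x ∈ msupp ν, ⟪dg e aF x, x⟫ + 2 * ⟪b, x⟫ = 0 := fun x hx => by
    have := hr x hx
    rw [hG.qq, real_inner_self_eq_norm_sq] at this
    linarith
  have he3 : ‖e 3‖ = 1 := e.norm_eq_one 3
  by_cases hb : b = 0
  · refine ⟨e 3, he3, fun z hz => ?_⟩
    have := hr' z hz
    rw [hb, dgF] at this
    simpa using this
  have g : GR ν (dg e aF) b := ⟨h, dg_symm _ _, hb, hr'⟩
  have hn0 : ‖b‖ ≠ 0 := norm_ne_zero_iff.2 hb
  obtain ⟨n, hn⟩ : ∃ n, n = ‖b‖⁻¹ • b := ⟨_, rfl⟩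
  have hn1 : ‖n‖ = 1 := by rw [hn, norm_smul, norm_inv, norm_norm, inv_mul_cancel₀ hn0]
  have ht := g.trace e hn
  obtain ⟨f, hf⟩ := exists_basis1 hn1
  have hs : ∀ f : OB, ∑ i, ⟪e 3, f i⟫ ^ 2 = 1 := fun f => by
    have := OB.norm_sq f (e 3)
    rw [he3, one_pow] at this
    rw [← this]
    exact Finset.sum_congr rfl fun i _ => by rw [real_inner_comm]
  have t1 : ∀ f : OB, ∑ i, ⟪dg e aF (f i), f i⟫ = -1 := fun f => by
    rw [← hs f, ← Finset.sum_neg_distrib]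
    exact Finset.sum_congr rfl fun i _ => by rw [dgF]; ring
  have t2 : ∑ i, ‖dg e aF (e i)‖ ^ 2 = 1 := by
    rw [← hs e]; exact Finset.sum_congr rfl fun i _ => by rw [dgF_norm]
  rw [t1, t2, dgF_norm, dgF] at ht
  have hc : ⟪e 3, n⟫ ^ 2 = 1 := by
    have : (1 - ⟪e 3, n⟫ ^ 2) ^ 2 = 0 := by linear_combination - ht
    have := pow_eq_zero_iff (by norm_num) |>.1 this
    linarith
  refine ⟨n, hn1, fun z hz => ?_⟩
  have := g.zero f (hf.trans hn) (by
    have := t1 f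
    simp only [Fin.sum_univ_four] at this ⊢
    simp
    rw [hf, dgF] at this
    linarith) z hz
  rw [hn, real_inner_smul_left, this, mul_zero]

/-- nonflatness at unit scale -/
def NF (ε : ℝ) (ν : Measure (E 4)) : Prop := ∀ u : E 4, ‖u‖ = 1 → ε ≤ q ν u u

lemma GD.K_NF {l : Measure (E 4)} {e : OB} (h : GD l e aK) {u : E 4} (hu : ‖u‖ = 1) :
    1 / 2 ≤ q l u u := by
  rw [h.qq, real_inner_self_eq_norm_sq, hu, dg_inner]
  have := OB.norm_sq e u
  rw [hu] at this
  simp [Fin.sum_univ_four, aK] at this ⊢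
  nlinarith [sq_nonneg ⟪e 3, u⟫]

/-- blow-down dichotomy -/
lemma Unif.inf_flat {ν : Measure (E 4)} (h : Unif ν) {ρ₀ : ℝ}
    (hn : ∀ ρ > ρ₀, ∃ u : E 4, ‖u‖ = 1 ∧ q (_root_.resc ν 0 ρ) u u ≤ 1 / 4) :
    ∃ u : E 4, ‖u‖ = 1 ∧ ∀ z ∈ msupp ν, ⟪u, z⟫ = 0 := by
  obtain ⟨l, b, hG, hL, hr⟩ := h.down
  rcases hG.classify with ⟨e, he⟩ | ⟨e, he⟩
  · exact h.flat_inf he hr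
  exfalso
  have hR : ∀ k : ℕ, (0:ℝ) < (k:ℝ) + 1 := fun k => by positivity
  have hRt : Tendsto (fun k : ℕ => (k:ℝ) + 1) (hyperfilter ℕ) atTop :=
    hyper_le (tendsto_atTop_add_const_right _ _ tendsto_natCast_atTop_atTop)
  have hlf : ∀ k : ℕ, IsLocallyFiniteMeasure (_root_.resc ν 0 ((k:ℝ) + 1)) := fun k => (h.resc h.z (hR k)).lf
  have hllf := hG.unif.lf
  have : ∀ k : ℕ, ∃ u : E 4, ‖u‖ = 1 ∧ (ρ₀ < (k:ℝ) + 1 → q (_root_.resc ν 0 ((k:ℝ) + 1)) u u ≤ 1 / 4) := by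
    intro k
    by_cases hk : ρ₀ < (k:ℝ) + 1
    · obtain ⟨u, h1, h2⟩ := hn _ hk; exact ⟨u, h1, fun _ => h2⟩
    · exact ⟨e 0, e.norm_eq_one 0, fun h => absurd h hk⟩
  choose u hu hq using this
  obtain ⟨w, hw1, hw⟩ := ultra_compact (hyperfilter ℕ) (isCompact_sphere (0 : E 4) 1) u
    (Eventually.of_forall fun k => by simpa using hu k)
  have h1 := hL.q' hlf hw
  have h2 : q l w w ≤ 1 / 4 := le_of_tendsto h1 (by
    filter_upwards [hRt.eventually_gt_atTop ρ₀] with k hk using hq k hk)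
  have h3 := he.K_NF (u := w) (by simpa using hw1)
  linarith

structure Hyp (μ : Measure (E 4)) (α C₀ : ℝ) : Prop where
  lf : IsLocallyFiniteMeasure μ
  z : (0 : E 4) ∈ msupp μ
  hα : 0 < α
  reg : ∀ x ∈ msupp μ ∩ closedBall (0 : E 4) 1, ∀ r : ℝ, 0 < r → r ≤ 1 →
      |(μ (closedBall x r)).toReal / (omega3 * r ^ 3) - 1| ≤ C₀ * r ^ α

lemma Hyp.au {μ : Measure (E 4)} {α C₀ : ℝ} (h : Hyp μ α C₀) {ι : Type} {U : Ultrafilter ι} {r : ι → ℝ}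
    (hr : ∀ i, 0 < r i) (h0 : Tendsto r U (𝓝 0)) : AU U (fun i => resc μ 0 (r i)) := by
  have := h.lf
  have ho := omega3_pos
  have hα := h.hα
  refine ⟨fun i => resc_lf μ 0 (hr i), fun i => ?_, fun R ε hR hε => ?_⟩
  · rw [resc_msupp _ _ _ (hr i)]; simpa using h.z
  have hC : 0 ≤ C₀ := by
    have := h.reg 0 ⟨h.z, by simp⟩ 1 one_pos le_rfl
    rw [Real.one_rpow, mul_one] at this
    exact (abs_nonneg _).trans this
  have t1 : Tendsto (fun i => omega3 * R ^ 3 * (C₀ * (r i * R) ^ α)) U (𝓝 (omega3 * R ^ 3 * (C₀ * (0 * R) ^ α))) := by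
    refine Tendsto.const_mul _ (Tendsto.const_mul _ ?_)
    exact (h0.mul_const R).rpow_const (Or.inr hα.le)
  rw [zero_mul, Real.zero_rpow hα.ne', mul_zero, mul_zero] at t1
  have t2 : Tendsto (fun i => r i * R) U (𝓝 (0 * R)) := h0.mul_const R
  rw [zero_mul] at t2
  filter_upwards [t1.eventually_le_const hε, t2.eventually_le_const one_pos] with i h1 h2
  intro x hx hxR ρ hρ hρR
  have hri := hr i
  rw [resc_msupp _ _ _ hri, zero_add] at hx
  have hle : r i * ρ ≤ r i * R := by gcongr
  have h3 := h.reg (r i • x) ⟨hx, by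
    rw [mem_closedBall_zero_iff, norm_smul, Real.norm_of_nonneg hri.le]
    exact (mul_le_mul_of_nonneg_left hxR hri.le).trans h2⟩ (r i * ρ) (by positivity) (hle.trans h2)
  rw [resc_real _ _ _ hri, zero_add]
  have h4 : (r i)⁻¹ ^ 3 * μ.real (closedBall (r i • x) (r i * ρ)) - omega3 * ρ ^ 3
      = omega3 * ρ ^ 3 * ((μ (closedBall (r i • x) (r i * ρ))).toReal / (omega3 * (r i * ρ) ^ 3) - 1) := by
    rw [Measure.real]
    field_simp
  rw [h4, abs_mul, abs_of_pos (by positivity)]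
  refine le_trans ?_ h1
  have h5 : (r i * ρ) ^ α ≤ (r i * R) ^ α := Real.rpow_le_rpow (by positivity) hle hα.le
  calc _ ≤ omega3 * ρ ^ 3 * (C₀ * (r i * ρ) ^ α) := by gcongr
    _ ≤ omega3 * R ^ 3 * (C₀ * (r i * R) ^ α) := by gcongr

lemma ULim.not_NF {ι : Type} {U : Ultrafilter ι} {μs : ι → Measure (E 4)} {ν : Measure (E 4)}
    (h : ULim U μs ν) (hl : ∀ i, IsLocallyFiniteMeasure (μs i)) [IsLocallyFiniteMeasure ν] {η : ℝ}
    (hn : ∀ᶠ i in (U : Filter ι), ¬ NF η (μs i)) : ∃ u : E 4, ‖u‖ = 1 ∧ _root_.q ν u u ≤ η := by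
  have : ∀ i, ∃ u : E 4, ‖u‖ = 1 ∧ (¬ NF η (μs i) → _root_.q (μs i) u u ≤ η) := by
    intro i
    by_cases hi : NF η (μs i)
    · exact ⟨EuclideanSpace.single 0 1, by simp, fun h => absurd hi h⟩
    · have h2 := hi
      unfold NF at h2
      push Not at h2
      obtain ⟨u, h1, h2⟩ := h2
      exact ⟨u, h1, fun _ => h2.le⟩
  choose u hu hq using this
  obtain ⟨w, hw1, hw⟩ := ultra_compact U (isCompact_sphere (0 : E 4) 1) u
    (Eventually.of_forall fun k => by simpa using hu k)
  refine ⟨w, by simpa using hw1, le_of_tendsto (h.q' hl hw) ?_⟩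
  filter_upwards [hn] with i hi using hq i hi

lemma ULim.NF {ι : Type} {U : Ultrafilter ι} {μs : ι → Measure (E 4)} {ν : Measure (E 4)}
    (h : ULim U μs ν) {η : ℝ} (hn : ∀ᶠ i in (U : Filter ι), NF η (μs i)) : _root_.NF η ν := by
  intro u hu
  refine ge_of_tendsto (h.q u u) ?_
  filter_upwards [hn] with i hi using hi u hu

lemma Unif.flat_of_scales {ν : Measure (E 4)} (h : Unif ν)
    (hs : ∀ ρ > 0, ∀ η > 0, ∃ u : E 4, ‖u‖ = 1 ∧ q (_root_.resc ν 0 ρ) u u ≤ η) :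
    ∃ u : E 4, ‖u‖ = 1 ∧ ∀ z ∈ msupp ν, ⟪u, z⟫ = 0 := by
  have hR : ∀ k : ℕ, (0:ℝ) < (k:ℝ) + 1 := fun k => by positivity
  have hRt : Tendsto (fun k : ℕ => (k:ℝ) + 1) (hyperfilter ℕ) atTop :=
    hyper_le (tendsto_atTop_add_const_right _ _ tendsto_natCast_atTop_atTop)
  have h1 : ∀ k : ℕ, ∃ u : E 4, ‖u‖ = 1 ∧ ∀ z ∈ msupp ν, ‖z‖ < (k:ℝ) + 1 → ⟪u, z⟫ = 0 := by
    intro k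
    have hlf := (h.resc h.z (hR k)).lf
    obtain ⟨u, hu, hm⟩ := (isCompact_sphere (0 : E 4) 1).exists_isMinOn
      ⟨EuclideanSpace.single 0 1, by simp⟩ (q_cont (_root_.resc ν 0 ((k:ℝ) + 1))).continuousOn
    have hu1 : ‖u‖ = 1 := by simpa using hu
    have hq0 : q (_root_.resc ν 0 ((k:ℝ) + 1)) u u = 0 := by
      refine le_antisymm (le_of_forall_pos_le_add fun η hη => ?_) (q_nonneg _ _)
      obtain ⟨v, hv, hv2⟩ := hs _ (hR k) η hη
      rw [zero_add]
      exact (hm (by simpa using hv : v ∈ sphere (0 : E 4) 1)).trans hv2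
    refine ⟨u, hu1, fun z hz hzk => ?_⟩
    have h2 := q_zero _ hq0 (z := ((k:ℝ) + 1)⁻¹ • z) (by
      rw [resc_msupp _ _ _ (hR k), zero_add, smul_smul, mul_inv_cancel₀ (hR k).ne', one_smul]; exact hz)
      (by rw [norm_smul, norm_inv, Real.norm_of_nonneg (hR k).le, ← div_eq_inv_mul, div_lt_one (hR k)]; exact hzk)
    rw [real_inner_smul_right] at h2
    exact (mul_eq_zero.1 h2).resolve_left (inv_ne_zero (hR k).ne')
  choose u hu hq using h1
  obtain ⟨w, hw1, hw⟩ := ultra_compact (hyperfilter ℕ) (isCompact_sphere (0 : E 4) 1) u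
    (Eventually.of_forall fun k => by simpa using hu k)
  refine ⟨w, by simpa using hw1, fun z hz => ?_⟩
  have h2 : Tendsto (fun k => ⟪u k, z⟫) (hyperfilter ℕ) (𝓝 ⟪w, z⟫) := hw.inner tendsto_const_nhds
  refine tendsto_nhds_unique h2 (tendsto_const_nhds.congr' ?_)
  filter_upwards [hRt.eventually_gt_atTop ‖z‖] with k hk
  rw [hq k z hz hk]

lemma setD_le {n : ℕ} {A B : Set (E n)} {c : ℝ} (hc : 0 ≤ c) (h : ∀ a ∈ A, infDist a B ≤ c) :
    setD A B ≤ c := Real.iSup_le (fun a => Real.iSup_le (fun ha => h a ha) hc) hc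

lemma dxr_nonneg {n : ℕ} {x : E n} {r : ℝ} (hr : 0 < r) (A B : Set (E n)) : 0 ≤ dxr x r A B :=
  mul_nonneg (by positivity) (Real.iSup_nonneg fun _ => Real.iSup_nonneg fun _ => infDist_nonneg)

lemma thetaP_nonneg {S : Set (E 4)} {r : ℝ} (hr : 0 < r) : 0 ≤ thetaP 3 S 0 r :=
  Real.iInf_nonneg fun _ => le_max_of_le_left (dxr_nonneg hr _ _)

lemma thetaP_le {S : Set (E 4)} {r η : ℝ} (hr : 0 < r) (hη : 0 ≤ η) {u : E 4} (hu : ‖u‖ = 1)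
    (h1 : ∀ a ∈ S, ‖a‖ ≤ r → |⟪u, a⟫| ≤ η * r)
    (h2 : ∀ v : E 4, ⟪u, v⟫ = 0 → ‖v‖ ≤ r → ∃ y ∈ S, ‖y‖ ≤ r ∧ dist v y ≤ η * r) :
    thetaP 3 S 0 r ≤ η := by
  have hu0 : u ≠ 0 := by rintro rfl; simp at hu
  let V : Submodule ℝ (E 4) := (ℝ ∙ u)ᗮ
  have : Fact (finrank ℝ (E 4) = 3 + 1) := ⟨by simp⟩
  have hV : finrank ℝ V = 3 := Submodule.finrank_orthogonal_span_singleton hu0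
  have hmem : ∀ z, z ∈ (V.toAffineSubspace : Set (E 4)) ↔ ⟪u, z⟫ = 0 := fun z => by
    simp [V, Submodule.mem_orthogonal_singleton_iff_inner_right]
  have hb : BddBelow (range fun L : {L : AffineSubspace ℝ (E 4) // (0 : E 4) ∈ L ∧
      Module.finrank ℝ L.direction = 3} => Dxr 0 r S (L.1 : Set (E 4))) :=
    ⟨0, by rintro _ ⟨L, rfl⟩; exact le_max_of_le_left (dxr_nonneg hr _ _)⟩
  refine (ciInf_le hb ⟨V.toAffineSubspace, by simp, by rw [Submodule.toAffineSubspace_direction]; exact hV⟩).trans ?_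
  have key : ∀ A B : Set (E 4), setD (A ∩ closedBall 0 r) (B ∩ closedBall 0 r) ≤ η * r → dxr 0 r A B ≤ η := by
    intro A B h
    unfold dxr
    rw [one_div, inv_mul_le_iff₀ hr, mul_comm]; exact h
  refine max_le (key _ _ (setD_le (by positivity) ?_)) (key _ _ (setD_le (by positivity) ?_))
  · rintro a ⟨ha, har⟩
    rw [mem_closedBall_zero_iff] at har
    have hp : ‖a - ⟪u, a⟫ • u‖ ^ 2 = ‖a‖ ^ 2 - ⟪u, a⟫ ^ 2 := by
      rw [@norm_sub_sq_real, norm_smul, hu, real_inner_smul_right, real_inner_comm, mul_one, Real.norm_eq_abs,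
        sq_abs]; ring
    have hmem' : a - ⟪u, a⟫ • u ∈ (V.toAffineSubspace : Set (E 4)) ∩ closedBall 0 r := by
      refine ⟨(hmem _).2 ?_, ?_⟩
      · rw [inner_sub_right, real_inner_smul_right, real_inner_self_eq_norm_sq, hu]; ring
      · rw [mem_closedBall_zero_iff]
        exact (abs_le_of_sq_le_sq' (by nlinarith [sq_nonneg ⟪u, a⟫]) (norm_nonneg a)).2.trans har
    refine (infDist_le_dist_of_mem hmem').trans ?_
    rw [dist_eq_norm, sub_sub_cancel, norm_smul, hu, mul_one, Real.norm_eq_abs]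
    exact h1 a ha har
  · rintro v ⟨hv, hvr⟩
    rw [mem_closedBall_zero_iff] at hvr
    obtain ⟨y, h3, h4, h5⟩ := h2 v ((hmem v).1 hv) hvr
    have hy : y ∈ S ∩ closedBall (0 : E 4) r := ⟨h3, by rwa [mem_closedBall_zero_iff]⟩
    exact (infDist_le_dist_of_mem hy).trans h5

lemma Hyp.claimA {μ : Measure (E 4)} {α C₀ : ℝ} (h : Hyp μ α C₀)
    (hnf : ¬ Tendsto (fun r : ℝ => thetaP 3 (msupp μ) 0 r) (𝓝[>] 0) (𝓝 0)) :
    ∃ ε > 0, ∃ᶠ r in 𝓝[>] (0:ℝ), NF ε (resc μ 0 r) := by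
  by_contra! hcon
  apply hnf
  have hlfμ := h.lf
  refine Metric.tendsto_nhds.2 fun ε₁ hε₁ => ?_
  by_contra hfr
  obtain ⟨ε, hε, hε1, hε2⟩ : ∃ ε > 0, ε < ε₁ ∧ ε ≤ 1 :=
    ⟨min (ε₁ / 2) 1, by positivity, (min_le_left _ _).trans_lt (by linarith), min_le_right _ _⟩
  obtain ⟨r, hr0, hr⟩ := Filter.exists_seq_forall_of_frequently
    ((not_eventually.1 hfr).and_eventually self_mem_nhdsWithin)
  have hpos : ∀ i, 0 < r i := fun i => (hr i).2
  have hth : ∀ i, ε < thetaP 3 (msupp μ) 0 (r i) := fun i => by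
    have := (hr i).1
    rw [Real.dist_eq, sub_zero, abs_of_nonneg (thetaP_nonneg (hpos i)), not_lt] at this
    linarith
  have hU : Tendsto r (hyperfilter ℕ) (𝓝[>] 0) := hyper_le hr0
  have hA := h.au hpos (hU.mono_right nhdsWithin_le_nhds)
  obtain ⟨ν, hν, hL⟩ := hA.exists_ulim
  have hνlf := hν.lf
  obtain ⟨u, hu, hflat⟩ := hν.flat_of_scales (by
    intro ρ hρ η hη
    have hL2 := hL.resc hρ
    have := (hν.resc hν.z hρ).lf
    refine hL2.not_NF (fun i => ?_) ?_
    · have := hA.lf i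
      exact resc_lf _ _ hρ
    · have h1 : Tendsto (fun i => r i * ρ) (hyperfilter ℕ) (𝓝[>] 0) := by
        refine tendsto_nhdsWithin_iff.2 ⟨?_, Eventually.of_forall fun i => mul_pos (hpos i) hρ⟩
        simpa using (hU.mono_right nhdsWithin_le_nhds).mul_const ρ
      have h2 := h1.eventually (hcon η hη)
      filter_upwards [h2] with i hi
      rwa [resc_resc _ (hpos i) hρ])
  have hfull : ∀ p, ⟪u, p⟫ = 0 → p ∈ msupp ν := fun p hp => hν.full hu hflat hp
  have e1 : ∀ᶠ i in (hyperfilter ℕ : Filter ℕ), ∀ y ∈ msupp (resc μ 0 (r i)), ‖y‖ ≤ 1 → |⟪u, y⟫| ≤ ε := by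
    by_contra hc
    have hc := Ultrafilter.frequently_iff_eventually.1 (not_eventually.1 hc)
    have : ∀ i, ∃ y : E 4, (∃ y ∈ msupp (resc μ 0 (r i)), ‖y‖ ≤ 1 ∧ ε < |⟪u, y⟫|) →
      (y ∈ msupp (resc μ 0 (r i)) ∧ ‖y‖ ≤ 1 ∧ ε < |⟪u, y⟫|) := fun i => by
      by_cases hi : ∃ y ∈ msupp (resc μ 0 (r i)), ‖y‖ ≤ 1 ∧ ε < |⟪u, y⟫|
      · obtain ⟨y, h1⟩ := hi; exact ⟨y, fun _ => h1⟩
      · exact ⟨0, fun h => absurd h hi⟩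
    choose y hy using this
    have hy : ∀ᶠ i in (hyperfilter ℕ : Filter ℕ), y i ∈ msupp (resc μ 0 (r i)) ∧ ‖y i‖ ≤ 1 ∧ ε < |⟪u, y i⟫| := by
      filter_upwards [hc] with i hi
      push Not at hi
      exact hy i hi
    obtain ⟨w, -, hw⟩ := ultra_compact (hyperfilter ℕ) (isCompact_closedBall (0 : E 4) 1) y
      (hy.mono fun i hi => by simpa using hi.2.1)
    have hw2 := hflat w (hL.mem (hy.mono fun i hi => hi.1) hw)
    have : ε ≤ |⟪u, w⟫| := ge_of_tendsto (tendsto_const_nhds.inner hw).abs (hy.mono fun i hi => hi.2.2.le)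
    rw [hw2, abs_zero] at this
    linarith
  have e2 : ∀ᶠ i in (hyperfilter ℕ : Filter ℕ), ∀ v : E 4, ⟪u, v⟫ = 0 → ‖v‖ ≤ 1 →
      ∃ y ∈ msupp (resc μ 0 (r i)), ‖y‖ ≤ 1 ∧ dist v y ≤ ε := by
    by_contra hc
    have hc := Ultrafilter.frequently_iff_eventually.1 (not_eventually.1 hc)
    let P : ℕ → E 4 → Prop := fun i v => ⟪u, v⟫ = 0 ∧ ‖v‖ ≤ 1 ∧
      ∀ y ∈ msupp (resc μ 0 (r i)), ‖y‖ ≤ 1 → ε < dist v y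
    have : ∀ i, ∃ v : E 4, (∃ v, P i v) → P i v := fun i => by
      by_cases hi : ∃ v, P i v
      · obtain ⟨y, h1⟩ := hi; exact ⟨y, fun _ => h1⟩
      · exact ⟨0, fun h => absurd h hi⟩
    choose v hv using this
    have hv : ∀ᶠ i in (hyperfilter ℕ : Filter ℕ), P i (v i) := by
      filter_upwards [hc] with i hi
      push Not at hi
      exact hv i hi
    obtain ⟨w, hw1, hw⟩ := ultra_compact (hyperfilter ℕ) (isCompact_closedBall (0 : E 4) 1) v
      (hv.mono fun i hi => by simpa using hi.2.1)
    have hw1 : ‖w‖ ≤ 1 := by simpa using hw1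
    have hw2 : ⟪u, w⟫ = 0 := by
      refine tendsto_nhds_unique (tendsto_const_nhds.inner hw) (tendsto_const_nhds.congr' ?_)
      filter_upwards [hv] with i hi
      rw [hi.1]
    have hw3 : (1 - ε / 4) • w ∈ msupp ν := hfull _ (by rw [real_inner_smul_right, hw2, mul_zero])
    obtain ⟨y, hy, hyw⟩ := hL.approx (fun i => ⟨0, hA.z i⟩) hw3
    have hn : ‖(1 - ε / 4) • w‖ < 1 := by
      rw [norm_smul, Real.norm_of_nonneg (by linarith)]
      nlinarith [norm_nonneg w]
    have hd : dist w ((1 - ε / 4) • w) ≤ ε / 4 := by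
      rw [dist_eq_norm, show w - (1 - ε / 4) • w = (ε / 4) • w by rw [sub_smul, one_smul]; abel,
        norm_smul, Real.norm_of_nonneg (by linarith)]
      nlinarith [norm_nonneg w]
    have c1 := hyw.norm.eventually_lt_const hn
    have c2 := Metric.tendsto_nhds.1 hyw (ε / 4) (by linarith)
    have c3 := Metric.tendsto_nhds.1 hw (ε / 4) (by linarith)
    obtain ⟨i, hi, d1, d2, d3⟩ := (hv.and (c1.and (c2.and c3))).exists
    have d4 := hi.2.2 (y i) (hy i) d1.le
    have d5 := dist_triangle4 (v i) w ((1 - ε / 4) • w) (y i)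
    rw [dist_comm] at d2
    linarith
  obtain ⟨i, h1, h2⟩ := (e1.and e2).exists
  have hri := hpos i
  refine absurd (hth i) (not_lt.2 (thetaP_le hri hε.le hu ?_ ?_))
  · intro a ha har
    have := h1 ((r i)⁻¹ • a) (by
      rw [resc_msupp _ _ _ hri, zero_add, smul_smul, mul_inv_cancel₀ hri.ne', one_smul]; exact ha)
      (by rw [norm_smul, norm_inv, Real.norm_of_nonneg hri.le, ← div_eq_inv_mul, div_le_one hri]; exact har)
    rw [real_inner_smul_right, abs_mul, abs_of_pos (by positivity), ← div_eq_inv_mul, div_le_iff₀ hri] at this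
    exact this
  · intro v hv hvr
    obtain ⟨y, g1, g2, g3⟩ := h2 ((r i)⁻¹ • v) (by rw [real_inner_smul_right, hv, mul_zero])
      (by rw [norm_smul, norm_inv, Real.norm_of_nonneg hri.le, ← div_eq_inv_mul, div_le_one hri]; exact hvr)
    refine ⟨r i • y, by rwa [resc_msupp _ _ _ hri, zero_add] at g1, ?_, ?_⟩
    · rw [norm_smul, Real.norm_of_nonneg hri.le]
      nlinarith
    · have : v = r i • ((r i)⁻¹ • v) := by rw [smul_smul, mul_inv_cancel₀ hri.ne', one_smul]
      rw [this, dist_smul₀, Real.norm_of_nonneg hri.le]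
      nlinarith

lemma Hyp.claimB {μ : Measure (E 4)} {α C₀ : ℝ} (h : Hyp μ α C₀)
    (hnf : ¬ Tendsto (fun r : ℝ => thetaP 3 (msupp μ) 0 r) (𝓝[>] 0) (𝓝 0)) :
    ∃ c > 0, ∀ᶠ r in 𝓝[>] (0:ℝ), NF c (resc μ 0 r) := by
  have hlfμ := h.lf
  obtain ⟨ε', hε', hfr'⟩ := h.claimA hnf
  obtain ⟨ε, hε, hε4, hfr⟩ : ∃ ε > 0, ε ≤ 1 / 4 ∧ ∃ᶠ r in 𝓝[>] (0:ℝ), NF ε (resc μ 0 r) :=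
    ⟨min ε' (1/4), by positivity, min_le_right _ _, hfr'.mono fun r hr u hu => (min_le_left _ _).trans (hr u hu)⟩
  by_contra! hcon
  have h1 : ∀ i : ℕ, ∃ r : ℝ, 0 < r ∧ r < 1 / ((i:ℝ) + 1) ∧ ¬ NF (1 / ((i:ℝ) + 1)) (resc μ 0 r) := by
    intro i
    have hi : (0:ℝ) < 1 / ((i:ℝ) + 1) := by positivity
    have := (hcon _ hi).and_eventually (Ioo_mem_nhdsGT hi)
    obtain ⟨r, h1, h2⟩ := this.exists
    exact ⟨r, h2.1, h2.2, h1⟩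
  choose r hr0 hr1 hr2 using h1
  have h2 : ∀ i, ∃ s, 0 < s ∧ s ≤ r i ∧ NF ε (resc μ 0 s) ∧ ∀ t, 2 * s < t → t ≤ r i → ¬ NF ε (resc μ 0 t) := by
    intro i
    obtain ⟨t, ht, ht2⟩ := (hfr.and_eventually (Ioo_mem_nhdsGT (hr0 i))).exists
    let A : Set ℝ := {s | 0 < s ∧ s ≤ r i ∧ NF ε (resc μ 0 s)}
    have hA : A.Nonempty := ⟨t, ht2.1, ht2.2.le, ht⟩
    have hB : BddAbove A := ⟨r i, fun s hs => hs.2.1⟩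
    have hs0 : 0 < sSup A := ht2.1.trans_le (le_csSup hB ⟨ht2.1, ht2.2.le, ht⟩)
    obtain ⟨s, hs, hs2⟩ := exists_lt_of_lt_csSup hA (half_lt_self hs0)
    refine ⟨s, hs.1, hs.2.1, hs.2.2, fun t h1 h2 h3 => ?_⟩
    have := le_csSup hB (show t ∈ A from ⟨by linarith [hs.1], h2, h3⟩)
    linarith
  choose s hs0 hs1 hs2 hs3 using h2
  have hst : Tendsto s (hyperfilter ℕ) (𝓝 0) := by
    refine hyper_le (squeeze_zero (fun i => (hs0 i).le) (fun i => (hs1 i).trans (hr1 i).le)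
      tendsto_one_div_add_atTop_nhds_zero_nat)
  have hratio : Tendsto (fun i => r i / s i) (hyperfilter ℕ) atTop := by
    have h5 : ∀ i : ℕ, ε * ((i:ℝ) + 1) ≤ (r i / s i) ^ 5 := by
      intro i
      have hi := hr2 i
      unfold NF at hi
      push Not at hi
      obtain ⟨u, hu, hq⟩ := hi
      have hh := hs0 i
      have hh' := hr0 i
      have := resc_lf μ 0 (hr0 i)
      have h6 := q_mono (resc μ 0 (r i)) (u := u) (σ := s i / r i) (by positivity) (by rw [div_le_one hh']; exact hs1 i)
      rw [resc_resc _ hh' (by positivity), mul_div_cancel₀ _ hh'.ne', inv_div] at h6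
      have h7 := hs2 i u hu
      have h8 : ε ≤ (r i / s i) ^ 5 * (1 / ((i:ℝ) + 1)) :=
        h7.trans (h6.trans (by gcongr))
      rw [mul_one_div, le_div_iff₀ (by positivity)] at h8
      exact h8
    refine tendsto_atTop.2 fun M => ?_
    have h6 : Tendsto (fun i : ℕ => ε * ((i:ℝ) + 1)) (hyperfilter ℕ) atTop :=
      (hyper_le (tendsto_atTop_add_const_right _ _ tendsto_natCast_atTop_atTop)).const_mul_atTop hε
    filter_upwards [h6.eventually_ge_atTop (|M| ^ 5)] with i hi
    have h7 : |M| ≤ r i / s i := le_of_pow_le_pow_left₀ (by norm_num) (div_nonneg (hr0 i).le (hs0 i).le) (hi.trans (h5 i))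
    exact (le_abs_self M).trans h7
  have hA := h.au hs0 hst
  obtain ⟨ν, hν, hL⟩ := hA.exists_ulim
  have hνlf := hν.lf
  have hN : NF ε ν := hL.NF (Eventually.of_forall hs2)
  obtain ⟨u, hu, hz⟩ := hν.inf_flat (ρ₀ := 2) (by
    intro ρ hρ2
    have hρ : 0 < ρ := by linarith
    have hL2 := hL.resc hρ
    have := (hν.resc hν.z hρ).lf
    obtain ⟨u, hu, hq⟩ := hL2.not_NF (η := ε) (fun i => by
      have := hA.lf i
      exact resc_lf _ _ hρ) (by
      filter_upwards [hratio.eventually_ge_atTop ρ] with i hi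
      rw [resc_resc _ (hs0 i) hρ]
      rw [le_div_iff₀ (hs0 i)] at hi
      exact hs3 i _ (by nlinarith [hs0 i]) (by linarith))
    exact ⟨u, hu, hq.trans hε4⟩)
  have h8 := hN u hu
  rw [q_zero_of ν hz] at h8
  linarith

lemma GD.form_mom {l : Measure (E 4)} {e : OB} {a : Fin 4 → ℝ} (h : GD l e a) {d : Fin 4 → Fin 4 → ℝ}
    (h0 : ∀ x ∈ msupp l, ∑ p, ∑ s, d p s * (⟪e p, x⟫ * ⟪e s, x⟫) = 0) :
    ∑ p, d p p * (1 + a p) = 0 := by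
  have := h.good.unif.lf
  have h1 : ∑ p, ∑ s, d p s * q l (e p) (e s) = 0 := by
    have e1 : ∀ p s, d p s * q l (e p) (e s)
        = 35 / (2 * omega3) * ∫ z, d p s * (wt z * (⟪e p, z⟫ * ⟪e s, z⟫)) ∂l := fun p s => by
      rw [integral_const_mul]; unfold q; ring
    have hi : ∀ p s, Integrable (fun z => d p s * (wt z * (⟪e p, z⟫ * ⟪e s, z⟫))) l := fun p s =>
      (wt_int1 l (by fun_prop)).const_mul _
    simp only [e1, ← Finset.mul_sum]
    simp only [← integral_finsetSum _ (fun s _ => hi _ s)]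
    rw [← integral_finsetSum _ (fun p _ => integrable_finsetSum _ fun s _ => hi p s)]
    rw [integral_eq_zero_of_ae, mul_zero]
    filter_upwards [ae_msupp l] with z hz
    have h2 := h0 z hz
    simp only [Pi.zero_apply]
    calc _ = wt z * ∑ p, ∑ s, d p s * (⟪e p, z⟫ * ⟪e s, z⟫) := by
          simp only [Finset.mul_sum]
          exact Finset.sum_congr rfl fun p _ => Finset.sum_congr rfl fun s _ => by ring
      _ = 0 := by rw [h2, mul_zero]
  simp only [h.diag] at h1
  simpa using h1

/-- coefficients of the derivative of a quadratic form along the field `fld e aK i 3` -/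
def dform (c : Fin 4 → Fin 4 → ℝ) (i : Fin 4) (r s : Fin 4) : ℝ :=
  (if r = 3 then (c i s + c s i) / 2 else 0) + (if r = i then (c 3 s + c s 3) / 2 else 0)

lemma GD.form_der {l : Measure (E 4)} {e : OB} (h : GD l e aK) {c : Fin 4 → Fin 4 → ℝ}
    (h0 : ∀ x ∈ msupp l, ∑ p, ∑ s, c p s * (⟪e p, x⟫ * ⟪e s, x⟫) = 0) {i : Fin 4} (hi : i ≠ 3) :
    ∀ x ∈ msupp l, ∑ p, ∑ s, dform c i p s * (⟪e p, x⟫ * ⟪e s, x⟫) = 0 := by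
  intro x hx
  have hd := h.der hx i 3 (f := fun x => ∑ p, ∑ s, c p s * (⟪e p, x⟫ * ⟪e s, x⟫))
    (by have := sprod_diff e; fun_prop) h0
    (HasDerivAt.fun_sum fun p _ => HasDerivAt.fun_sum fun s _ =>
      ((coord_der e p x (fld e aK i 3 x)).fun_mul (coord_der e s x (fld e aK i 3 x))).const_mul (c p s))
  simp only [zero_smul, add_zero, fld_coord] at hd
  rw [← hd]
  fin_cases i
  · simp [Fin.sum_univ_four, dform, aK]; ring
  · simp [Fin.sum_univ_four, dform, aK]; ring
  · simp [Fin.sum_univ_four, dform, aK]; ring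
  · simp at hi

lemma GD.form_off {l : Measure (E 4)} {e : OB} (h : GD l e aK) {c : Fin 4 → Fin 4 → ℝ}
    (h0 : ∀ x ∈ msupp l, ∑ p, ∑ s, c p s * (⟪e p, x⟫ * ⟪e s, x⟫) = 0) {i : Fin 4} (hi : i ≠ 3) :
    c i 3 + c 3 i = 0 := by
  have := h.form_mom (h.form_der h0 hi)
  fin_cases i
  · simp [Fin.sum_univ_four, dform, aK] at this ⊢; linarith
  · simp [Fin.sum_univ_four, dform, aK] at this ⊢; linarith
  · simp [Fin.sum_univ_four, dform, aK] at this ⊢; linarith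
  · simp at hi

lemma GD.form {l : Measure (E 4)} {e : OB} (h : GD l e aK) {c : Fin 4 → Fin 4 → ℝ}
    (h0 : ∀ x ∈ msupp l, ∑ p, ∑ s, c p s * (⟪e p, x⟫ * ⟪e s, x⟫) = 0)
    (hs : ∀ i j, c i j = c j i) (ht : ∑ i, c i i = -1) (i j : Fin 4) :
    c i j = if i = j then aK i else 0 := by
  have h1 : ∀ i, i ≠ 3 → c i 3 = 0 := fun i hi => by
    have := h.form_off h0 hi
    rw [hs 3 i] at this; linarith
  have h2 : ∀ i k, i ≠ 3 → k ≠ 3 → c i k + (if k = i then c 3 3 else 0) = 0 := fun i k hi hk => by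
    have := h.form_off (h.form_der h0 hi) hk
    simp only [dform, hk, if_true, if_false, Ne.symm hi, zero_add, add_zero, hs k i] at this
    split_ifs at this ⊢ <;> linarith
  have h00 := h2 0 0 (by decide) (by decide)
  have h11 := h2 1 1 (by decide) (by decide)
  have h22 := h2 2 2 (by decide) (by decide)
  simp [Fin.sum_univ_four] at ht h00 h11 h22
  have h33 : c 3 3 = 1 / 2 := by linarith
  by_cases hi : i = 3
  · by_cases hj : j = 3
    · subst hi; subst hj; simp [aK, h33]
    · subst hi; rw [hs, h1 j hj]; simp [Ne.symm hj]
  · by_cases hj : j = 3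
    · subst hj; rw [h1 i hi]; simp [hi]
    · have := h2 i j hi hj
      by_cases hij : i = j
      · subst hij; simp [h33] at this; simp [aK, hi]; linarith
      · simp [Ne.symm hij] at this; simp [hij, this]

lemma Unif.struct {ν : Measure (E 4)} (h : Unif ν) {c : ℝ} (hc : 0 < c)
    (hN : ∀ ρ > 0, NF c (_root_.resc ν 0 ρ)) :
    ∃ e : OB, ∀ ρ > 0, ∀ i j, q (_root_.resc ν 0 ρ) (e i) (e j) = if i = j then 1 + aK i else 0 := by
  obtain ⟨l, hl⟩ := h.blow
  have hlN : _root_.NF c l := by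
    obtain ⟨h1, r, h2, h3, h4⟩ := hl
    exact h4.NF (Eventually.of_forall fun k => hN _ (h2 k))
  have hb : ∀ ρ > 0, ∀ u, bl (_root_.resc ν 0 ρ) u = 0 := by
    intro ρ hρ u
    have hu := h.resc h.z hρ
    have := hu.lf
    obtain ⟨b, hb⟩ := exists_b (_root_.resc ν 0 ρ)
    by_cases h0 : b = 0
    · rw [hb, h0, inner_zero_left]
    exfalso
    have h1 : ∀ x ∈ msupp l, ⟪‖b‖⁻¹ • b, x⟫ = 0 := fun x hx => by
      rw [real_inner_smul_left, ← hb, ((hl.tan hx).resc hρ).bl hu, mul_zero]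
    have h2 := hlN (‖b‖⁻¹ • b) (by
      rw [norm_smul, norm_inv, norm_norm, inv_mul_cancel₀ (norm_ne_zero_iff.2 h0)])
    rw [q_zero_of l h1] at h2
    linarith
  have hg : Good l := ⟨hl.1, fun x hx => hl.q h hb hx⟩
  rcases hg.classify with ⟨e, he⟩ | ⟨e, he⟩
  · exfalso
    have h1 := hlN (e 3) (e.norm_eq_one 3)
    rw [he.diag] at h1
    simp [aF] at h1
    linarith
  refine ⟨e, fun ρ hρ i j => ?_⟩
  have hu := h.resc h.z hρ
  have := hu.lf
  have key := he.form (c := fun i j => q (_root_.resc ν 0 ρ) (e i) (e j) - if i = j then 1 else 0)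
    (fun x hx => by
      have h1 := ((hl.tan hx).resc hρ).q hu (hb ρ hρ)
      rw [q_exp _ e, ← OB.norm_sq e x] at h1
      simp only [sub_mul, Finset.sum_sub_distrib]
      rw [sub_eq_zero]
      calc _ = _ := ?_
        _ = _ := h1
        _ = _ := ?_
      · exact Finset.sum_congr rfl fun p _ => Finset.sum_congr rfl fun s _ => by ring
      · refine Finset.sum_congr rfl fun p _ => ?_
        simp [pow_two])
    (fun i j => by simp only [q_comm _ (e i) (e j), eq_comm (a := i)])
    (by
      have := hu.q_trace e
      simp only [if_true, Finset.sum_sub_distrib, this]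
      simp; norm_num) i j
  split_ifs at key ⊢ <;> linarith

/-- scaled weight -/
def Ws (s : ℝ) (z : E 4) : ℝ := max 0 (s ^ 2 - ‖z‖ ^ 2)

lemma Ws_cont (s : ℝ) : Continuous (Ws s) := by unfold Ws; fun_prop

lemma Ws_wt {s : ℝ} (hs : 0 < s) (z : E 4) : Ws s z = s ^ 2 * wt (s⁻¹ • z) := by
  unfold Ws wt
  rw [mul_max_of_nonneg _ _ (by positivity), mul_zero, norm_smul, norm_inv, Real.norm_of_nonneg hs.le]
  congr 1
  field_simp

lemma Ws_zero {s : ℝ} (hs : 0 < s) {z : E 4} (h : s < ‖z‖) : Ws s z = 0 := by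
  unfold Ws; apply max_eq_left; nlinarith

lemma Ws_eq {s : ℝ} {z : E 4} (h : ‖z‖ ≤ s) : Ws s z = s ^ 2 - ‖z‖ ^ 2 := by
  unfold Ws; apply max_eq_right; nlinarith [norm_nonneg z]

lemma Ws_supp {s : ℝ} (hs : 0 < s) (f : E 4 → ℝ) : HasCompactSupport (fun z => Ws s z * f z) := by
  refine HasCompactSupport.intro (isCompact_closedBall 0 s) fun z hz => ?_
  rw [mem_closedBall_zero_iff, not_le] at hz
  rw [Ws_zero hs hz, zero_mul]

lemma Ws_int (ν : Measure (E 4)) {s : ℝ} (hs : 0 < s) (u v : E 4) :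
    ∫ z, Ws s z * (⟪u, z⟫ * ⟪v, z⟫) ∂ν = s ^ 7 * (2 * omega3 / 35) * q (resc ν 0 s) u v := by
  have ho := omega3_pos
  have hc := wt_cont
  have e : ∀ z, Ws s z * (⟪u, z⟫ * ⟪v, z⟫)
      = s ^ 4 * (wt (s⁻¹ • (z - 0)) * (⟪u, s⁻¹ • (z - 0)⟫ * ⟪v, s⁻¹ • (z - 0)⟫)) := fun z => by
    rw [sub_zero, Ws_wt hs, real_inner_smul_right, real_inner_smul_right]
    field_simp
  simp only [e, integral_const_mul]
  unfold q
  rw [resc_int ν 0 hs (fun z => wt z * (⟪u, z⟫ * ⟪v, z⟫)) (by fun_prop)]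
  field_simp

lemma inner_prod_le {u v z : E 4} (hu : ‖u‖ = 1) (hv : ‖v‖ = 1) : |⟪u, z⟫ * ⟪v, z⟫| ≤ ‖z‖ ^ 2 := by
  have h1 := abs_real_inner_le_norm u z
  have h2 := abs_real_inner_le_norm v z
  rw [hu, one_mul] at h1
  rw [hv, one_mul] at h2
  rw [abs_mul, pow_two]
  exact mul_le_mul h1 h2 (abs_nonneg _) (norm_nonneg _)

lemma chi_err (ν : Measure (E 4)) [IsLocallyFiniteMeasure ν] {s : ℝ} (hs : 1 < s) {u v : E 4}
    (hu : ‖u‖ = 1) (hv : ‖v‖ = 1) :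
    |(∫ z, Ws s z * (⟪u, z⟫ * ⟪v, z⟫) ∂ν - ∫ z, Ws 1 z * (⟪u, z⟫ * ⟪v, z⟫) ∂ν) / (s ^ 2 - 1)
      - ∫ z in closedBall (0 : E 4) 1, ⟪u, z⟫ * ⟪v, z⟫ ∂ν|
    ≤ s ^ 2 * (ν.real (closedBall 0 s) - ν.real (closedBall 0 1)) := by
  have hs0 : 0 < s := by linarith
  have hs2 : 0 < s ^ 2 - 1 := by nlinarith
  have c1 := Ws_cont s
  have c2 := Ws_cont 1
  have i1 : Integrable (fun z => Ws s z * (⟪u, z⟫ * ⟪v, z⟫)) ν :=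
    Continuous.integrable_of_hasCompactSupport (by fun_prop) (Ws_supp hs0 _)
  have i2 : Integrable (fun z => Ws 1 z * (⟪u, z⟫ * ⟪v, z⟫)) ν :=
    Continuous.integrable_of_hasCompactSupport (by fun_prop) (Ws_supp one_pos _)
  have i3 : IntegrableOn (fun z : E 4 => ⟪u, z⟫ * ⟪v, z⟫) (closedBall 0 1) ν :=
    ContinuousOn.integrableOn_compact (isCompact_closedBall 0 1) (by fun_prop)
  have i3' := (integrable_indicator_iff measurableSet_closedBall).2 i3
  have fin : ∀ t : ℝ, ν (closedBall (0 : E 4) t) ≠ ⊤ := fun t => (isCompact_closedBall 0 t).measure_ne_top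
  have i4 : ∀ t : ℝ, Integrable ((closedBall (0 : E 4) t).indicator (1 : E 4 → ℝ)) ν := fun t =>
    (integrable_indicator_iff measurableSet_closedBall).2
      (integrableOn_const (C := (1 : ℝ)) (fin t))
  rw [← integral_sub i1 i2, ← integral_div, ← integral_indicator measurableSet_closedBall]
  have i5 : Integrable (fun z => (Ws s z * (⟪u, z⟫ * ⟪v, z⟫) - Ws 1 z * (⟪u, z⟫ * ⟪v, z⟫)) / (s ^ 2 - 1)) ν :=
    (i1.sub i2).div_const _
  rw [← integral_sub i5 i3']
  have e1 : s ^ 2 * (ν.real (closedBall 0 s) - ν.real (closedBall 0 1))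
      = ∫ z, s ^ 2 * ((closedBall (0 : E 4) s).indicator 1 z - (closedBall (0 : E 4) 1).indicator 1 z) ∂ν := by
    rw [integral_const_mul, integral_sub (i4 s) (i4 1), integral_indicator_one measurableSet_closedBall,
      integral_indicator_one measurableSet_closedBall]
  rw [e1, ← Real.norm_eq_abs]
  refine norm_integral_le_of_norm_le (((i4 s).sub (i4 1)).const_mul _) (Eventually.of_forall fun z => ?_)
  rw [Real.norm_eq_abs]
  have hF := inner_prod_le (z := z) hu hv
  by_cases hz : ‖z‖ ≤ 1
  · have m1 : z ∈ closedBall (0 : E 4) 1 := by simpa using hz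
    have m2 : z ∈ closedBall (0 : E 4) s := by simpa using hz.trans hs.le
    rw [indicator_of_mem m1, indicator_of_mem m1, indicator_of_mem m2, Ws_eq hz, Ws_eq (hz.trans hs.le)]
    rw [show (s ^ 2 - ‖z‖ ^ 2) * (⟪u, z⟫ * ⟪v, z⟫) - (1 ^ 2 - ‖z‖ ^ 2) * (⟪u, z⟫ * ⟪v, z⟫)
      = (s ^ 2 - 1) * (⟪u, z⟫ * ⟪v, z⟫) by ring, mul_div_cancel_left₀ _ hs2.ne']
    simp
  · have m1 : z ∉ closedBall (0 : E 4) 1 := by simpa using hz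
    rw [not_le] at hz
    rw [indicator_of_notMem m1, indicator_of_notMem m1, Ws_zero one_pos hz]
    by_cases hz2 : ‖z‖ ≤ s
    · have m2 : z ∈ closedBall (0 : E 4) s := by simpa using hz2
      rw [indicator_of_mem m2, Ws_eq hz2]
      simp only [zero_mul, sub_zero, Pi.one_apply, mul_one]
      rw [abs_div, abs_mul, abs_of_pos hs2, div_le_iff₀ hs2, abs_of_nonneg (by nlinarith [norm_nonneg z])]
      have h1 : s ^ 2 - ‖z‖ ^ 2 ≤ s ^ 2 - 1 := by nlinarith
      have h2 : ‖z‖ ^ 2 ≤ s ^ 2 := by nlinarith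
      have h3 : 0 ≤ s ^ 2 - ‖z‖ ^ 2 := by linarith
      rw [mul_comm (s ^ 2)]
      exact mul_le_mul h1 (hF.trans h2) (abs_nonneg _) hs2.le
    · have m2 : z ∉ closedBall (0 : E 4) s := by simpa using hz2
      rw [not_le] at hz2
      rw [indicator_of_notMem m2, Ws_zero hs0 hz2]
      simp

lemma ball_mom {ι : Type} {U : Ultrafilter ι} {μs : ι → Measure (E 4)} {ν : Measure (E 4)}
    (hA : AU U μs) (hL : ULim U μs ν) {u v : E 4} (hu : ‖u‖ = 1) (hv : ‖v‖ = 1) {M : ℝ}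
    (hM : ∀ ρ > 0, q (resc ν 0 ρ) u v = M) :
    Tendsto (fun i => 5 / omega3 * ∫ z in closedBall (0 : E 4) 1, ⟪u, z⟫ * ⟪v, z⟫ ∂(μs i)) U (𝓝 M) := by
  have ho := omega3_pos
  rw [Metric.tendsto_nhds]
  intro ε hε
  have l1 : Tendsto (fun s : ℝ => 2 / 7 * ((s ^ 6 + s ^ 5 + s ^ 4 + s ^ 3 + s ^ 2 + s + 1) / (s + 1)) * M)
      (𝓝[>] 1) (𝓝 M) := by
    have hc : ContinuousAt (fun s : ℝ => 2 / 7 * ((s ^ 6 + s ^ 5 + s ^ 4 + s ^ 3 + s ^ 2 + s + 1) / (s + 1)) * M) 1 := by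
      refine ContinuousAt.mul (ContinuousAt.mul continuousAt_const
        (ContinuousAt.div (by fun_prop) (by fun_prop) (by norm_num))) continuousAt_const
    have := hc.tendsto
    norm_num at this
    exact this.mono_left nhdsWithin_le_nhds
  have l2 : Tendsto (fun s : ℝ => 5 * (s ^ 2 * (s ^ 3 - 1))) (𝓝[>] 1) (𝓝 0) := by
    have hc : Continuous (fun s : ℝ => 5 * (s ^ 2 * (s ^ 3 - 1))) := by fun_prop
    have := hc.tendsto 1
    norm_num at this
    exact this.mono_left nhdsWithin_le_nhds
  have l3 : ∀ᶠ s : ℝ in 𝓝[>] 1, s < 2 :=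
    (eventually_lt_nhds (by norm_num)).filter_mono nhdsWithin_le_nhds
  obtain ⟨s, ⟨⟨h1, h2⟩, h3⟩, h4⟩ := (((Metric.tendsto_nhds.1 l1 (ε / 4) (by positivity)).and
    (l2.eventually_lt_const (u := ε / 4) (by positivity))).and l3).and self_mem_nhdsWithin |>.exists
  have h4 : 1 < s := h4
  have hs0 : 0 < s := by linarith
  have hs2 : 0 < s ^ 2 - 1 := by nlinarith
  have c1 := Ws_cont s
  have c2 := Ws_cont 1
  have t1 := hL.conv (fun z => Ws s z * (⟪u, z⟫ * ⟪v, z⟫)) (by fun_prop) (Ws_supp hs0 _)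
  have t2 := hL.conv (fun z => Ws 1 z * (⟪u, z⟫ * ⟪v, z⟫)) (by fun_prop) (Ws_supp one_pos _)
  have t3 := ((t1.sub t2).div_const (s ^ 2 - 1)).const_mul (5 / omega3)
  have e3 : 5 / omega3 * ((∫ z, Ws s z * (⟪u, z⟫ * ⟪v, z⟫) ∂ν - ∫ z, Ws 1 z * (⟪u, z⟫ * ⟪v, z⟫) ∂ν) / (s ^ 2 - 1))
      = 2 / 7 * ((s ^ 6 + s ^ 5 + s ^ 4 + s ^ 3 + s ^ 2 + s + 1) / (s + 1)) * M := by
    rw [Ws_int ν hs0, Ws_int ν one_pos, hM s hs0, hM 1 one_pos]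
    have : s + 1 ≠ 0 := by linarith
    field_simp
    ring
  rw [e3] at t3
  filter_upwards [Metric.tendsto_nhds.1 t3 (ε / 4) (by positivity),
    hA.u 2 (ε * omega3 / 160) (by norm_num) (by positivity)] with i g1 g2
  have := hA.lf i
  have g3 := chi_err (μs i) h4 hu hv
  have g4 := g2 0 (hA.z i) (by simp) s hs0 h3.le
  have g5 := g2 0 (hA.z i) (by simp) 1 one_pos one_le_two
  rw [Real.dist_eq] at g1 h1 ⊢
  generalize (∫ z, Ws s z * (⟪u, z⟫ * ⟪v, z⟫) ∂(μs i) - ∫ z, Ws 1 z * (⟪u, z⟫ * ⟪v, z⟫) ∂(μs i)) / (s ^ 2 - 1) = A at *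
  generalize (∫ z in closedBall (0 : E 4) 1, ⟪u, z⟫ * ⟪v, z⟫ ∂(μs i)) = B at *
  generalize 2 / 7 * ((s ^ 6 + s ^ 5 + s ^ 4 + s ^ 3 + s ^ 2 + s + 1) / (s + 1)) * M = N at *
  have k1 : s ^ 2 * ((μs i).real (closedBall 0 s) - (μs i).real (closedBall 0 1))
      ≤ s ^ 2 * (omega3 * (s ^ 3 - 1) + ε * omega3 / 80) := by
    refine mul_le_mul_of_nonneg_left ?_ (by positivity)
    have := (abs_le.1 g4).2
    have := (abs_le.1 g5).1
    linarith
  have k2 : s ^ 2 * (ε * omega3 / 80) ≤ 4 * (ε * omega3 / 80) :=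
    mul_le_mul_of_nonneg_right (by nlinarith) (by positivity)
  have k3 : |5 / omega3 * A - 5 / omega3 * B| < ε / 2 := by
    rw [← mul_sub, abs_mul, abs_of_pos (by positivity : 0 < 5 / omega3), div_mul_eq_mul_div, div_lt_iff₀ ho]
    have : 5 * (s ^ 2 * (s ^ 3 - 1)) * omega3 < ε / 4 * omega3 := mul_lt_mul_of_pos_right h2 ho
    nlinarith
  have k4 := abs_lt.1 k3
  have k5 := abs_lt.1 g1
  have k6 := abs_lt.1 h1
  rw [abs_lt]
  constructor <;> linarith [k4.1, k4.2, k5.1, k5.2, k6.1, k6.2]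

lemma qmom_resc (μ : Measure (E 4)) {r : ℝ} (hr : 0 < r) (u v : E 4) :
    qmom μ r u v = 5 / omega3 * ∫ z in closedBall (0 : E 4) 1, ⟪u, z⟫ * ⟪v, z⟫ ∂(resc μ 0 r) := by
  have ho := omega3_pos
  have e : ∫ z in closedBall (0 : E 4) 1, ⟪u, z⟫ * ⟪v, z⟫ ∂(resc μ 0 r)
      = r⁻¹ ^ 5 * ∫ z in closedBall (0 : E 4) r, ⟪u, z⟫ * ⟪v, z⟫ ∂μ := by
    have hm : AEStronglyMeasurable ((closedBall (0 : E 4) 1).indicator fun z => ⟪u, z⟫ * ⟪v, z⟫)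
        (Measure.map (fun y => r⁻¹ • (y - 0)) μ) :=
      ((by fun_prop : Continuous fun z : E 4 => ⟪u, z⟫ * ⟪v, z⟫).measurable.indicator
        measurableSet_closedBall).aestronglyMeasurable
    rw [← integral_indicator measurableSet_closedBall, ← integral_indicator measurableSet_closedBall,
      resc, integral_smul_measure, ENNReal.toReal_ofReal (by positivity),
      integral_map (resc_meas 0 r).aemeasurable hm, smul_eq_mul, ← integral_const_mul,
      ← integral_const_mul]
    congr 1
    ext z
    have hz : r⁻¹ • (z - 0) ∈ closedBall (0 : E 4) 1 ↔ z ∈ closedBall (0 : E 4) r := by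
      rw [sub_zero, mem_closedBall_zero_iff, mem_closedBall_zero_iff, norm_smul, norm_inv,
        Real.norm_of_nonneg hr.le, inv_mul_le_iff₀ hr, mul_one]
    by_cases h : z ∈ closedBall (0 : E 4) r
    · rw [indicator_of_mem h, indicator_of_mem (hz.2 h), sub_zero, real_inner_smul_right,
        real_inner_smul_right]
      ring
    · rw [indicator_of_notMem h, indicator_of_notMem (fun h' => h (hz.1 h')), mul_zero, mul_zero]
  rw [e, qmom]
  field_simp

lemma final (μ : Measure (E 4)) {α C₀ : ℝ} (h : Hyp μ α C₀)
    (hnf : ¬ Tendsto (fun r : ℝ => thetaP 3 (msupp μ) 0 r) (𝓝[>] 0) (𝓝 0)) {δ : ℝ} (hδ : 0 < δ) :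
    ∃ r₀ : ℝ, 0 < r₀ ∧ ∀ r : ℝ, 0 < r → r ≤ r₀ →
      ∃ b : OrthonormalBasis (Fin 4) ℝ (E 4),
        (∀ i : Fin 4, i ≠ 3 → |qmom μ r (b i) (b i) - 1 / 2| < δ) ∧
        |qmom μ r (b 3) (b 3) - 3 / 2| < δ ∧
        (∀ i j : Fin 4, i ≠ j → |qmom μ r (b i) (b j)| < δ) := by
  by_contra hcon
  push Not at hcon
  obtain ⟨c, hc, hB⟩ := h.claimB hnf
  choose r hr0 hr1 hr2 using fun n : ℕ => hcon (1 / ((n : ℝ) + 1)) (by positivity)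
  have hr : Tendsto r atTop (𝓝 0) := squeeze_zero (fun n => (hr0 n).le) hr1
    tendsto_one_div_add_atTop_nhds_zero_nat
  have hA := h.au (U := hyperfilter ℕ) hr0 (hyper_le hr)
  obtain ⟨ν, hν, hL⟩ := hA.exists_ulim
  have hN : ∀ ρ > 0, NF c (resc ν 0 ρ) := by
    intro ρ hρ
    refine (hL.resc hρ).NF ?_
    simp only [resc_resc μ (hr0 _) hρ]
    have ht : Tendsto (fun n => r n * ρ) atTop (𝓝[>] 0) := by
      rw [tendsto_nhdsWithin_iff]
      exact ⟨by simpa using hr.mul_const ρ, Eventually.of_forall fun n => mul_pos (hr0 n) hρ⟩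
    exact (hyper_le ht).eventually hB
  obtain ⟨e, he⟩ := hν.struct hc hN
  have key : ∀ i j, ∀ᶠ n in (hyperfilter ℕ : Filter ℕ),
      |qmom μ (r n) (e i) (e j) - if i = j then 1 + aK i else 0| < δ := fun i j => by
    have := ball_mom hA hL (e.norm_eq_one i) (e.norm_eq_one j) (fun ρ hρ => he ρ hρ i j)
    have := Metric.tendsto_nhds.1 this δ hδ
    filter_upwards [this] with n hn
    rwa [qmom_resc μ (hr0 n)]
  have key2 : ∀ᶠ n in (hyperfilter ℕ : Filter ℕ), ∀ i j,
      |qmom μ (r n) (e i) (e j) - if i = j then 1 + aK i else 0| < δ := by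
    rw [eventually_all]; intro i
    rw [eventually_all]; intro j
    exact key i j
  obtain ⟨n, hn⟩ := key2.exists
  obtain ⟨i, j, hij, h3⟩ := hr2 n e (fun i hi => by
    have := hn i i
    simp only [if_true, aK, hi, if_false] at this
    convert this using 3
    norm_num) (by
    have := hn 3 3
    simp only [if_true, aK] at this
    convert this using 3
    norm_num)
  have := hn i j
  simp only [hij, if_false, sub_zero] at this
  linarith

/-- Lemma 4.4 / `QvsK`: at small scales the second-moment matrix of a
Hölder asymptotically uniform measure on `ℝ⁴` at a nonflat point is close, in some
orthonormal basis, to `diag(1/2, 1/2, 1/2, 3/2)`. -/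
theorem second_moment_matrix_near_K (μ : Measure (E 4))
    (hRadon : IsLocallyFiniteMeasure μ) (S : Set (E 4)) (hS : S = msupp μ)
    (h0 : (0 : E 4) ∈ S)
    (hnf : ¬ Tendsto (fun r : ℝ => thetaP 3 S 0 r) (nhdsWithin 0 (Set.Ioi 0)) (nhds 0))
    (α C₀ : ℝ) (hα : 0 < α)
    (hreg : ∀ x ∈ S ∩ closedBall (0 : E 4) 1, ∀ r : ℝ, 0 < r → r ≤ 1 →
      |(μ (closedBall x r)).toReal / (omega3 * r ^ 3) - 1| ≤ C₀ * r ^ α)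
    (δ : ℝ) (hδ : 0 < δ) :
    ∃ r₀ : ℝ, 0 < r₀ ∧ ∀ r : ℝ, 0 < r → r ≤ r₀ →
      ∃ b : OrthonormalBasis (Fin 4) ℝ (E 4),
        (∀ i : Fin 4, i ≠ 3 → |qmom μ r (b i) (b i) - 1 / 2| < δ) ∧
        |qmom μ r (b 3) (b 3) - 3 / 2| < δ ∧
        (∀ i j : Fin 4, i ≠ j → |qmom μ r (b i) (b j)| < δ) := by
  subst hS
  exact final μ ⟨hRadon, h0, hα, hreg⟩ hnf hδ
end
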